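/- arXiv:1311.4382 — 3 statements merged into one kernel-verified Lean document; each statement's English description precedes it below -/
import Mathlib

section
/- The number of intervals in the Tamari lattice on binary trees with n internal nodes equals 2/(n(n+1)) * binomial(4n+1, n-1). -/
open Tree

/-- One right rotation somewhere in a binary tree: `y(x(A,B),C) → x(A,y(B,C))`. -/
inductive RightRot : Tree Unit → Tree Unit → Prop
  | root (A B C : Tree Unit) :
      RightRot (node () (node () A B) C) (node () A (node () B C))
  | left {A A' : Tree Unit} (B : Tree Unit) :
      RightRot A A' → RightRot (node () A B) (node () A' B)
  | right (A : Tree Unit) {B B' : Tree Unit} :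
      RightRot B B' → RightRot (node () A B) (node () A B')

/-- The Tamari order on binary trees: reflexive-transitive closure of right rotation. -/
def tamariLE : Tree Unit → Tree Unit → Prop := Relation.ReflTransGen RightRot

namespace TamariInterval

/-- The number of internal nodes on the leftmost branch. -/
def leftSpine : BinaryTree Unit → ℕ
  | .nil => 0
  | .node _ A _ => leftSpine A + 1

/-- Replace the subtree `S` of `T` at depth `k` of the leftmost branch by the tree with left
subtree `L` and right subtree `S`. -/
def graft (L : BinaryTree Unit) : ℕ → BinaryTree Unit → BinaryTree Unit
  | 0, T => .node () L T
  | _ + 1, .nil => .node () L .nil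
  | k + 1, .node _ B C => .node () (graft L k B) C

theorem leftSpine_graft (L : BinaryTree Unit) (k : ℕ) (T : BinaryTree Unit)
    (hk : k ≤ leftSpine T) : leftSpine (graft L k T) = leftSpine L + 1 + k := by
  induction k generalizing T with
  | zero => simp [graft, leftSpine]
  | succ k ih =>
    cases T with
    | nil => simp [leftSpine] at hk
    | node a B C =>
      simp only [leftSpine] at hk
      simp only [graft, leftSpine, ih B (by omega)]
      omega

theorem numNodes_graft (L : BinaryTree Unit) (k : ℕ) (T : BinaryTree Unit) :
    (graft L k T).numNodes = L.numNodes + T.numNodes + 1 := by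
  induction k generalizing T with
  | zero => simp [graft, BinaryTree.numNodes]
  | succ k ih =>
    cases T with
    | nil => simp [graft, BinaryTree.numNodes]
    | node a B C =>
      simp only [graft, BinaryTree.numNodes, ih]
      omega

theorem graft_injective {L L' : BinaryTree Unit} (hL : L.numNodes = L'.numNodes) {k k' : ℕ}
    {T T' : BinaryTree Unit} (hk : k ≤ leftSpine T) (hk' : k' ≤ leftSpine T')
    (h : graft L k T = graft L' k' T') : L = L' ∧ T = T' ∧ k = k' := by
  induction k generalizing T T' k' with
  | zero =>
    cases k' with
    | zero => simpa [graft] using h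
    | succ k' =>
      cases T' with
      | nil => simp [leftSpine] at hk'
      | node a B C =>
        simp only [graft, BinaryTree.node.injEq] at h
        have := congrArg BinaryTree.numNodes h.2.1
        rw [numNodes_graft] at this
        omega
  | succ k ih =>
    cases T with
    | nil => simp [leftSpine] at hk
    | node a B C =>
      cases k' with
      | zero =>
        simp only [graft, BinaryTree.node.injEq] at h
        have := congrArg BinaryTree.numNodes h.2.1
        rw [numNodes_graft] at this
        omega
      | succ k' =>
        cases T' with
        | nil => simp [leftSpine] at hk'
        | node a' B' C' =>
          simp only [graft, BinaryTree.node.injEq] at h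
          simp only [leftSpine] at hk hk'
          obtain ⟨h₁, h₂, h₃⟩ := ih (by omega) (by omega) h.2.1
          simp [h₁, h₂, h₃, h.2.2]

theorem numNodes_eq_of_rightRot {S T : BinaryTree Unit} (h : RightRot S T) :
    S.numNodes = T.numNodes := by
  induction h <;> grind [BinaryTree.numNodes]

theorem numNodes_eq_of_tamariLE {S T : BinaryTree Unit} (h : tamariLE S T) :
    S.numNodes = T.numNodes := by
  induction h with
  | refl => rfl
  | tail _ h ih => exact ih.trans (numNodes_eq_of_rightRot h)

theorem tamariLE_node {A A' B B' : BinaryTree Unit} (hA : tamariLE A A') (hB : tamariLE B B') :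
    tamariLE (.node () A B) (.node () A' B') :=
  (hA.lift (fun S => BinaryTree.node () S B) fun _ _ h => RightRot.left B h).trans
    (hB.lift (BinaryTree.node () A') fun _ _ h => RightRot.right A' h)

theorem graft_tamariLE_node (L : BinaryTree Unit) (k : ℕ) (T : BinaryTree Unit) :
    tamariLE (graft L k T) (.node () L T) := by
  induction k generalizing T with
  | zero => exact .refl
  | succ k ih =>
    cases T with
    | nil => exact .refl
    | node a B C =>
      exact (tamariLE_node (ih B) (Relation.ReflTransGen.refl (a := C))).tail (RightRot.root L B C)

theorem exists_graft_of_rightRot {S L R : BinaryTree Unit} {k : ℕ} (hk : k ≤ leftSpine R)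
    (h : RightRot S (graft L k R)) :
    ∃ L' R' k', k' ≤ leftSpine R' ∧ S = graft L' k' R' ∧ tamariLE L' L ∧ tamariLE R' R := by
  induction k generalizing S R with
  | zero =>
    simp only [graft] at h
    cases h with
    | root A B C =>
      exact ⟨L, .node () B C, 1, by simp [leftSpine], by simp [graft], .refl, .refl⟩
    | left B h => exact ⟨_, R, 0, by simp, rfl, .single h, .refl⟩
    | right A h => exact ⟨L, _, 0, by simp, rfl, .refl, .single h⟩
  | succ k ih =>
    cases R with
    | nil => simp [leftSpine] at hk
    | node a B C =>
      simp only [leftSpine] at hk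
      simp only [graft] at h
      generalize hG : graft L k B = G at h
      cases h with
      | root A B' C' =>
        subst hG
        exact ⟨L, .node () (.node () B B') C', k + 2, by simp only [leftSpine]; omega,
          by simp [graft], .refl, .single (RightRot.root B B' C')⟩
      | left C h =>
        subst hG
        obtain ⟨L', B', k', hk', rfl, hL, hB⟩ := ih (by omega) h
        exact ⟨L', .node () B' C, k' + 1, by simp only [leftSpine]; omega, rfl, hL,
          tamariLE_node hB .refl⟩
      | right A h =>
        subst hG
        exact ⟨L, .node () B _, k + 1, by simp only [leftSpine]; omega, rfl, .refl,
          tamariLE_node .refl (.single h)⟩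

theorem tamariLE_node_iff {S L R : BinaryTree Unit} :
    tamariLE S (.node () L R) ↔
      ∃ L' R' k, k ≤ leftSpine R' ∧ S = graft L' k R' ∧ tamariLE L' L ∧ tamariLE R' R := by
  constructor
  · intro h
    induction h using Relation.ReflTransGen.head_induction_on with
    | refl => exact ⟨L, R, 0, by simp, rfl, .refl, .refl⟩
    | head h _ ih =>
      obtain ⟨L₁, R₁, k₁, hk₁, rfl, hL₁, hR₁⟩ := ih
      obtain ⟨L₂, R₂, k₂, hk₂, rfl, hL₂, hR₂⟩ := exists_graft_of_rightRot hk₁ h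
      exact ⟨L₂, R₂, k₂, hk₂, rfl, hL₂.trans hL₁, hR₂.trans hR₁⟩
  · rintro ⟨L', R', k, -, rfl, hL, hR⟩
    exact (graft_tamariLE_node L' k R').trans (tamariLE_node hL hR)

open Classical in
/-- The finite set of Tamari intervals on trees with `n` internal nodes. -/
noncomputable def intervals (n : ℕ) : Finset (BinaryTree Unit × BinaryTree Unit) :=
  (BinaryTree.treesOfNumNodesEq n ×ˢ BinaryTree.treesOfNumNodesEq n).filter
    fun p => tamariLE p.1 p.2

theorem mem_intervals {n : ℕ} {p : BinaryTree Unit × BinaryTree Unit} :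
    p ∈ intervals n ↔ p.1.numNodes = n ∧ p.2.numNodes = n ∧ tamariLE p.1 p.2 := by
  simp [intervals, BinaryTree.mem_treesOfNumNodesEq, and_assoc]

variable {R : Type*} [CommRing R]

/-- The polynomial enumerating the intervals of size `n` by the length of the leftmost branch of
their lower tree, evaluated at `x`. -/
noncomputable def spinePoly (n : ℕ) (x : R) : R := ∑ p ∈ intervals n, x ^ leftSpine p.1

theorem spinePoly_one (n : ℕ) : spinePoly n (1 : R) = (intervals n).card := by
  simp [spinePoly]

theorem map_spinePoly {S : Type*} [CommRing S] (f : R →+* S) (n : ℕ) (x : R) :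
    f (spinePoly n x) = spinePoly n (f x) := by
  simp [spinePoly]

theorem spinePoly_zero (x : R) : spinePoly 0 x = 1 := by
  have : intervals 0 = {(.nil, .nil)} := by
    ext ⟨S, T⟩
    rw [mem_intervals]
    cases S <;> cases T <;> simp [BinaryTree.numNodes]
    exact .refl
  simp [spinePoly, this, leftSpine]

theorem spinePoly_succ_eq_sum (n : ℕ) (x : R) :
    spinePoly (n + 1) x = ∑ ij ∈ Finset.HasAntidiagonal.antidiagonal n, ∑ p ∈ intervals ij.1,
      ∑ q ∈ intervals ij.2, ∑ k ∈ Finset.range (leftSpine q.1 + 1),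
        x ^ (leftSpine p.1 + 1 + k) := by
  simp_rw [Finset.sum_sigma']
  symm
  refine Finset.sum_bij (fun s _ => (graft s.2.1.1 s.2.2.2 s.2.2.1.1,
    .node () s.2.1.2 s.2.2.1.2)) ?_ ?_ ?_ ?_
  · rintro ⟨⟨i, j⟩, ⟨L', L⟩, ⟨R', R⟩, k⟩ h
    simp only [Finset.mem_sigma, Finset.HasAntidiagonal.mem_antidiagonal, mem_intervals,
      Finset.mem_range] at h
    obtain ⟨rfl, ⟨rfl, hL, hLL⟩, ⟨rfl, hR, hRR⟩, hk⟩ := h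
    simp only [mem_intervals, numNodes_graft, BinaryTree.numNodes, hL, hR, true_and]
    exact tamariLE_node_iff.2 ⟨L', R', k, by omega, rfl, hLL, hRR⟩
  · rintro ⟨⟨i, j⟩, ⟨L', L⟩, ⟨R', R⟩, k⟩ h ⟨⟨i₁, j₁⟩, ⟨L₁', L₁⟩, ⟨R₁', R₁⟩, k₁⟩ h₁ he
    simp only [Finset.mem_sigma, Finset.HasAntidiagonal.mem_antidiagonal, mem_intervals,
      Finset.mem_range] at h h₁
    simp only [Prod.mk.injEq, BinaryTree.node.injEq, true_and] at he
    obtain ⟨he, rfl, rfl⟩ := he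
    obtain ⟨-, ⟨rfl, hL, -⟩, ⟨rfl, hR, -⟩, hk⟩ := h
    obtain ⟨-, ⟨rfl, hL₁, -⟩, ⟨rfl, hR₁, -⟩, hk₁⟩ := h₁
    obtain ⟨rfl, rfl, rfl⟩ := graft_injective (hL.symm.trans hL₁) (by omega) (by omega) he
    rfl
  · rintro ⟨S, T⟩ h
    obtain ⟨hS, hT, hST⟩ := mem_intervals.1 h
    cases T with
    | nil => simp [BinaryTree.numNodes] at hT
    | node a L R =>
      obtain ⟨L', R', k, hk, rfl, hL, hR⟩ := tamariLE_node_iff.1 hST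
      have hL' := numNodes_eq_of_tamariLE hL
      have hR' := numNodes_eq_of_tamariLE hR
      simp only [BinaryTree.numNodes] at hT
      refine ⟨⟨(L.numNodes, R.numNodes), (L', L), (R', R), k⟩, ?_, rfl⟩
      simp only [Finset.mem_sigma, Finset.HasAntidiagonal.mem_antidiagonal, mem_intervals,
        Finset.mem_range]
      exact ⟨by omega, ⟨hL', trivial, hL⟩, ⟨hR', trivial, hR⟩, by omega⟩
  · rintro ⟨⟨i, j⟩, ⟨L', L⟩, ⟨R', R⟩, k⟩ h
    simp only [Finset.mem_sigma, Finset.mem_range] at h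
    rw [leftSpine_graft _ _ _ (Nat.lt_succ_iff.1 h.2.2.2)]

theorem sub_one_mul_spinePoly_succ (n : ℕ) (x : R) :
    (x - 1) * spinePoly (n + 1) x = x * ∑ ij ∈ Finset.HasAntidiagonal.antidiagonal n,
      spinePoly ij.1 x * (x * spinePoly ij.2 x - spinePoly ij.2 1) := by
  have geom (a s : ℕ) : ∑ k ∈ Finset.range (s + 1), (x - 1) * x ^ (a + 1 + k) =
      x * (x ^ a * (x * x ^ s - 1)) := by
    simp_rw [pow_add x (a + 1), ← mul_assoc, ← Finset.mul_sum]
    linear_combination x ^ (a + 1) * mul_geom_sum x (s + 1)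
  simp_rw [spinePoly_succ_eq_sum, Finset.mul_sum, geom]
  refine Finset.sum_congr rfl fun ij _ => ?_
  simp_rw [spinePoly, Finset.sum_mul, Finset.mul_sum, one_pow,
    ← Finset.sum_sub_distrib, Finset.mul_sum]

open Polynomial in
theorem pow_dvd_sum_mul_sum_sub (a b : ℕ → R) (t : R) (N : ℕ) :
    t ^ N ∣ (∑ n ∈ Finset.range N, a n * t ^ n) * (∑ n ∈ Finset.range N, b n * t ^ n) -
      ∑ n ∈ Finset.range N,
        (∑ ij ∈ Finset.HasAntidiagonal.antidiagonal n, a ij.1 * b ij.2) * t ^ n := by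
  have key : (X : R[X]) ^ N ∣ (∑ n ∈ Finset.range N, C (a n) * X ^ n) *
      (∑ n ∈ Finset.range N, C (b n) * X ^ n) - ∑ n ∈ Finset.range N,
        C (∑ ij ∈ Finset.HasAntidiagonal.antidiagonal n, a ij.1 * b ij.2) * X ^ n := by
    rw [X_pow_dvd_iff]
    intro d hd
    rw [coeff_sub, coeff_mul]
    simp only [finsetSum_coeff, coeff_C_mul, coeff_X_pow, mul_ite, mul_one,
      mul_zero, Finset.sum_ite_eq, Finset.mem_range, hd, if_true]
    rw [sub_eq_zero]
    refine Finset.sum_congr rfl fun ij h => ?_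
    have := Finset.HasAntidiagonal.mem_antidiagonal.1 h
    rw [if_pos (by omega), if_pos (by omega)]
  simpa [eval_finsetSum] using map_dvd (evalRingHom t) key

/-- The functional equation of the interval generating function, truncated at order `N`. -/
theorem pow_dvd_functional_equation (x t : R) (N : ℕ) :
    t ^ N ∣ (x - 1) * (∑ n ∈ Finset.range N, spinePoly n x * t ^ n - 1) -
      x * t * (∑ n ∈ Finset.range N, spinePoly n x * t ^ n) *
        (x * (∑ n ∈ Finset.range N, spinePoly n x * t ^ n) -
          ∑ n ∈ Finset.range N, spinePoly n 1 * t ^ n) := by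
  obtain ⟨c, hc⟩ := pow_dvd_sum_mul_sum_sub (fun n => spinePoly n x)
    (fun n => x * spinePoly n x - spinePoly n 1) t N
  cases N with
  | zero => simp
  | succ N =>
    set P := ∑ n ∈ Finset.range (N + 1), spinePoly n x * t ^ n with hP
    have hK : ∑ n ∈ Finset.range (N + 1), (x * spinePoly n x - spinePoly n 1) * t ^ n =
        x * P - ∑ n ∈ Finset.range (N + 1), spinePoly n 1 * t ^ n := by
      simp_rw [sub_mul, Finset.sum_sub_distrib, hP, Finset.mul_sum, mul_assoc]
    have hstep (M : ℕ) : (x - 1) * (∑ n ∈ Finset.range (M + 1), spinePoly n x * t ^ n - 1) =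
        x * t * ∑ n ∈ Finset.range M, (∑ ij ∈ Finset.HasAntidiagonal.antidiagonal n,
          spinePoly ij.1 x * (x * spinePoly ij.2 x - spinePoly ij.2 1)) * t ^ n := by
      rw [Finset.sum_range_succ', Finset.mul_sum]
      simp only [spinePoly_zero, pow_zero, mul_one, add_sub_cancel_right, Finset.mul_sum]
      refine Finset.sum_congr rfl fun n _ => ?_
      linear_combination t ^ (n + 1) * sub_one_mul_spinePoly_succ n x
    rw [hK] at hc
    have h := hstep (N + 1)
    rw [Finset.sum_range_succ, ← hP] at h
    refine ⟨(1 - x) * spinePoly (N + 1) x - x * t * c, ?_⟩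
    linear_combination h - x * t * hc

section Parametrization

open PowerSeries

/-- The interval generating function at `t = z(1-z)³` equals `(1-2z)/(1-z)³`. The proof compares the
two-variable generating function at `x = (1+u)/(1+zu)²` with the explicit solution of the functional
equation. -/
theorem X_pow_dvd_sum_card_sub (N : ℕ) :
    (X : ℚ⟦X⟧) ^ N ∣ (∑ n ∈ Finset.range N, ((intervals n).card : ℚ⟦X⟧) * (X * (1 - X) ^ 3) ^ n) *
      (1 - X) ^ 3 - (1 - 2 * X) := by
  let z : (Polynomial ℚ)⟦X⟧ := X
  let u : (Polynomial ℚ)⟦X⟧ := C Polynomial.X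
  obtain ⟨w, hw⟩ : ∃ w, (1 + z * u) * w = 1 :=
    (isUnit_iff_constantCoeff.2 (by simp [z])).exists_right_inv
  obtain ⟨v, hv⟩ : ∃ v, (1 - z) * v = 1 :=
    (isUnit_iff_constantCoeff.2 (by simp [z])).exists_right_inv
  let ψ : (Polynomial ℚ)⟦X⟧ →+* ℚ⟦X⟧ := PowerSeries.map (Polynomial.evalRingHom 0)
  let ι : ℚ⟦X⟧ →+* (Polynomial ℚ)⟦X⟧ := PowerSeries.map Polynomial.C
  have hψz : ψ z = X := by simp [ψ, z]
  have hιX : ι X = z := by simp [ι, z]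
  have hψu : ψ u = 0 := by simp [ψ, u]
  have hψw : ψ w = 1 := by simpa [hψu] using congrArg ψ hw
  have hψv : (1 - X) * ψ v = 1 := by simpa [hψz] using congrArg ψ hv
  have hιψv : ι (ψ v) = v := by
    have h : (1 - z) * ι (ψ v) = 1 := by simpa [hιX] using congrArg ι hψv
    linear_combination v * h - ι (ψ v) * hv
  set x := (1 + u) * w ^ 2 with hx
  set t := z * (1 - z) ^ 3 with ht
  have hψx : ψ x = 1 := by simp [hx, hψu, hψw]
  have hψt : ψ t = X * (1 - X) ^ 3 := by simp [ht, hψz]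
  have hιt : ι (X * (1 - X) ^ 3) = t := by simp [ht, hιX]
  set P := ∑ n ∈ Finset.range N, spinePoly n x * t ^ n with hP
  set H := ∑ n ∈ Finset.range N, spinePoly n 1 * t ^ n with hH
  have hψP : ψ P = ∑ n ∈ Finset.range N, spinePoly n 1 * (X * (1 - X) ^ 3) ^ n := by
    simp [hP, map_spinePoly, hψx, hψt]
  have hιP : ι (ψ P) = H := by
    simp only [hψP, map_sum, map_mul, map_pow ι _ _, map_spinePoly, hιt, hH, map_one]
  set P' := (1 + z * u) * (1 - 2 * z - z ^ 2 * u) * v ^ 3 with hP'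
  set H' := (1 - 2 * z) * v ^ 3 with hH'
  have hψP' : ψ P' = (1 - 2 * X) * ψ v ^ 3 := by simp [hP', hψz, hψu, map_ofNat ψ 2]
  have hιP' : ι (ψ P') = H' := by simp [hψP', hιψv, hιX, hH', map_ofNat ι 2]
  have hsol : (x - 1) * (P' - 1) = x * t * P' * (x * P' - H') := by
    have hxt : x * t * P' = (1 + u) * w * z * (1 - 2 * z - z ^ 2 * u) := by
      calc x * t * P' = (1 + u) * w * z * (1 - 2 * z - z ^ 2 * u) *
            ((1 + z * u) * w) * ((1 - z) * v) ^ 3 := by rw [hx, ht, hP']; ring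
        _ = _ := by rw [hw, hv]; ring
    have hxP : x * P' = (1 + u) * w * (1 - 2 * z - z ^ 2 * u) * v ^ 3 := by
      calc x * P' = (1 + u) * w * (1 - 2 * z - z ^ 2 * u) * v ^ 3 * ((1 + z * u) * w) := by
            rw [hx, hP']; ring
        _ = _ := by rw [hw]; ring
    have hx1 : x - 1 = ((1 + u) - (1 + z * u) ^ 2) * w ^ 2 := by
      linear_combination hx + ((1 + z * u) * w + 1) * hw
    have hP1 : P' - 1 = ((1 + z * u) * (1 - 2 * z - z ^ 2 * u) - (1 - z) ^ 3) * v ^ 3 := by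
      linear_combination hP' + (((1 - z) * v) ^ 2 + (1 - z) * v + 1) * hv
    have hHw : H' = (1 - 2 * z) * v ^ 3 * ((1 + z * u) * w) := by rw [hw, mul_one]
    rw [hxt, hxP, hx1, hP1, hHw]
    ring
  obtain ⟨c, hc⟩ := pow_dvd_functional_equation x t N
  rw [← hP, ← hH] at hc
  have hdvd (k : ℕ) (hk : k ≤ N) : z ^ k ∣ P - P' := by
    induction k with
    | zero => simp
    | succ k ih =>
      obtain ⟨d, hd⟩ := ih (by omega)
      have hd' : H - H' = z ^ k * ι (ψ d) := by
        simpa [hιP, hιP', hψz, hιX] using congrArg (fun y => ι (ψ y)) hd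
      obtain ⟨m, rfl⟩ := Nat.exists_eq_add_of_le hk
      have hmul : z ^ (k + 1) ∣ (P - P') * (x - 1) := by
        refine ⟨x * (1 - z) ^ 3 * (d * (x * P - H) + P' * (x * d - ι (ψ d))) +
          z ^ m * (1 - z) ^ (3 * (k + 1 + m)) * c, ?_⟩
        have ht' : t ^ (k + 1 + m) = z ^ (k + 1) * (z ^ m * (1 - z) ^ (3 * (k + 1 + m))) := by
          rw [ht, mul_pow, ← pow_mul, pow_add]; ring
        rw [ht'] at hc
        linear_combination hc - hsol + x * t * (x * P - H) * hd +
          x * t * P' * (x * hd - hd')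
      refine X_prime.pow_dvd_of_dvd_mul_right _ ?_ hmul
      rw [X_dvd_iff]
      have hw0 : constantCoeff w = 1 := by simpa [z] using congrArg constantCoeff hw
      simp [hx, hw0, u, Polynomial.X_ne_zero]
  have h := map_dvd ψ (hdvd N le_rfl)
  rw [map_pow, hψz, map_sub, hψP, hψP'] at h
  simp_rw [spinePoly_one] at h
  obtain ⟨e, he⟩ := h
  refine ⟨e * (1 - X) ^ 3, ?_⟩
  have hv3 : (1 - X) ^ 3 * ψ v ^ 3 = 1 := by rw [← mul_pow, hψv, one_pow]
  linear_combination (1 - X) ^ 3 * he + (1 - 2 * X) * hv3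

end Parametrization

section Coefficients

open PowerSeries

theorem coeff_one_sub_X_pow (k j : ℕ) :
    coeff j ((1 - X : ℚ⟦X⟧) ^ k) = (-1) ^ j * (k.choose j : ℚ) := by
  have h : (1 - X : ℚ⟦X⟧) ^ k = rescale (-1) ((1 + X : ℚ⟦X⟧) ^ k) := by
    simp [rescale_X, sub_eq_add_neg]
  have h' : (1 + X : ℚ⟦X⟧) ^ k = ((1 + Polynomial.X) ^ k : Polynomial ℚ) := by simp
  rw [h, coeff_rescale, h', Polynomial.coeff_coe, Polynomial.coeff_one_add_X_pow]

theorem C_mul_substitution_pow (c : ℚ) (n : ℕ) :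
    C c * (X * (1 - X) ^ 3) ^ n * (1 - X) ^ 3 = X ^ n * (C c * (1 - X) ^ (3 * n + 3)) := by
  rw [mul_pow, ← pow_mul]
  ring

theorem eq_zero_of_X_pow_dvd (c : ℕ → ℚ)
    (h : ∀ N, (X : ℚ⟦X⟧) ^ N ∣
      (∑ n ∈ Finset.range N, C (c n) * (X * (1 - X) ^ 3) ^ n) * (1 - X) ^ 3) (n : ℕ) :
    c n = 0 := by
  induction n using Nat.strong_induction_on with
  | _ n ih =>
    have hn := X_pow_dvd_iff.1 (h (n + 1)) n (by omega)
    rw [Finset.sum_range_succ, Finset.sum_eq_zero fun m hm => by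
      rw [ih m (Finset.mem_range.1 hm), map_zero, zero_mul]] at hn
    rw [zero_add, C_mul_substitution_pow, coeff_X_pow_mul'] at hn
    simpa using hn

/-- Chapoton's numbers `2 (4n+1)! / ((n+1)! (3n+2)!)`. -/
noncomputable def chapoton (n : ℕ) : ℚ :=
  2 * (4 * n + 1).factorial / ((n + 1).factorial * (3 * n + 2).factorial)

theorem chapoton_mul_choose (n k : ℕ) (h : 2 ≤ n + k) :
    chapoton n * (3 * n + 3).choose k =
      6 / (n + k).factorial * ((n + k).choose n * (4 * n + 1).descFactorial (n + k - 2)) := by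
  obtain hk | hk := le_or_gt k (3 * n + 3)
  · have h₁ : (((4 * n + 3 - (n + k)).factorial : ℕ) : ℚ) *
        (4 * n + 1).descFactorial (n + k - 2) = (4 * n + 1).factorial := by
      rw [show 4 * n + 3 - (n + k) = 4 * n + 1 - (n + k - 2) by omega]
      exact_mod_cast Nat.factorial_mul_descFactorial (by omega)
    have h₂ : ((3 * n + 3).factorial : ℚ) = 3 * (n + 1) * (3 * n + 2).factorial := by
      rw [Nat.factorial_succ]; push_cast; ring
    have h₃ : ((n + 1).factorial : ℚ) = (n + 1) * n.factorial := by
      rw [Nat.factorial_succ]; push_cast; ring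
    rw [chapoton, Nat.cast_choose ℚ hk, Nat.cast_choose ℚ (Nat.le_add_right n k), h₂, h₃, ← h₁,
      show n + k - n = k by omega, show 3 * n + 3 - k = 4 * n + 3 - (n + k) by omega]
    have := fun i : ℕ => Nat.cast_ne_zero (R := ℚ).2 i.factorial_ne_zero
    have hn : (n : ℚ) + 1 ≠ 0 := by positivity
    field_simp [this]
    ring
  · rw [Nat.choose_eq_zero_of_lt hk, Nat.descFactorial_eq_zero_iff_lt.2 (by omega)]
    simp

/-- The `m`-th finite difference of a polynomial of degree `m - 2` vanishes. -/
theorem sum_choose_mul_descFactorial_eq_zero (m : ℕ) (hm : 2 ≤ m) :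
    ∑ n ∈ Finset.range (m + 1), (-1 : ℚ) ^ (m - n) *
      (m.choose n * (4 * n + 1).descFactorial (m - 2)) = 0 := by
  let p : Polynomial ℚ := (descPochhammer ℚ (m - 2)).comp (4 * Polynomial.X + 1)
  have hp : p.natDegree < m := by
    refine lt_of_le_of_lt Polynomial.natDegree_comp_le ?_
    have : (4 * Polynomial.X + 1 : Polynomial ℚ).natDegree ≤ 1 := by compute_degree
    rw [descPochhammer_natDegree]
    calc (m - 2) * _ ≤ (m - 2) * 1 := Nat.mul_le_mul_left _ this
      _ < m := by omega
  have h := congrFun (Polynomial.fwdDiff_iter_eq_zero_of_degree_lt hp) 0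
  rw [fwdDiff_iter_eq_sum_shift] at h
  rw [← h.trans (Pi.zero_apply 0)]
  refine Finset.sum_congr rfl fun n _ => ?_
  have : p.eval (n : ℚ) = (4 * n + 1).descFactorial (m - 2) := by
    rw [← descPochhammer_eval_eq_descFactorial]
    simp [p]
  simp [this, mul_assoc]

theorem X_pow_dvd_sum_chapoton_sub (N : ℕ) :
    (X : ℚ⟦X⟧) ^ N ∣ (∑ n ∈ Finset.range N, C (chapoton n) * (X * (1 - X) ^ 3) ^ n) *
      (1 - X) ^ 3 - (1 - 2 * X) := by
  rw [X_pow_dvd_iff]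
  intro m hm
  have hcoeff : coeff m ((∑ n ∈ Finset.range N, C (chapoton n) * (X * (1 - X) ^ 3) ^ n) *
      (1 - X) ^ 3) = ∑ n ∈ Finset.range (m + 1),
        (-1) ^ (m - n) * (chapoton n * (3 * n + 3).choose (m - n)) := by
    simp_rw [Finset.sum_mul, C_mul_substitution_pow, map_sum, coeff_X_pow_mul', coeff_C_mul,
      coeff_one_sub_X_pow]
    rw [← Finset.sum_filter]
    refine Finset.sum_congr ?_ fun n _ => by ring
    ext n
    simp only [Finset.mem_filter, Finset.mem_range]
    omega
  rw [map_sub, hcoeff]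
  match m with
  | 0 => simp [chapoton]
  | 1 =>
    have : coeff 1 (2 * X : ℚ⟦X⟧) = 2 := by
      rw [show (2 : ℚ⟦X⟧) = C 2 from (map_ofNat C 2).symm, coeff_C_mul, coeff_one_X, mul_one]
    simp [Finset.sum_range_succ, chapoton, this, coeff_one, Nat.factorial]
    norm_num
  | m + 2 =>
    have : coeff (m + 2) (2 * X : ℚ⟦X⟧) = 0 := by
      rw [show (2 : ℚ⟦X⟧) = C 2 from (map_ofNat C 2).symm, coeff_C_mul, coeff_X]
      simp
    rw [map_sub, this, coeff_one, if_neg (by omega), sub_zero, sub_zero]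
    have hsum := sum_choose_mul_descFactorial_eq_zero (m + 2) (by omega)
    rw [← mul_zero (6 / ((m + 2).factorial : ℚ)), ← hsum, Finset.mul_sum]
    refine Finset.sum_congr rfl fun n hn => ?_
    obtain ⟨k, hk⟩ := Nat.exists_eq_add_of_le (Nat.lt_succ_iff.1 (Finset.mem_range.1 hn))
    rw [hk, show n + k - n = k by omega, chapoton_mul_choose n k (by omega)]
    ring

theorem card_intervals (n : ℕ) : ((intervals n).card : ℚ) = chapoton n := by
  rw [← sub_eq_zero]
  refine eq_zero_of_X_pow_dvd (fun n => (intervals n).card - chapoton n) (fun N => ?_) n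
  convert dvd_sub (X_pow_dvd_sum_card_sub N) (X_pow_dvd_sum_chapoton_sub N) using 1
  rw [sub_sub_sub_cancel_right, ← sub_mul, ← Finset.sum_sub_distrib]
  simp [sub_mul]

theorem chapoton_mul (n : ℕ) (hn : 1 ≤ n) :
    chapoton n * (n * (n + 1)) = 2 * (4 * n + 1).choose (n - 1) := by
  obtain ⟨m, rfl⟩ := Nat.exists_eq_add_of_le' hn
  rw [chapoton, Nat.cast_choose ℚ (by omega : m + 1 - 1 ≤ 4 * (m + 1) + 1),
    show 4 * (m + 1) + 1 - (m + 1 - 1) = 3 * (m + 1) + 2 by omega, Nat.add_sub_cancel,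
    Nat.factorial_succ (m + 1), Nat.factorial_succ m]
  have := fun i : ℕ => Nat.cast_ne_zero (R := ℚ).2 i.factorial_ne_zero
  have hm : (m : ℚ) + 1 ≠ 0 := by positivity
  have hm' : (m : ℚ) + 1 + 1 ≠ 0 := by positivity
  push_cast
  field_simp [this]

end Coefficients

end TamariInterval

/-- Chapoton's formula: the number of intervals of the Tamari lattice on binary
trees with `n` internal nodes equals `2/(n(n+1)) * C(4n+1, n-1)`. -/
theorem tamari_interval_count (n : ℕ) (hn : 1 ≤ n) :
    Nat.card {p : Tree Unit × Tree Unit //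
        p.1.numNodes = n ∧ p.2.numNodes = n ∧ tamariLE p.1 p.2} * (n * (n + 1)) =
      2 * Nat.choose (4 * n + 1) (n - 1) := by
  have hcard : Nat.card {p : BinaryTree Unit × BinaryTree Unit //
      p.1.numNodes = n ∧ p.2.numNodes = n ∧ tamariLE p.1 p.2} =
        (TamariInterval.intervals n).card := by
    rw [← Nat.card_eq_finsetCard]
    exact Nat.card_congr (Equiv.subtypeEquivRight fun p => TamariInterval.mem_intervals.symm)
  refine (congrArg (· * (n * (n + 1))) hcard).trans ?_
  have h := TamariInterval.chapoton_mul n hn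
  rw [← TamariInterval.card_intervals] at h
  exact_mod_cast h
end

section
/- Every interval-poset I of size n is uniquely determined by a triple (I1, I2, r) where I1 and I2 are interval-posets with size(I1) + size(I2) + 1 = n and 0 ≤ r ≤ ir(I2), via the initial-rise composition; i.e., the initial-rise composition IR is a bijection from such triples to interval-posets of size n. -/
/-- An interval-poset: a partial order on `{1,…,n}` such that for `a < b < c`,
`a ≺ c` implies `b ≺ c` and `c ≺ a` implies `b ≺ a`. -/
structure IPoset where
  n : ℕ
  rel : ℕ → ℕ → Prop
  supp : ∀ ⦃a b⦄, rel a b → 1 ≤ a ∧ a ≤ n ∧ 1 ≤ b ∧ b ≤ n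
  refl : ∀ a, 1 ≤ a → a ≤ n → rel a a
  antisymm : ∀ ⦃a b⦄, rel a b → rel b a → a = b
  trans : ∀ ⦃a b c⦄, rel a b → rel b c → rel a c
  inc : ∀ ⦃a b c⦄, a < b → b < c → rel a c → rel b c
  dec : ∀ ⦃a b c⦄, a < b → b < c → rel c a → rel b a

open scoped Classical in
/-- The initial rise `ir I`: the largest `k ≤ n` such that no relation
`i-1 ≺ i` holds for `2 ≤ i ≤ k`. -/
noncomputable def ir (I : IPoset) : ℕ :=
  Nat.findGreatest (fun k => ∀ i, 2 ≤ i → i ≤ k → ¬ I.rel (i - 1) i) I.n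

/-- `x` is a root of the final forest (the forest of decreasing relations) of `I`. -/
def IsDecRoot (I : IPoset) (x : ℕ) : Prop :=
  1 ≤ x ∧ x ≤ I.n ∧ ∀ y, y < x → ¬ I.rel x y

/-- `trees I`: the number of connected components of the final forest of `I`,
i.e. the number of its roots. -/
noncomputable def trees (I : IPoset) : ℕ := Set.ncard {x | IsDecRoot I x}

/-- The relation of the lower-contacts composition `LC(I₁, I₂, r)`: shifted
concatenation of `I₁`, a new vertex `k = n₁ + 1`, and `I₂`, where every vertex
of `I₁` precedes `k` and the vertices below one of the `r` smallest roots of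
the final forest of `I₂` precede `k`. -/
def LCrel (I1 I2 : IPoset) (r : ℕ) : ℕ → ℕ → Prop := fun x y =>
  let k := I1.n + 1
  (x ≤ I1.n ∧ y ≤ I1.n ∧ I1.rel x y) ∨
  (k < x ∧ k < y ∧ I2.rel (x - k) (y - k)) ∨
  (x = k ∧ y = k) ∨
  (y = k ∧ 1 ≤ x ∧ x ≤ I1.n) ∨
  (y = k ∧ k < x ∧ x ≤ k + I2.n ∧
    ∃ s, IsDecRoot I2 s ∧ Set.ncard {z | IsDecRoot I2 z ∧ z ≤ s} ≤ r ∧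
      (x - k = s ∨ (s < x - k ∧ I2.rel (x - k) s)))
/-- `w` is a child of `v` in the final forest (decreasing relations) of `I`. -/
def IsDecChild (I : IPoset) (w v : ℕ) : Prop :=
  v < w ∧ I.rel w v ∧ ∀ u, v < u → u < w → ¬ (I.rel w u ∧ I.rel u v)

/-- Number of children of `v` in the final forest of `I`. -/
noncomputable def decChildCount (I : IPoset) (v : ℕ) : ℕ :=
  Set.ncard {w | IsDecChild I w v}

/-- Label shift when inserting a new vertex `k`: labels `< k` are unchanged,
labels `≥ k` are shifted by 1. -/
def shiftIns (k v : ℕ) : ℕ := if v < k then v else v + 1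

/-- First step of the initial-rise composition: `I2'` is obtained from `I2` by
inserting a new vertex `k = ir I2 - r + 1` (shifting larger labels), keeping
the increasing relations, adding `k ≺ k+1` when `k + 1 ≤ size I2 + 1`, and
redistributing the decreasing relations so that each former vertex keeps its
number of children in the final forest. -/
def IsInsert (I2 : IPoset) (r : ℕ) (I2' : IPoset) : Prop :=
  I2'.n = I2.n + 1 ∧
  (let k := ir I2 + 1 - r
   (∀ a b, a < b → (I2'.rel a b ↔
      Relation.TransGen (fun u v =>
        (u = k ∧ v = k + 1 ∧ k + 1 ≤ I2.n + 1) ∨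
        ∃ a' b', a' < b' ∧ I2.rel a' b' ∧ u = shiftIns k a' ∧ v = shiftIns k b')
        a b)) ∧
   (∀ v, 1 ≤ v → v ≤ I2.n →
      decChildCount I2' (shiftIns k v) = decChildCount I2 v))

/-- Relabelling of the vertices of `I1` when a block of `m` vertices is
inserted right after the vertex `a`. -/
def mapMerge (a m v : ℕ) : ℕ := if v ≤ a then v else v + m

/-- The relation of the merge step of the initial-rise composition: `I2'` is
inserted right after the vertex `a = ir I1` of `I1` (labels shifted
accordingly), and every vertex of `I2'` precedes `a`; the result is the poset
generated by these relations. -/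
def IRrel (I1 I2' : IPoset) : ℕ → ℕ → Prop := fun x y =>
  let a := ir I1
  let m := I2'.n
  (x = y ∧ 1 ≤ x ∧ x ≤ I1.n + m) ∨
  Relation.TransGen (fun u v =>
    (∃ p q, I1.rel p q ∧ u = mapMerge a m p ∧ v = mapMerge a m q) ∨
    (∃ p q, I2'.rel p q ∧ u = p + a ∧ v = q + a) ∨
    (1 ≤ a ∧ a < u ∧ u ≤ a + m ∧ v = a)) x y

/-- `J` is the initial-rise composition `IR(I1, I2, r)`. -/
def IsIRComp (I1 I2 : IPoset) (r : ℕ) (J : IPoset) : Prop :=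
  ∃ I2' : IPoset, IsInsert I2 r I2' ∧ J.n = I1.n + I2'.n ∧
    ∀ x y, J.rel x y ↔ IRrel I1 I2' x y

namespace IPoset

theorem ext_rel {A B : IPoset} (hn : A.n = B.n) (h : ∀ x y, A.rel x y ↔ B.rel x y) : A = B := by
  obtain ⟨n, R, _, _, _, _, _, _⟩ := A
  obtain ⟨m, S, _, _, _, _, _, _⟩ := B
  obtain rfl : n = m := hn
  obtain rfl : R = S := by
    funext x y
    exact propext (h x y)
  rfl

theorem exists_not_rel (I : IPoset) (x : ℕ) : ∃ y, x < y ∧ ¬ I.rel y x :=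
  ⟨max x I.n + 1, by omega, fun h => by have := I.supp h; omega⟩

open scoped Classical in
/-- The least `y > x` that does not precede `x`: the decreasing relations to `x` come exactly
from the vertices in the open interval from `x` to `I.next x`. -/
noncomputable def next (I : IPoset) (x : ℕ) : ℕ := Nat.find (I.exists_not_rel x)

theorem lt_next (I : IPoset) (x : ℕ) : x < I.next x := by
  classical exact (Nat.find_spec (I.exists_not_rel x)).1

theorem not_rel_next (I : IPoset) (x : ℕ) : ¬ I.rel (I.next x) x := by
  classical exact (Nat.find_spec (I.exists_not_rel x)).2

theorem rel_iff_lt_next (I : IPoset) {x c : ℕ} (h : x < c) : I.rel c x ↔ c < I.next x := by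
  classical
  constructor
  · intro hr
    by_contra hc
    have h1 := I.lt_next x
    have h2 := I.not_rel_next x
    rcases (not_lt.mp hc).eq_or_lt with h3 | h3
    · exact h2 (h3 ▸ hr)
    · exact h2 (I.dec h1 h3 hr)
  · intro hc
    by_contra hr
    exact Nat.find_min (I.exists_not_rel x) hc ⟨h, hr⟩

theorem next_eq (I : IPoset) {x y : ℕ} (hxy : x < y)
    (h : ∀ c, x < c → (I.rel c x ↔ c < y)) : I.next x = y := by
  have h1 := I.lt_next x
  have h2 := (h _ h1).not.mp (I.not_rel_next x)
  have h3 := (I.rel_iff_lt_next hxy).not.mp ((h y hxy).not.mpr (lt_irrefl _))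
  omega

theorem next_le_next (I : IPoset) {x c : ℕ} (h : x < c) (hc : c < I.next x) :
    I.next c ≤ I.next x := by
  by_contra hlt
  push Not at hlt
  exact I.not_rel_next x (I.trans ((I.rel_iff_lt_next hc).mpr hlt) ((I.rel_iff_lt_next h).mpr hc))

theorem next_le_of_rel (I : IPoset) {x y : ℕ} (h : x < y) (hr : I.rel x y) : I.next x ≤ y := by
  by_contra hlt
  have := I.antisymm hr ((I.rel_iff_lt_next h).mpr (not_le.mp hlt))
  omega

theorem next_supp (I : IPoset) {x c : ℕ} (h : x < c) (hc : c < I.next x) : 1 ≤ x ∧ c ≤ I.n := by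
  have := I.supp ((I.rel_iff_lt_next h).mpr hc)
  omega

theorem next_le (I : IPoset) {x : ℕ} (h : x ≤ I.n) : I.next x ≤ I.n + 1 := by
  by_contra hlt
  have := I.next_supp (Nat.lt_succ_of_le h) (not_le.mp hlt)
  omega

theorem ext_next {A B : IPoset} (hn : A.n = B.n) (hd : ∀ x, A.next x = B.next x)
    (hi : ∀ x y, x < y → (A.rel x y ↔ B.rel x y)) : A = B := by
  refine ext_rel hn fun x y => ?_
  rcases lt_trichotomy x y with h | rfl | h
  · exact hi x y h
  · constructor
    · intro h
      have := A.supp h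
      exact B.refl _ (by omega) (by omega)
    · intro h
      have := B.supp h
      exact A.refl _ (by omega) (by omega)
  · rw [A.rel_iff_lt_next h, B.rel_iff_lt_next h, hd]

/-- The interval-poset with prescribed increasing relations `up` and decreasing relations
given by `f`. -/
def ofNext (n : ℕ) (f : ℕ → ℕ) (up : ℕ → ℕ → Prop)
    (hf : ∀ ⦃x c⦄, x < c → c < f x → 1 ≤ x ∧ c ≤ n)
    (hnest : ∀ ⦃x c⦄, x < c → c < f x → f c ≤ f x)
    (hup : ∀ ⦃x y⦄, x < y → up x y → 1 ≤ x ∧ y ≤ n)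
    (htrans : ∀ ⦃x y z⦄, x < y → y < z → up x y → up y z → up x z)
    (hinc : ∀ ⦃x y z⦄, x < y → y < z → up x z → up y z)
    (hcompat : ∀ ⦃x y⦄, x < y → up x y → f x ≤ y) : IPoset where
  n := n
  rel x y := (x = y ∧ 1 ≤ x ∧ x ≤ n) ∨ (x < y ∧ up x y) ∨ (y < x ∧ x < f y)
  supp := by
    rintro a b (h | ⟨h, h'⟩ | ⟨h, h'⟩)
    · omega
    · have := hup h h'
      omega
    · have := hf h h'
      omega
  refl a h h' := Or.inl ⟨rfl, h, h'⟩
  antisymm := by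
    rintro a b (h | ⟨h, h'⟩ | ⟨h, h'⟩) (g | ⟨g, g'⟩ | ⟨g, g'⟩) <;> try omega
    · have := hcompat h h'
      omega
    · have := hcompat g g'
      omega
  trans := by
    rintro a b c (⟨rfl, h⟩ | ⟨h, h'⟩ | ⟨h, h'⟩) hbc
    · exact hbc
    · rcases hbc with ⟨rfl, g⟩ | ⟨g, g'⟩ | ⟨g, g'⟩
      · exact Or.inr (Or.inl ⟨h, h'⟩)
      · exact Or.inr (Or.inl ⟨h.trans g, htrans h g h' g'⟩)
      · rcases lt_trichotomy a c with k | rfl | k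
        · have := hcompat g (hinc k g h')
          omega
        · have := hcompat h h'
          omega
        · exact Or.inr (Or.inr ⟨k, h.trans g'⟩)
    · rcases hbc with ⟨rfl, g⟩ | ⟨g, g'⟩ | ⟨g, g'⟩
      · exact Or.inr (Or.inr ⟨h, h'⟩)
      · have := hcompat g g'
        exact Or.inr (Or.inl ⟨by omega, hinc h (by omega) g'⟩)
      · have := hnest g g'
        exact Or.inr (Or.inr ⟨by omega, by omega⟩)
  inc := by
    rintro a b c hab hbc (h | ⟨h, h'⟩ | ⟨h, h'⟩)
    · omega
    · exact Or.inr (Or.inl ⟨hbc, hinc hab hbc h'⟩)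
    · omega
  dec := by
    rintro a b c hab hbc (h | ⟨h, h'⟩ | ⟨h, h'⟩)
    · omega
    · omega
    · exact Or.inr (Or.inr ⟨hab, by omega⟩)

theorem exists_of_next (n : ℕ) (f : ℕ → ℕ) (up : ℕ → ℕ → Prop)
    (hlt : ∀ x, x < f x)
    (hf : ∀ ⦃x c⦄, x < c → c < f x → 1 ≤ x ∧ c ≤ n)
    (hnest : ∀ ⦃x c⦄, x < c → c < f x → f c ≤ f x)
    (hup : ∀ ⦃x y⦄, x < y → up x y → 1 ≤ x ∧ y ≤ n)
    (htrans : ∀ ⦃x y z⦄, x < y → y < z → up x y → up y z → up x z)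
    (hinc : ∀ ⦃x y z⦄, x < y → y < z → up x z → up y z)
    (hcompat : ∀ ⦃x y⦄, x < y → up x y → f x ≤ y) :
    ∃ I : IPoset, I.n = n ∧ (∀ x, I.next x = f x) ∧ ∀ x y, x < y → (I.rel x y ↔ up x y) := by
  refine ⟨ofNext n f up hf hnest hup htrans hinc hcompat, rfl, fun x => next_eq _ (hlt x) ?_, ?_⟩
  · intro c hc
    simp only [ofNext]
    omega
  · intro x y hxy
    simp only [ofNext]
    constructor
    · rintro (h | h | h)
      · omega
      · exact h.2
      · omega
    · exact fun h => Or.inr (Or.inl ⟨hxy, h⟩)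

/-! Child counts -/

theorem isDecChild_iff (I : IPoset) {v w : ℕ} :
    IsDecChild I w v ↔ v < w ∧ w < I.next v ∧ ∀ u, v < u → u < w → I.next u ≤ w := by
  unfold IsDecChild
  constructor
  · rintro ⟨h, hr, hu⟩
    have hw := (I.rel_iff_lt_next h).mp hr
    refine ⟨h, hw, fun u h1 h2 => ?_⟩
    have := hu u h1 h2
    rw [I.rel_iff_lt_next h1, I.rel_iff_lt_next h2] at this
    omega
  · rintro ⟨h, hr, hu⟩
    refine ⟨h, (I.rel_iff_lt_next h).mpr hr, fun u h1 h2 => ?_⟩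
    have := hu u h1 h2
    rw [I.rel_iff_lt_next h1, I.rel_iff_lt_next h2]
    omega

theorem iterate_next_children_from (I : IPoset) (v d : ℕ) : ∀ x, v < x → x + d = I.next v →
    (∀ u, v < u → u < x → I.next u ≤ x) →
    I.next^[Set.ncard {w | IsDecChild I w v ∧ x ≤ w}] x = I.next v := by
  induction d using Nat.strong_induction_on with
  | _ d ih =>
    intro x hx hd hr
    rcases Nat.eq_zero_or_pos d with rfl | hpos
    · have : {w | IsDecChild I w v ∧ x ≤ w} = ∅ := by
        ext w
        simp only [Set.mem_ofPred_eq, isDecChild_iff, Set.mem_empty_iff_false, iff_false]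
        omega
      rw [this]
      simpa using hd
    · have h1 := I.lt_next x
      have h2 := I.next_le_next hx (by omega)
      have h3 : {w | IsDecChild I w v ∧ x ≤ w} =
          insert x {w | IsDecChild I w v ∧ I.next x ≤ w} := by
        ext w
        simp only [Set.mem_ofPred_eq, isDecChild_iff, Set.mem_insert_iff]
        constructor
        · rintro ⟨⟨ha, hb, hc⟩, hw⟩
          rcases hw.eq_or_lt with rfl | hw
          · exact Or.inl rfl
          · exact Or.inr ⟨⟨ha, hb, hc⟩, hc x hx hw⟩
        · rintro (rfl | ⟨h, hw⟩)
          · exact ⟨⟨hx, by omega, hr⟩, le_rfl⟩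
          · exact ⟨h, by omega⟩
      have hfin : {w | IsDecChild I w v ∧ I.next x ≤ w}.Finite := by
        refine (Set.finite_Iio (I.next v)).subset fun w hw => ?_
        exact (I.isDecChild_iff.mp hw.1).2.1
      rw [h3, Set.ncard_insert_of_notMem (by simp; omega) hfin, Function.iterate_succ_apply]
      refine ih (I.next v - I.next x) (by omega) _ (by omega) (by omega) fun u hu hux => ?_
      rcases lt_trichotomy u x with h | rfl | h
      · have := hr u hu h
        omega
      · exact le_rfl
      · exact I.next_le_next h hux

theorem iterate_next_decChildCount (I : IPoset) (v : ℕ) :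
    I.next^[decChildCount I v] (v + 1) = I.next v := by
  have h := I.iterate_next_children_from v (I.next v - (v + 1)) (v + 1) (by omega)
    (by have := I.lt_next v; omega) (by omega)
  have : {w | IsDecChild I w v ∧ v + 1 ≤ w} = {w | IsDecChild I w v} := by
    ext w
    simp only [Set.mem_ofPred_eq, and_iff_left_iff_imp]
    exact fun h => h.1
  rwa [this] at h

theorem iterate_next_injective (I : IPoset) (x : ℕ) :
    Function.Injective fun i => I.next^[i] x := by
  refine (strictMono_nat_of_lt_succ fun i => ?_).injective
  rw [Function.iterate_succ_apply']
  exact I.lt_next _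

theorem decChildCount_eq (I : IPoset) {v c : ℕ} (h : I.next^[c] (v + 1) = I.next v) :
    decChildCount I v = c :=
  I.iterate_next_injective (v + 1) ((I.iterate_next_decChildCount v).trans h.symm)

theorem next_of_gt (I : IPoset) {x : ℕ} (h : I.n < x) : I.next x = x + 1 := by
  refine I.next_eq (by omega) fun c hc => ?_
  constructor
  · intro hr
    have := I.supp hr
    omega
  · omega

theorem next_eq_of_decChildCount_eq {A B : IPoset} (hn : A.n = B.n)
    (h : ∀ v, 1 ≤ v → v ≤ A.n → decChildCount A v = decChildCount B v) (x : ℕ) :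
    A.next x = B.next x := by
  have key : ∀ d x, 1 ≤ x → A.n + 1 ≤ x + d → A.next x = B.next x := by
    intro d
    induction d with
    | zero =>
      intro x _ hx
      rw [A.next_of_gt (by omega), B.next_of_gt (by omega)]
    | succ d ih =>
      intro x hx1 hx
      by_cases hxn : A.n < x
      · exact ih x hx1 (by omega)
      · rw [← A.iterate_next_decChildCount, ← B.iterate_next_decChildCount,
          h x hx1 (by omega)]
        generalize decChildCount B x = c
        have : ∀ c, A.next^[c] (x + 1) = B.next^[c] (x + 1) ∧ x < A.next^[c] (x + 1) := by
          intro c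
          induction c with
          | zero => simp
          | succ c ihc =>
            rw [Function.iterate_succ_apply', Function.iterate_succ_apply', ← ihc.1]
            have := A.lt_next (A.next^[c] (x + 1))
            exact ⟨ih _ (by omega) (by omega), by omega⟩
        exact (this c).1
  rcases Nat.eq_zero_or_pos x with rfl | hx
  · have hz : ∀ I : IPoset, I.next 0 = 1 := by
      refine fun I => I.next_eq (by omega) fun c hc => ?_
      constructor
      · intro hr
        have := I.supp hr
        omega
      · omega
    rw [hz, hz]
  · exact key (A.n + 1) x hx (by omega)

/-! The initial rise -/

theorem rel_pred (I : IPoset) {x y : ℕ} (h : x < y) (hr : I.rel x y) : I.rel (y - 1) y := by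
  rcases (Nat.le_sub_one_of_lt h).eq_or_lt with e | e
  · exact e ▸ hr
  · exact I.inc e (by omega) hr

theorem ir_le (I : IPoset) : ir I ≤ I.n := by
  classical exact Nat.findGreatest_le _

theorem not_rel_of_le_ir (I : IPoset) {x y : ℕ} (h : x < y) (hy : y ≤ ir I) : ¬ I.rel x y := by
  classical
  intro hr
  have h1 := I.supp hr
  have h2 : ∀ i, 2 ≤ i → i ≤ ir I → ¬ I.rel (i - 1) i := by
    unfold ir
    exact Nat.findGreatest_spec (P := fun k => ∀ i, 2 ≤ i → i ≤ k → ¬ I.rel (i - 1) i)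
      (Nat.zero_le _) (by omega)
  exact h2 y (by omega) hy (I.rel_pred h hr)

theorem le_ir (I : IPoset) {k : ℕ} (hk : k ≤ I.n)
    (h : ∀ x y, x < y → y ≤ k → ¬ I.rel x y) : k ≤ ir I := by
  classical
  unfold ir
  exact Nat.le_findGreatest hk fun i hi hik => h _ _ (by omega) hik

theorem ir_eq (I : IPoset) {k : ℕ} (hk : k ≤ I.n)
    (h : ∀ x y, x < y → y ≤ k → ¬ I.rel x y) (h' : k = I.n ∨ I.rel k (k + 1)) : ir I = k := by
  have h1 := I.le_ir hk h
  have h2 := I.ir_le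
  rcases h' with rfl | h'
  · omega
  · by_contra hne
    exact I.not_rel_of_le_ir (Nat.lt_succ_self k) (by omega) h'

theorem ir_pos (I : IPoset) (h : 1 ≤ I.n) : 1 ≤ ir I := by
  refine I.le_ir h fun x y hxy hy hr => ?_
  have := I.supp hr
  omega

theorem ir_eq_or_rel (I : IPoset) : ir I = I.n ∨ I.rel (ir I) (ir I + 1) := by
  by_contra h
  push Not at h
  have h1 := I.ir_le
  have : ir I + 1 ≤ ir I := by
    refine I.le_ir (by omega) fun x y hxy hy hr => ?_
    by_cases hy2 : y ≤ ir I
    · exact I.not_rel_of_le_ir hxy hy2 hr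
    · obtain rfl : y = ir I + 1 := by omega
      exact h.2 (by simpa using I.rel_pred hxy hr)
  omega

/-! Insertion of a vertex -/

/-- `z` is a root of the final forest of `I` restricted to the vertices `≥ k`. -/
def RootFrom (I : IPoset) (k z : ℕ) : Prop :=
  k ≤ z ∧ ∀ w, k ≤ w → w < z → I.next w ≤ z

theorem rootFrom_self (I : IPoset) (k : ℕ) : I.RootFrom k k := ⟨le_rfl, by omega⟩

theorem RootFrom.next {I : IPoset} {k z : ℕ} (h : I.RootFrom k z) : I.RootFrom k (I.next z) := by
  have h1 := I.lt_next z
  refine ⟨h.1.trans h1.le, fun w hk hw => ?_⟩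
  rcases lt_trichotomy w z with h2 | rfl | h2
  · exact (h.2 w hk h2).trans h1.le
  · exact le_rfl
  · exact I.next_le_next h2 hw

theorem RootFrom.le_of_next_le {I : IPoset} {k z z' : ℕ} (h : I.RootFrom k z)
    (h' : I.RootFrom k z') (hz : I.next z' ≤ I.next z) : z' ≤ z := by
  by_contra hlt
  have := h'.2 z h.1 (by omega)
  have := I.lt_next z'
  omega

theorem exists_rootFrom (I : IPoset) {k v : ℕ} (hv : v < k) (h : k < I.next v) :
    ∃ z, I.RootFrom k z ∧ I.next v = I.next z := by
  classical
  have hex : ∃ z, k ≤ z ∧ I.next v ≤ I.next z :=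
    ⟨I.next v - 1, by omega, by have := I.lt_next (I.next v - 1); omega⟩
  obtain ⟨h1, h2⟩ := Nat.find_spec hex
  have hmin : ∀ w, w < Nat.find hex → k ≤ w → I.next w < I.next v := by
    intro w hw hk
    have := Nat.find_min hex hw
    omega
  generalize Nat.find hex = z at *
  have h3 : z ≤ I.next v - 1 := by
    by_contra hlt
    have := hmin (I.next v - 1) (by omega) (by omega)
    have := I.lt_next (I.next v - 1)
    omega
  refine ⟨z, ⟨h1, fun w hk hw => ?_⟩, le_antisymm h2 (I.next_le_next (by omega) (by omega))⟩
  have h4 := hmin w hw hk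
  by_contra hlt
  have := I.next_le_next hw (not_le.mp hlt)
  omega

/-- The end of the block of descendants, before and after the insertion of `k`. -/
def InsNext (I : IPoset) (k y y' : ℕ) : Prop :=
  (y ≤ k ∧ y' = y) ∨ ∃ z, I.RootFrom k z ∧ y = I.next z ∧ y' = z + 1

theorem insNext_iff_of_le (I : IPoset) {k y y' : ℕ} (h : y ≤ k) : I.InsNext k y y' ↔ y' = y := by
  constructor
  · rintro (h | ⟨z, hz, rfl, _⟩)
    · exact h.2
    · have := I.lt_next z
      have := hz.1
      omega
  · exact fun h' => Or.inl ⟨h, h'⟩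

/-- Inverse of the shift, sending the new vertex to its successor. -/
def unshift (k x : ℕ) : ℕ := if x ≤ k then x else x - 1

/-- `B` is obtained from `A` by inserting the vertex `k`. -/
structure Ins (A B : IPoset) (k : ℕ) : Prop where
  card : B.n = A.n + 1
  pos : 1 ≤ k
  le : k ≤ B.n
  notrel : ∀ x y, x < y → y < k → ¬ A.rel x y
  up : ∀ x y, x < y → (B.rel x y ↔ k < y ∧ A.rel (unshift k x) (y - 1))
  next_ge : ∀ v, k ≤ v → B.next (v + 1) = A.next v + 1
  next_self : B.next k = k + 1
  next_lt : ∀ v, v < k → A.InsNext k (A.next v) (B.next v)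

theorem exists_ins (A : IPoset) {k : ℕ} (h1 : 1 ≤ k) (h2 : k ≤ A.n + 1)
    (h3 : ∀ x y, x < y → y < k → ¬ A.rel x y) : ∃ B, Ins A B k := by
  classical
  have hex : ∀ v, ∃ y', v < k → A.InsNext k (A.next v) y' := by
    intro v
    by_cases hv : v < k
    · by_cases h : A.next v ≤ k
      · exact ⟨A.next v, fun _ => Or.inl ⟨h, rfl⟩⟩
      · obtain ⟨z, hz, e⟩ := A.exists_rootFrom hv (not_le.mp h)
        exact ⟨z + 1, fun _ => Or.inr ⟨z, hz, e, rfl⟩⟩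
    · exact ⟨0, fun h => absurd h hv⟩
  choose g hg using hex
  let f : ℕ → ℕ := fun v => if v < k then g v else if v = k then k + 1 else A.next (v - 1) + 1
  have f1 : ∀ v, v < k → (A.next v ≤ k ∧ f v = A.next v) ∨
      ∃ z, A.RootFrom k z ∧ A.next v = A.next z ∧ f v = z + 1 := by
    intro v hv
    have := hg v hv
    unfold InsNext at this
    simpa [f, hv] using this
  have f2 : f k = k + 1 := by simp [f]
  have f3 : ∀ v, k < v → f v = A.next (v - 1) + 1 := by
    intro v hv
    simp only [f]
    rw [if_neg (by omega), if_neg (by omega)]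
  refine Exists.elim (exists_of_next (A.n + 1) f (fun x y => k < y ∧ A.rel (unshift k x) (y - 1))
    ?_ ?_ ?_ ?_ ?_ ?_ ?_) ?_
  pick_goal 8
  · rintro B ⟨hB1, hB2, hB3⟩
    refine ⟨B, hB1, h1, by omega, h3, hB3, ?_, ?_, ?_⟩
    · intro v hv
      rw [hB2, f3 _ (by omega)]
      simp
    · rw [hB2, f2]
    · intro v hv
      rw [hB2]
      exact f1 v hv
  · intro x
    rcases lt_trichotomy x k with h | rfl | h
    · have := A.lt_next x
      rcases f1 x h with h' | ⟨z, hz, -, e⟩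
      · omega
      · have := hz.1
        omega
    · omega
    · rw [f3 x h]
      have := A.lt_next (x - 1)
      omega
  · intro x c hxc hc
    rcases lt_trichotomy x k with h | rfl | h
    · rcases f1 x h with h' | ⟨z, hz, e', e⟩
      · have := A.next_supp hxc (by omega)
        omega
      · have := hz.1
        have := A.lt_next z
        have := A.next_supp (x := x) (c := z) (by omega) (by omega)
        omega
    · omega
    · rw [f3 x h] at hc
      have := A.next_supp (x := x - 1) (c := c - 1) (by omega) (by omega)
      omega
  · intro x c hxc hc
    rcases lt_trichotomy x k with h | rfl | h
    · rcases f1 x h with h' | ⟨z, hz, e', e⟩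
      · have := A.next_le_next hxc (by omega)
        rcases f1 c (by omega) with h'' | ⟨z', hz', d', d⟩
        · omega
        · have := hz'.1
          have := A.lt_next z'
          omega
      · rw [e]
        have hk := hz.1
        rcases lt_trichotomy c k with g | rfl | g
        · have := A.lt_next z
          have := A.next_le_next (x := x) (c := c) hxc (by omega)
          rcases f1 c g with h'' | ⟨z', hz', d', d⟩
          · omega
          · have := hz.le_of_next_le hz' (by omega)
            omega
        · omega
        · rw [f3 c g]
          have := hz.2 (c - 1) (by omega) (by omega)
          omega
    · omega
    · rw [f3 x h] at hc ⊢
      rw [f3 c (by omega)]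
      have := A.next_le_next (x := x - 1) (c := c - 1) (by omega) (by omega)
      omega
  · rintro x y hxy ⟨hy, hr⟩
    have := A.supp hr
    unfold unshift at this
    split_ifs at this <;> omega
  · rintro x y z hxy hyz ⟨hy, hr⟩ ⟨hz, hr'⟩
    refine ⟨hz, A.trans hr ?_⟩
    rwa [unshift, if_neg (by omega)] at hr'
  · rintro x y z hxy hyz ⟨hz, hr⟩
    refine ⟨hz, ?_⟩
    have g1 : unshift k x ≤ unshift k y := by
      unfold unshift
      split_ifs <;> omega
    have g2 : unshift k y ≤ z - 1 := by
      unfold unshift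
      split_ifs <;> omega
    rcases g1.eq_or_lt with g1 | g1
    · rwa [← g1]
    rcases g2.eq_or_lt with g2 | g2
    · rw [g2]
      have := A.supp hr
      exact A.refl _ (by omega) (by omega)
    · exact A.inc g1 g2 hr
  · rintro x y hxy ⟨hy, hr⟩
    rcases lt_trichotomy x k with h | rfl | h
    · rw [unshift, if_pos (by omega)] at hr
      have := A.next_le_of_rel (by omega) hr
      rcases f1 x h with h' | ⟨z, hz, e', e⟩
      · omega
      · have := A.lt_next z
        omega
    · omega
    · rw [unshift, if_neg (by omega)] at hr
      have := A.next_le_of_rel (by omega) hr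
      rw [f3 x h]
      omega

theorem shiftIns_lt {k x y : ℕ} (h : x < y) : shiftIns k x < shiftIns k y := by
  unfold shiftIns
  split_ifs <;> omega

theorem unshift_shiftIns (k x : ℕ) : unshift k (shiftIns k x) = x := by
  unfold shiftIns unshift
  split_ifs <;> omega

theorem Ins.up_shift {A B : IPoset} {k x y : ℕ} (h : Ins A B k) (hxy : x < y) :
    B.rel (shiftIns k x) (shiftIns k y) ↔ k ≤ y ∧ A.rel x y := by
  rw [h.up _ _ (shiftIns_lt hxy), unshift_shiftIns]
  unfold shiftIns
  split_ifs
  · omega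
  · simp only [Nat.lt_succ_iff, Nat.add_sub_cancel]

/-- The decreasing relations of the old poset in terms of the new one. -/
theorem Ins.next_of_lt {A B : IPoset} {k v : ℕ} (h : Ins A B k) (hv : v < k) :
    A.next v = if B.next v ≤ k then B.next v else B.next (B.next v) - 1 := by
  rcases h.next_lt v hv with ⟨h1, h2⟩ | ⟨z, hz, h1, h2⟩
  · rw [if_pos (by omega), h2]
  · have := hz.1
    rw [if_neg (by omega), h2, h.next_ge z hz.1]
    simpa using h1

theorem Ins.left_unique {A A' B : IPoset} {k : ℕ} (h : Ins A B k) (h' : Ins A' B k) : A = A' := by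
  refine ext_next (by have := h.card; have := h'.card; omega) (fun v => ?_) fun x y hxy => ?_
  · by_cases hv : v < k
    · rw [h.next_of_lt hv, h'.next_of_lt hv]
    · have h1 := h.next_ge v (by omega)
      have h2 := h'.next_ge v (by omega)
      omega
  · by_cases hy : y < k
    · exact iff_of_false (h.notrel x y hxy hy) (h'.notrel x y hxy hy)
    · have := (h.up_shift hxy).symm.trans (h'.up_shift hxy)
      simpa [not_lt.mp hy] using this

theorem Ins.ir_eq {A B : IPoset} {k : ℕ} (h : Ins A B k) : ir B = k := by
  refine B.ir_eq h.le (fun x y hxy hy hr => ?_) ?_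
  · have := ((h.up x y hxy).mp hr).1
    omega
  · have h1 := h.card
    have h2 := h.le
    have h3 := h.pos
    by_cases hk : k = B.n
    · exact Or.inl hk
    · refine Or.inr ((h.up _ _ (by omega)).mpr ⟨by omega, ?_⟩)
      rw [unshift, if_pos le_rfl]
      exact A.refl _ h3 (by omega)

theorem Ins.le_ir_add_one {A B : IPoset} {k : ℕ} (h : Ins A B k) : k ≤ ir A + 1 := by
  have h1 := h.card
  have h2 := h.le
  have h3 := h.pos
  have : k - 1 ≤ ir A := A.le_ir (by omega) fun x y hxy hy => h.notrel x y hxy (by omega)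
  omega

/-- Every descendants block around the inserted vertex can be extended. -/
theorem Ins.extendable {A B : IPoset} {k p : ℕ} (h : Ins A B k) (hp : p < k) (hkp : k < B.next p) :
    B.next p ≤ B.n ∧ ¬ B.rel p (B.next p) := by
  have h1 := h.card
  rcases h.next_lt p hp with ⟨h2, h3⟩ | ⟨z, hz, h2, h3⟩
  · omega
  · have h4 := A.lt_next z
    have h5 := hz.1
    have h6 := A.next_supp (x := p) (c := z) (by omega) (by omega)
    refine ⟨by omega, fun hr => ?_⟩
    have h7 := ((h.up _ _ (by omega)).mp hr).2
    rw [unshift, if_pos hp.le] at h7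
    have := A.next_le_of_rel (by omega) h7
    omega

/-- A vertex can be deleted when the blocks around it can be extended. -/
theorem exists_ins_right (B : IPoset) {k : ℕ} (h1 : 1 ≤ k) (h2 : k ≤ B.n) (h3 : ir B = k)
    (h4 : ∀ p, 1 ≤ p → p < k → k < B.next p → B.next p ≤ B.n ∧ ¬ B.rel p (B.next p)) :
    ∃ A, Ins A B k := by
  classical
  have hno : ∀ x y, x < y → y ≤ k → ¬ B.rel x y := fun x y hxy hy =>
    B.not_rel_of_le_ir hxy (by omega)
  have hself : B.next k = k + 1 := by
    have := B.lt_next k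
    rcases B.ir_eq_or_rel with h | h
    · have := B.next_le h2
      omega
    · rw [h3] at h
      have := B.next_le_of_rel (by omega) h
      omega
  have hkk : k = B.n ∨ B.rel k (k + 1) := by
    have := B.ir_eq_or_rel
    rwa [h3] at this
  have h4' : ∀ p, p < k → k < B.next p → 1 ≤ p ∧ B.next p ≤ B.n ∧ ¬ B.rel p (B.next p) := by
    intro p hp hk
    have := B.next_supp hp hk
    exact ⟨this.1, h4 p this.1 hp hk⟩
  let f : ℕ → ℕ := fun v => if v < k then
    (if B.next v ≤ k then B.next v else B.next (B.next v) - 1) else B.next (v + 1) - 1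
  have f1 : ∀ v, v < k → B.next v ≤ k → f v = B.next v := by
    intro v hv h
    simp only [f]
    rw [if_pos hv, if_pos h]
  have f2 : ∀ v, v < k → k < B.next v → f v + 1 = B.next (B.next v) := by
    intro v hv h
    have := B.lt_next (B.next v)
    simp only [f]
    rw [if_pos hv, if_neg (by omega)]
    omega
  have f3 : ∀ v, k ≤ v → f v + 1 = B.next (v + 1) := by
    intro v hv
    have := B.lt_next (v + 1)
    simp only [f]
    rw [if_neg (by omega)]
    omega
  refine Exists.elim (exists_of_next (B.n - 1) f (fun x y => B.rel (shiftIns k x) (shiftIns k y))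
    ?_ ?_ ?_ ?_ ?_ ?_ ?_) ?_
  pick_goal 8
  · rintro A ⟨hA1, hA2, hA3⟩
    refine ⟨A, by omega, h1, h2, ?_, ?_, ?_, hself, ?_⟩
    · intro x y hxy hy hr
      refine hno _ _ (shiftIns_lt (k := k) hxy) ?_ ((hA3 _ _ hxy).mp hr)
      rw [shiftIns, if_pos hy]
      exact hy.le
    · intro x y hxy
      have hky : B.rel x y → k < y := fun hr => by
        by_contra hlt
        exact hno x y hxy (by omega) hr
      by_cases hky' : k < y
      swap
      · exact iff_of_false (fun h => hky' (hky h)) (fun h => hky' h.1)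
      have hs : shiftIns k (y - 1) = y := by
        unfold shiftIns
        split_ifs <;> omega
      by_cases hx : x = k
      · subst hx
        rw [unshift, if_pos le_rfl]
        constructor
        · intro hr
          have := B.supp hr
          refine ⟨hky', ?_⟩
          rcases (Nat.le_sub_one_of_lt hky').eq_or_lt with e | e
          · rw [← e]
            exact A.refl _ h1 (by omega)
          · rw [hA3 _ _ e, hs]
            rw [shiftIns, if_neg (lt_irrefl _)]
            exact B.inc (a := x) (by omega) (by omega) hr
        · rintro ⟨_, hr⟩
          have := A.supp hr
          have hkr : B.rel x (x + 1) := by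
            rcases hkk with e | e
            · omega
            · exact e
          rcases (Nat.le_sub_one_of_lt hky').eq_or_lt with e | e
          · have : y = x + 1 := by omega
            rwa [this]
          · rw [hA3 _ _ e, hs] at hr
            refine B.trans hkr ?_
            simpa [shiftIns] using hr
      · have hu : unshift k x < y - 1 := by
          unfold unshift
          split_ifs <;> omega
        have hs' : shiftIns k (unshift k x) = x := by
          unfold unshift shiftIns
          split_ifs <;> omega
        rw [hA3 _ _ hu, hs, hs']
        simp [hky']
    · intro v hv
      rw [hA2, f3 v hv]
    · intro v hv
      rw [hA2]
      by_cases h : B.next v ≤ k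
      · exact Or.inl ⟨by rw [f1 v hv h]; exact h, (f1 v hv h).symm⟩
      · refine Or.inr ⟨B.next v - 1, ⟨by omega, fun w hkw hw => ?_⟩, ?_, by omega⟩
        · rw [hA2]
          have := f3 w hkw
          have := B.next_le_next (x := v) (c := w + 1) (by omega) (by omega)
          omega
        · rw [hA2]
          have e1 := f2 v hv (by omega)
          have e2 := f3 (B.next v - 1) (by omega)
          rw [Nat.sub_add_cancel (by omega)] at e2
          omega
  · intro x
    have g := B.lt_next x
    by_cases hx : x < k
    · by_cases h : B.next x ≤ k
      · rw [f1 x hx h]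
        exact g
      · have := f2 x hx (by omega)
        have := B.lt_next (B.next x)
        omega
    · have := f3 x (by omega)
      have := B.lt_next (x + 1)
      omega
  · intro x c hxc hc
    by_cases hx : x < k
    · by_cases h : B.next x ≤ k
      · rw [f1 x hx h] at hc
        have := B.next_supp hxc hc
        omega
      · have e := f2 x hx (by omega)
        have g := h4' x hx (by omega)
        have := B.next_le g.2.1
        omega
    · have e := f3 x (by omega)
      have := B.next_supp (x := x + 1) (c := c + 1) (by omega) (by omega)
      omega
  · intro x c hxc hc
    by_cases hx : x < k
    · by_cases h : B.next x ≤ k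
      · have e := f1 x hx h
        have g := B.next_le_next hxc (by omega)
        rw [f1 c (by omega) (by omega)]
        omega
      · have e := f2 x hx (by omega)
        by_cases hck : c < k
        · have g := B.next_le_next (x := x) (c := c) hxc (by omega)
          by_cases h' : B.next c ≤ k
          · have := f1 c hck h'
            have := B.lt_next (B.next x)
            omega
          · have e' := f2 c hck (by omega)
            rcases g.eq_or_lt with g | g
            · rw [g] at e'
              omega
            · have := B.lt_next c
              have := B.next_le_next (x := x) (c := B.next c) (by omega) g
              have := B.lt_next (B.next x)
              omega
        · have e' := f3 c (by omega)
          rcases lt_trichotomy (c + 1) (B.next x) with g | g | g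
          · have := B.next_le_next (x := x) (c := c + 1) (by omega) g
            have := B.lt_next (B.next x)
            omega
          · rw [g] at e'
            omega
          · have := B.next_le_next (x := B.next x) (c := c + 1) g (by omega)
            omega
    · have e := f3 x (by omega)
      have e' := f3 c (by omega)
      have := B.next_le_next (x := x + 1) (c := c + 1) (by omega) (by omega)
      omega
  · intro x y hxy hr
    have := B.supp hr
    unfold shiftIns at this
    split_ifs at this <;> omega
  · exact fun x y z _ _ h h' => B.trans h h'
  · exact fun x y z h h' hr => B.inc (shiftIns_lt h) (shiftIns_lt h') hr
  · intro x y hxy hr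
    have hy : k ≤ y := by
      by_contra hlt
      refine hno _ _ (shiftIns_lt (k := k) hxy) ?_ hr
      rw [shiftIns, if_pos (by omega)]
      omega
    have hlt := shiftIns_lt (k := k) hxy
    have e : shiftIns k y = y + 1 := if_neg (by omega)
    rw [e] at hr hlt
    have g := B.next_le_of_rel hlt hr
    by_cases hx : x < k
    · rw [shiftIns, if_pos hx] at hr g
      by_cases h : B.next x ≤ k
      · rw [f1 x hx h]
        omega
      · have e' := f2 x hx (by omega)
        have g' := h4' x hx (by omega)
        have hne : B.next x ≠ y + 1 := fun h => g'.2.2 (h ▸ hr)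
        have := B.lt_next x
        have := B.next_le_of_rel (by omega) (B.inc (b := B.next x) (by omega) (by omega) hr)
        omega
    · rw [shiftIns, if_neg hx] at g
      have := f3 x (by omega)
      omega

/-- Relation generating the increasing relations of the poset with a vertex inserted. -/
theorem Ins.rel_iff_transGen {A B : IPoset} {k a b : ℕ} (h : Ins A B k) (hab : a < b) :
    B.rel a b ↔ Relation.TransGen (fun u v =>
        (u = k ∧ v = k + 1 ∧ k + 1 ≤ A.n + 1) ∨
        ∃ a' b', a' < b' ∧ A.rel a' b' ∧ u = shiftIns k a' ∧ v = shiftIns k b') a b := by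
  have h1 := h.pos
  have h2 := h.card
  constructor
  · intro hr
    obtain ⟨hkb, hA⟩ := (h.up a b hab).mp hr
    have hs := A.supp hA
    have hb : shiftIns k (b - 1) = b := by
      unfold shiftIns
      split_ifs <;> omega
    by_cases ha : a = k
    · subst ha
      rw [unshift, if_pos le_rfl] at hA
      have hstep : a = a ∧ a + 1 = a + 1 ∧ a + 1 ≤ A.n + 1 := ⟨rfl, rfl, by omega⟩
      rcases (Nat.le_sub_one_of_lt hab).eq_or_lt with e | e
      · obtain rfl : b = a + 1 := by omega
        exact .single (Or.inl hstep)
      · refine .tail (.single (Or.inl hstep)) (Or.inr ⟨a, b - 1, e, hA, ?_, hb.symm⟩)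
        rw [shiftIns, if_neg (lt_irrefl _)]
    · refine .single (Or.inr ⟨unshift k a, b - 1, ?_, hA, ?_, hb.symm⟩)
      · unfold unshift
        split_ifs <;> omega
      · unfold unshift shiftIns
        split_ifs <;> omega
  · intro ht
    clear hab
    have hstep : ∀ u v, ((u = k ∧ v = k + 1 ∧ k + 1 ≤ A.n + 1) ∨
        ∃ a' b', a' < b' ∧ A.rel a' b' ∧ u = shiftIns k a' ∧ v = shiftIns k b') → B.rel u v := by
      rintro u v (⟨rfl, rfl, hk⟩ | ⟨a', b', hlt, hr, rfl, rfl⟩)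
      · refine (h.up _ _ (by omega)).mpr ⟨by omega, ?_⟩
        rw [unshift, if_pos le_rfl]
        exact A.refl _ h1 (by omega)
      · refine (h.up_shift hlt).mpr ⟨?_, hr⟩
        by_contra hlt'
        exact h.notrel _ _ hlt (by omega) hr
    induction ht with
    | single hs => exact hstep _ _ hs
    | tail _ hs ih => exact B.trans ih (hstep _ _ hs)

theorem Ins.insNext_next {A B : IPoset} {k y y' : ℕ} (h : Ins A B k) (hy : A.InsNext k y y') :
    A.InsNext k (A.next y) (B.next y') := by
  rcases hy with ⟨h1, rfl⟩ | ⟨z, hz, rfl, rfl⟩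
  · rcases h1.eq_or_lt with rfl | h1
    · exact Or.inr ⟨y', A.rootFrom_self y', rfl, h.next_self⟩
    · exact h.next_lt _ h1
  · exact Or.inr ⟨A.next z, hz.next, rfl, h.next_ge z hz.1⟩

theorem InsNext.unique {A : IPoset} {k y y₁ y₂ : ℕ} (h₁ : A.InsNext k y y₁)
    (h₂ : A.InsNext k y y₂) : y₁ = y₂ := by
  rcases h₁ with h | ⟨z, hz, rfl, rfl⟩
  · exact h.2.trans ((A.insNext_iff_of_le h.1).mp h₂).symm
  · rcases h₂ with h | ⟨z', hz', e, rfl⟩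
    · have := A.lt_next z
      have := hz.1
      omega
    · have := hz.le_of_next_le hz' (by omega)
      have := hz'.le_of_next_le hz (by omega)
      omega

theorem Ins.decChildCount_shiftIns {A B : IPoset} {k : ℕ} (h : Ins A B k) (v : ℕ) :
    decChildCount B (shiftIns k v) = decChildCount A v := by
  apply B.decChildCount_eq
  have hA := A.iterate_next_decChildCount v
  generalize decChildCount A v = c at hA
  unfold shiftIns
  split_ifs with hv
  · have key : ∀ c, A.InsNext k (A.next^[c] (v + 1)) (B.next^[c] (v + 1)) := by
      intro c
      induction c with
      | zero => exact Or.inl ⟨hv, rfl⟩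
      | succ c ih =>
        rw [Function.iterate_succ_apply', Function.iterate_succ_apply']
        exact h.insNext_next ih
    have hc := key c
    rw [hA] at hc
    exact hc.unique (h.next_lt v hv)
  · have key : ∀ c, k ≤ A.next^[c] (v + 1) ∧
        B.next^[c] (v + 1 + 1) = A.next^[c] (v + 1) + 1 := by
      intro c
      induction c with
      | zero => exact ⟨by simp; omega, rfl⟩
      | succ c ih =>
        rw [Function.iterate_succ_apply', Function.iterate_succ_apply', ih.2, h.next_ge _ ih.1]
        have := A.lt_next (A.next^[c] (v + 1))
        exact ⟨by omega, rfl⟩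
    rw [(key c).2, hA, h.next_ge v (by omega)]

theorem Ins.isInsert {A B : IPoset} {r : ℕ} (h : Ins A B (ir A + 1 - r)) : IsInsert A r B :=
  ⟨h.card, fun _ _ hab => h.rel_iff_transGen hab, fun v _ _ => h.decChildCount_shiftIns v⟩

theorem decChildCount_eq_zero (I : IPoset) {k : ℕ} (h : I.next k = k + 1) :
    decChildCount I k = 0 :=
  I.decChildCount_eq h.symm

theorem exists_ins_of_le_ir (A : IPoset) {r : ℕ} (hr : r ≤ ir A) :
    ∃ B, Ins A B (ir A + 1 - r) := by
  have := A.ir_le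
  exact A.exists_ins (by omega) (by omega) fun x y hxy hy => A.not_rel_of_le_ir hxy (by omega)

theorem isInsert_iff {A B : IPoset} {r : ℕ} (hr : r ≤ ir A) :
    IsInsert A r B ↔ Ins A B (ir A + 1 - r) := by
  refine ⟨fun hB => ?_, Ins.isInsert⟩
  obtain ⟨C, hC⟩ := A.exists_ins_of_le_ir hr
  suffices B = C from this ▸ hC
  obtain ⟨hn, hup, hcount⟩ := hB
  have hCn := hC.card
  have hup' : ∀ x y, x < y → (B.rel x y ↔ C.rel x y) := fun x y hxy =>
    (hup x y hxy).trans (hC.rel_iff_transGen hxy).symm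
  refine ext_next (by omega) (next_eq_of_decChildCount_eq (by omega) fun v h1 h2 => ?_) hup'
  generalize hk : ir A + 1 - r = k at *
  have hcount' : ∀ w, 1 ≤ w → w ≤ A.n → v = shiftIns k w →
      decChildCount B v = decChildCount C v := by
    rintro w hw1 hw2 rfl
    exact (hcount w hw1 hw2).trans (hC.decChildCount_shiftIns w).symm
  have hle := hC.le
  rcases lt_trichotomy v k with hv | rfl | hv
  · exact hcount' v h1 (by omega) (if_pos hv).symm
  · rw [C.decChildCount_eq_zero hC.next_self, B.decChildCount_eq_zero]
    have := B.lt_next v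
    rcases C.ir_eq_or_rel with e | e
    · rw [hC.ir_eq] at e
      have := B.next_le h2
      omega
    · rw [hC.ir_eq] at e
      have := B.next_le_of_rel (by omega) ((hup' _ _ (by omega)).mpr e)
      omega
  · refine hcount' (v - 1) (by have := hC.pos; omega) (by omega) ?_
    unfold shiftIns
    split_ifs <;> omega

theorem Ins.right_unique {A B C : IPoset} {k : ℕ} (h : Ins A B k) (h' : Ins A C k) : B = C := by
  have h1 := h.card
  have h2 := h'.card
  refine ext_next (by omega) (fun v => ?_) fun x y hxy => ?_
  · rcases lt_trichotomy v k with hv | rfl | hv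
    · exact (h.next_lt v hv).unique (h'.next_lt v hv)
    · rw [h.next_self, h'.next_self]
    · obtain ⟨v, rfl⟩ : ∃ w, v = w + 1 := ⟨v - 1, by omega⟩
      rw [h.next_ge v (by omega), h'.next_ge v (by omega)]
  · rw [h.up x y hxy, h'.up x y hxy]

/-! Merging -/

theorem mapMerge_of_le {a m v : ℕ} (h : v ≤ a) : mapMerge a m v = v := if_pos h

theorem mapMerge_of_lt {a m v : ℕ} (h : a < v) : mapMerge a m v = v + m := if_neg (not_le.mpr h)

theorem mapMerge_cases (a m v : ℕ) :
    (v ≤ a ∧ mapMerge a m v = v) ∨ (a < v ∧ mapMerge a m v = v + m) := by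
  unfold mapMerge
  split_ifs <;> omega

theorem eq_mapMerge_or_block (a m x : ℕ) :
    (a < x ∧ x ≤ a + m) ∨ ∃ p, x = mapMerge a m p := by
  rcases le_or_gt x a with h | h
  · exact Or.inr ⟨x, (mapMerge_of_le h).symm⟩
  · rcases le_or_gt x (a + m) with h' | h'
    · exact Or.inl ⟨h, h'⟩
    · refine Or.inr ⟨x - m, ?_⟩
      rw [mapMerge_of_lt (by omega)]
      omega

theorem mapMerge_lt_iff {a m p q : ℕ} : mapMerge a m p < mapMerge a m q ↔ p < q := by
  have := mapMerge_cases a m p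
  have := mapMerge_cases a m q
  omega

theorem mapMerge_inj {a m p q : ℕ} : mapMerge a m p = mapMerge a m q ↔ p = q := by
  have := mapMerge_cases a m p
  have := mapMerge_cases a m q
  omega

/-- The relation of the poset obtained by inserting `B` after the vertex `a` of `A`. -/
def MergeRel (A B : IPoset) (a x y : ℕ) : Prop :=
  (∃ p q, A.rel p q ∧ x = mapMerge a B.n p ∧ y = mapMerge a B.n q) ∨
  (∃ p q, B.rel p q ∧ x = p + a ∧ y = q + a) ∨
  (∃ q, a < x ∧ x ≤ a + B.n ∧ A.rel a q ∧ y = mapMerge a B.n q)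

theorem mergeRel_mapMerge_left {A B : IPoset} {a p y : ℕ} :
    MergeRel A B a (mapMerge a B.n p) y ↔ ∃ q, A.rel p q ∧ y = mapMerge a B.n q := by
  have hc := mapMerge_cases a B.n p
  constructor
  · rintro (⟨p', q, h, e, rfl⟩ | ⟨p', q, h, e, rfl⟩ | ⟨q, h1, h2, h, rfl⟩)
    · rw [mapMerge_inj.mp e]
      exact ⟨q, h, rfl⟩
    · have := B.supp h
      omega
    · omega
  · rintro ⟨q, h, rfl⟩
    exact Or.inl ⟨p, q, h, rfl, rfl⟩

theorem mergeRel_mapMerge {A B : IPoset} {a p q : ℕ} :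
    MergeRel A B a (mapMerge a B.n p) (mapMerge a B.n q) ↔ A.rel p q := by
  simp [mergeRel_mapMerge_left, mapMerge_inj]

theorem mergeRel_block_right {A B : IPoset} {a x y : ℕ} (h1 : a < y) (h2 : y ≤ a + B.n) :
    MergeRel A B a x y ↔ ∃ p q, B.rel p q ∧ x = p + a ∧ y = q + a := by
  constructor
  · rintro (⟨p, q, h, e, rfl⟩ | h | ⟨q, _, _, h, rfl⟩)
    · have := mapMerge_cases a B.n q
      omega
    · exact h
    · have := mapMerge_cases a B.n q
      omega
  · exact fun h => Or.inr (Or.inl h)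

theorem mergeRel_block {A B : IPoset} {a x q : ℕ} (h1 : a < x) (h2 : x ≤ a + B.n) :
    MergeRel A B a x (mapMerge a B.n q) ↔ A.rel a q := by
  have hc := mapMerge_cases a B.n q
  constructor
  · rintro (⟨p, q', h, rfl, e⟩ | ⟨p, q', h, rfl, e⟩ | ⟨q', _, _, h, e⟩)
    · have := mapMerge_cases a B.n p
      omega
    · have := B.supp h
      omega
    · rwa [mapMerge_inj.mp e]
  · exact fun h => Or.inr (Or.inr ⟨q, h1, h2, h, rfl⟩)

theorem mergeRel_trans {A B : IPoset} {a x y z : ℕ} (h : MergeRel A B a x y)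
    (h' : MergeRel A B a y z) : MergeRel A B a x z := by
  rcases eq_mapMerge_or_block a B.n y with ⟨h1, h2⟩ | ⟨q, rfl⟩
  · obtain ⟨p, q, hr, rfl, rfl⟩ := (mergeRel_block_right h1 h2).mp h
    have hs := B.supp hr
    rcases eq_mapMerge_or_block a B.n z with ⟨h3, h4⟩ | ⟨s, rfl⟩
    · obtain ⟨q', s, hr', e, rfl⟩ := (mergeRel_block_right h3 h4).mp h'
      obtain rfl : q = q' := by omega
      exact Or.inr (Or.inl ⟨p, s, B.trans hr hr', rfl, rfl⟩)
    · rw [mergeRel_block h1 h2] at h'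
      rwa [mergeRel_block (by omega) (by omega)]
  · obtain ⟨s, hr, rfl⟩ := mergeRel_mapMerge_left.mp h'
    rcases eq_mapMerge_or_block a B.n x with ⟨h1, h2⟩ | ⟨p, rfl⟩
    · rw [mergeRel_block h1 h2] at h ⊢
      exact A.trans h hr
    · rw [mergeRel_mapMerge] at h ⊢
      exact A.trans h hr

theorem irRel_iff {A B : IPoset} {x y : ℕ} : IRrel A B x y ↔ MergeRel A B (ir A) x y := by
  have ha := A.ir_le
  constructor
  · rintro (⟨rfl, h1, h2⟩ | h)
    · rcases eq_mapMerge_or_block (ir A) B.n x with ⟨h3, h4⟩ | ⟨p, rfl⟩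
      · exact Or.inr (Or.inl ⟨x - ir A, x - ir A, B.refl _ (by omega) (by omega),
          by omega, by omega⟩)
      · have := mapMerge_cases (ir A) B.n p
        exact mergeRel_mapMerge.mpr (A.refl _ (by omega) (by omega))
    · have hstep : ∀ u v, ((∃ p q, A.rel p q ∧ u = mapMerge (ir A) B.n p ∧
          v = mapMerge (ir A) B.n q) ∨ (∃ p q, B.rel p q ∧ u = p + ir A ∧ v = q + ir A) ∨
          (1 ≤ ir A ∧ ir A < u ∧ u ≤ ir A + B.n ∧ v = ir A)) → MergeRel A B (ir A) u v := by
        rintro u v (h | h | ⟨h1, h2, h3, rfl⟩)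
        · exact Or.inl h
        · exact Or.inr (Or.inl h)
        · exact Or.inr (Or.inr ⟨ir A, h2, h3, A.refl _ h1 ha, (mapMerge_of_le le_rfl).symm⟩)
      induction h with
      | single hs => exact hstep _ _ hs
      | tail _ hs ih => exact mergeRel_trans ih (hstep _ _ hs)
  · rintro (h | h | ⟨q, h1, h2, h, rfl⟩)
    · exact Or.inr (.single (Or.inl h))
    · exact Or.inr (.single (Or.inr (Or.inl h)))
    · refine Or.inr (.tail (.single (Or.inr (Or.inr ⟨?_, h1, h2, rfl⟩)))
        (Or.inl ⟨ir A, q, h, (mapMerge_of_le le_rfl).symm, rfl⟩))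
      exact (A.supp h).1

/-- `J` is obtained by inserting `B` after the vertex `a` of `A`. -/
def Merge (A B : IPoset) (a : ℕ) (J : IPoset) : Prop :=
  J.n = A.n + B.n ∧ ∀ x y, J.rel x y ↔ MergeRel A B a x y

theorem exists_merge (A B : IPoset) {a : ℕ} (ha : a ≤ A.n) : ∃ J, Merge A B a J := by
  refine ⟨⟨A.n + B.n, MergeRel A B a, ?_, ?_, ?_, fun _ _ _ => mergeRel_trans, ?_, ?_⟩, rfl,
    fun _ _ => Iff.rfl⟩
  · rintro x y (⟨p, q, h, rfl, rfl⟩ | ⟨p, q, h, rfl, rfl⟩ | ⟨q, h1, h2, h, rfl⟩)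
    · have := A.supp h
      have := mapMerge_cases a B.n p
      have := mapMerge_cases a B.n q
      omega
    · have := B.supp h
      omega
    · have := A.supp h
      have := mapMerge_cases a B.n q
      omega
  · intro x h1 h2
    rcases eq_mapMerge_or_block a B.n x with ⟨h3, h4⟩ | ⟨p, rfl⟩
    · exact Or.inr (Or.inl ⟨x - a, x - a, B.refl _ (by omega) (by omega), by omega, by omega⟩)
    · have := mapMerge_cases a B.n p
      exact mergeRel_mapMerge.mpr (A.refl _ (by omega) (by omega))
  · intro x y h h'
    rcases eq_mapMerge_or_block a B.n y with ⟨h1, h2⟩ | ⟨q, rfl⟩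
    · obtain ⟨p, q, hr, rfl, rfl⟩ := (mergeRel_block_right h1 h2).mp h
      have := B.supp hr
      obtain ⟨q', p', hr', e', e⟩ := (mergeRel_block_right (by omega) (by omega)).mp h'
      obtain rfl : q = q' := by omega
      obtain rfl : p = p' := by omega
      rw [B.antisymm hr hr']
    · obtain ⟨p, hr, rfl⟩ := mergeRel_mapMerge_left.mp h'
      rw [mergeRel_mapMerge] at h
      rw [A.antisymm h hr]
  · intro x y z hxy hyz h
    rcases eq_mapMerge_or_block a B.n z with ⟨h1, h2⟩ | ⟨s, rfl⟩
    · obtain ⟨p, s, hr, rfl, rfl⟩ := (mergeRel_block_right h1 h2).mp h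
      exact Or.inr (Or.inl ⟨y - a, s, B.inc (a := p) (by omega) (by omega) hr, by omega, rfl⟩)
    · have hs := mapMerge_cases a B.n s
      rcases eq_mapMerge_or_block a B.n x with ⟨h1, h2⟩ | ⟨p, rfl⟩
      · rw [mergeRel_block h1 h2] at h
        rcases eq_mapMerge_or_block a B.n y with ⟨h3, h4⟩ | ⟨q, rfl⟩
        · rwa [mergeRel_block h3 h4]
        · have := mapMerge_cases a B.n q
          rw [mergeRel_mapMerge]
          exact A.inc (a := a) (by omega) (by omega) h
      · rw [mergeRel_mapMerge] at h
        have := mapMerge_cases a B.n p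
        rcases eq_mapMerge_or_block a B.n y with ⟨h3, h4⟩ | ⟨q, rfl⟩
        · rw [mergeRel_block h3 h4]
          rcases (show p ≤ a by omega).eq_or_lt with rfl | hp
          · exact h
          · exact A.inc hp (by omega) h
        · rw [mapMerge_lt_iff] at hxy hyz
          rw [mergeRel_mapMerge]
          exact A.inc hxy hyz h
  · intro x y z hxy hyz h
    rcases eq_mapMerge_or_block a B.n x with ⟨h1, h2⟩ | ⟨p, rfl⟩
    · obtain ⟨s, p, hr, rfl, rfl⟩ := (mergeRel_block_right h1 h2).mp h
      exact Or.inr (Or.inl ⟨y - a, p, B.dec (c := s) (by omega) (by omega) hr, by omega, rfl⟩)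
    · have hp := mapMerge_cases a B.n p
      rcases eq_mapMerge_or_block a B.n z with ⟨h1, h2⟩ | ⟨s, rfl⟩
      · rw [mergeRel_block h1 h2] at h
        rcases eq_mapMerge_or_block a B.n y with ⟨h3, h4⟩ | ⟨q, rfl⟩
        · rwa [mergeRel_block h3 h4]
        · have := mapMerge_cases a B.n q
          rw [mergeRel_mapMerge]
          rcases (show q ≤ a by omega).eq_or_lt with rfl | hq
          · exact h
          · exact A.dec (c := a) (by omega) hq h
      · rw [mergeRel_mapMerge] at h
        have := mapMerge_cases a B.n s
        have := A.supp h
        rcases eq_mapMerge_or_block a B.n y with ⟨h3, h4⟩ | ⟨q, rfl⟩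
        · rw [mergeRel_block h3 h4]
          rcases (show p ≤ a by omega).eq_or_lt with rfl | hp
          · exact A.refl _ (by omega) ha
          · exact A.dec hp (by omega) h
        · rw [mapMerge_lt_iff] at hxy hyz
          rw [mergeRel_mapMerge]
          exact A.dec hxy hyz h

theorem Merge.right_unique {A B J K : IPoset} {a : ℕ} (h : Merge A B a J) (h' : Merge A B a K) :
    J = K :=
  ext_rel (h.1.trans h'.1.symm) fun x y => (h.2 x y).trans (h'.2 x y).symm

theorem Merge.rel_mapMerge {A B J : IPoset} {a p q : ℕ} (h : Merge A B a J) :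
    J.rel (mapMerge a B.n p) (mapMerge a B.n q) ↔ A.rel p q :=
  (h.2 _ _).trans mergeRel_mapMerge

theorem Merge.rel_block {A B J : IPoset} {a p q : ℕ} (h : Merge A B a J) (hq : 1 ≤ q)
    (hq' : q ≤ B.n) : J.rel (p + a) (q + a) ↔ B.rel p q := by
  rw [h.2, mergeRel_block_right (by omega) (by omega)]
  constructor
  · rintro ⟨p', q', hr, e, e'⟩
    obtain rfl : p = p' := by omega
    obtain rfl : q = q' := by omega
    exact hr
  · exact fun hr => ⟨p, q, hr, rfl, rfl⟩

theorem Merge.left_unique {A B A' B' J : IPoset} {a : ℕ} (h : Merge A B a J)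
    (h' : Merge A' B' a J) (hB : B.n = B'.n) : A = A' ∧ B = B' := by
  have h1 := h.1
  have h2 := h'.1
  constructor
  · refine ext_rel (by omega) fun p q => ?_
    rw [← h.rel_mapMerge, ← h'.rel_mapMerge, hB]
  · refine ext_rel hB fun p q => ?_
    by_cases hq : 1 ≤ q ∧ q ≤ B.n
    · rw [← h.rel_block hq.1 hq.2, h'.rel_block hq.1 (hB ▸ hq.2)]
    · constructor
      · intro hr
        have := B.supp hr
        omega
      · intro hr
        have := B'.supp hr
        omega

/-- The vertices `a + 1, …, a + m` form a block of `J` that may be the inserted one. -/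
structure Cut (J : IPoset) (a m : ℕ) : Prop where
  lt : a < ir J
  ir_le : ir J ≤ a + m
  le : a + m ≤ J.n
  zero : a = 0 → m = J.n
  below : 1 ≤ a → J.rel (a + m) a
  above : a + m = J.n ∨ J.rel a (a + m + 1)

theorem Merge.cut {A B J : IPoset} (h : Merge A B (ir A) J) (hB : 1 ≤ B.n) :
    Cut J (ir A) B.n ∧ ir J = ir A + ir B := by
  have hn := h.1
  have hA := A.ir_le
  have hB' := B.ir_le
  have hB1 := B.ir_pos hB
  have hself : mapMerge (ir A) B.n (ir A) = ir A := mapMerge_of_le le_rfl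
  have hsucc : mapMerge (ir A) B.n (ir A + 1) = ir A + B.n + 1 := by
    rw [mapMerge_of_lt (by omega)]
    omega
  have hir : ir J = ir A + ir B := by
    refine J.ir_eq (by omega) (fun x y hxy hy hr => ?_) ?_
    · rcases (h.2 x y).mp hr with ⟨p, q, hr', rfl, rfl⟩ | ⟨p, q, hr', rfl, rfl⟩ |
        ⟨q, h1, h2, hr', rfl⟩
      · have := mapMerge_cases (ir A) B.n q
        exact A.not_rel_of_le_ir (mapMerge_lt_iff.mp hxy) (by omega) hr'
      · exact B.not_rel_of_le_ir (x := p) (y := q) (by omega) (by omega) hr'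
      · have := mapMerge_cases (ir A) B.n q
        omega
    · rcases B.ir_eq_or_rel with e | e
      · rcases A.ir_eq_or_rel with e' | e'
        · exact Or.inl (by omega)
        · refine Or.inr ?_
          rw [h.2, e, ← hsucc]
          exact (mergeRel_block (by omega) (by omega)).mpr e'
      · refine Or.inr ((h.2 _ _).mpr (Or.inr (Or.inl ⟨_, _, e, ?_, ?_⟩))) <;> omega
  refine ⟨⟨by omega, by omega, by omega, fun h0 => ?_, fun h1 => ?_, ?_⟩, hir⟩
  · have := A.ir_pos
    omega
  · refine (h.2 _ _).mpr (Or.inr (Or.inr ⟨ir A, by omega, le_rfl, A.refl _ h1 hA, hself.symm⟩))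
  · rcases A.ir_eq_or_rel with e | e
    · exact Or.inl (by omega)
    · refine Or.inr ((h.2 _ _).mpr (Or.inl ⟨_, _, e, hself.symm, hsucc.symm⟩))

theorem Cut.size_unique {J : IPoset} {a m m' : ℕ} (h : Cut J a m) (h' : Cut J a m') : m = m' := by
  have key : ∀ m m', Cut J a m → Cut J a m' → ¬ m < m' := by
    intro m m' h h' hlt
    rcases Nat.eq_zero_or_pos a with h0 | h0
    · have := h.zero h0
      have := h'.zero h0
      omega
    · have h1 := h'.below h0
      have h2 := h.le
      have h3 := h'.le
      have h4 := h.above.resolve_left (by omega)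
      have h5 := J.next_le_of_rel (by omega) h4
      rw [J.rel_iff_lt_next (by have := h.lt; have := h.ir_le; omega)] at h1
      omega
  have := key m m' h h'
  have := key m' m h' h
  omega

theorem Cut.exists_merge {J : IPoset} {a m : ℕ} (h : Cut J a m) :
    ∃ A B, B.n = m ∧ ir A = a ∧ Merge A B a J := by
  obtain ⟨h1, h2, h3, h4, h5, h6⟩ := h
  let A : IPoset :=
    { n := J.n - m
      rel := fun p q => J.rel (mapMerge a m p) (mapMerge a m q)
      supp := fun p q hr => by
        have := J.supp hr
        have := mapMerge_cases a m p
        have := mapMerge_cases a m q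
        omega
      refl := fun p hp hp' => by
        have := mapMerge_cases a m p
        exact J.refl _ (by omega) (by omega)
      antisymm := fun p q hr hr' => mapMerge_inj.mp (J.antisymm hr hr')
      trans := fun p q s hr hr' => J.trans hr hr'
      inc := fun p q s hpq hqs hr =>
        J.inc (mapMerge_lt_iff.mpr hpq) (mapMerge_lt_iff.mpr hqs) hr
      dec := fun p q s hpq hqs hr =>
        J.dec (mapMerge_lt_iff.mpr hpq) (mapMerge_lt_iff.mpr hqs) hr }
  let B : IPoset :=
    { n := m
      rel := fun p q => 1 ≤ p ∧ p ≤ m ∧ 1 ≤ q ∧ q ≤ m ∧ J.rel (p + a) (q + a)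
      supp := fun p q hr => by omega
      refl := fun p hp hp' => ⟨hp, hp', hp, hp', J.refl _ (by omega) (by omega)⟩
      antisymm := fun p q hr hr' => by
        have := J.antisymm hr.2.2.2.2 hr'.2.2.2.2
        omega
      trans := fun p q s hr hr' => ⟨hr.1, hr.2.1, hr'.2.2.1, hr'.2.2.2.1,
        J.trans hr.2.2.2.2 hr'.2.2.2.2⟩
      inc := fun p q s hpq hqs hr => ⟨by omega, by omega, hr.2.2.1, hr.2.2.2.1,
        J.inc (a := p + a) (by omega) (by omega) hr.2.2.2.2⟩
      dec := fun p q s hpq hqs hr => ⟨by omega, by omega, hr.2.2.1, hr.2.2.2.1,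
        J.dec (c := s + a) (by omega) (by omega) hr.2.2.2.2⟩ }
  have hself : mapMerge a m a = a := mapMerge_of_le le_rfl
  have hsucc : mapMerge a m (a + 1) = a + m + 1 := by
    rw [mapMerge_of_lt (by omega)]
    omega
  have hbelow : ∀ x, 1 ≤ a → a < x → x ≤ a + m → J.rel x a := by
    intro x ha hx hx'
    rcases hx'.eq_or_lt with rfl | hx'
    · exact h5 ha
    · exact J.dec hx hx' (h5 ha)
  have hirA : ir A = a := by
    refine A.ir_eq (show a ≤ J.n - m by omega) (fun x y hxy hy hr => ?_) ?_
    · change J.rel (mapMerge a m x) (mapMerge a m y) at hr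
      rw [mapMerge_of_le hy, mapMerge_of_le (by omega)] at hr
      exact J.not_rel_of_le_ir hxy (by omega) hr
    · rcases h6 with h6 | h6
      · exact Or.inl (show a = J.n - m by omega)
      · refine Or.inr (show J.rel (mapMerge a m a) (mapMerge a m (a + 1)) from ?_)
        rwa [hself, hsucc]
  refine ⟨A, B, rfl, hirA, show J.n = J.n - m + m by omega, fun x y => ?_⟩
  rcases eq_mapMerge_or_block a m y with ⟨hy1, hy2⟩ | ⟨q, rfl⟩
  · rw [mergeRel_block_right hy1 hy2]
    constructor
    · intro hr
      have hs := J.supp hr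
      by_cases hx : a < x ∧ x ≤ a + m
      · refine ⟨x - a, y - a, ⟨by omega, by omega, by omega, by omega, ?_⟩, by omega, by omega⟩
        rwa [Nat.sub_add_cancel hx.1.le, Nat.sub_add_cancel hy1.le]
      · exfalso
        rcases le_or_gt x a with hxa | hxa
        · have ha : J.rel a y := by
            rcases hxa.eq_or_lt with rfl | hxa
            · exact hr
            · exact J.inc hxa hy1 hr
          have := J.antisymm ha (hbelow y (by omega) hy1 hy2)
          omega
        · have h6' := h6.resolve_left (by omega)
          have hs' := J.supp h6'
          have hxy : J.rel (a + m + 1) y := by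
            rcases (show a + m + 1 ≤ x by omega).eq_or_lt with e | hlt
            · rwa [e]
            · exact J.dec (by omega) hlt hr
          have := J.antisymm h6' (J.trans hxy (hbelow y hs'.1 hy1 hy2))
          omega
    · rintro ⟨p, q, hr, rfl, rfl⟩
      exact hr.2.2.2.2
  · rcases eq_mapMerge_or_block a m x with ⟨hx1, hx2⟩ | ⟨p, rfl⟩
    · have e : MergeRel A B a x (mapMerge a m q) ↔ A.rel a q := mergeRel_block hx1 hx2
      have e' : A.rel a q ↔ J.rel a (mapMerge a m q) := by
        change J.rel (mapMerge a m a) (mapMerge a m q) ↔ _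
        rw [hself]
      rw [e, e']
      constructor
      · intro hr
        have hs := J.supp hr
        rcases mapMerge_cases a m q with ⟨hq, e1⟩ | ⟨hq, e1⟩
        · rw [e1] at hr hs ⊢
          rcases hq.eq_or_lt with rfl | hq
          · exact J.refl _ (by omega) (by omega)
          · exact J.dec hq hx1 hr
        · rw [e1] at hr hs ⊢
          have h6' := h6.resolve_left (by omega)
          rcases (show a + m + 1 ≤ q + m by omega).eq_or_lt with e2 | hlt
          · rwa [← e2]
          · exact J.trans h6' (J.inc (by omega) hlt hr)
      · exact fun hr => J.trans (hbelow x (J.supp hr).1 hx1 hx2) hr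
    · exact (mergeRel_mapMerge (A := A) (B := B)).symm

/-! The composition -/

theorem isIRComp_iff {A C J : IPoset} {r : ℕ} (hr : r ≤ ir C) :
    IsIRComp A C r J ↔ ∃ B, Ins C B (ir C + 1 - r) ∧ Merge A B (ir A) J := by
  simp only [IsIRComp, isInsert_iff hr, irRel_iff, Merge]

theorem exists_maximal_cut (J : IPoset) (h : 1 ≤ J.n) :
    ∃ a m, Cut J a m ∧ ∀ a' m', Cut J a' m' → a' ≤ a := by
  classical
  have h0 : Cut J 0 J.n := ⟨J.ir_pos h, by simpa using J.ir_le, by omega, fun _ => rfl,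
    by omega, Or.inl (by omega)⟩
  obtain ⟨m, hm⟩ := Nat.findGreatest_spec (P := fun a => ∃ m, Cut J a m) (Nat.zero_le J.n)
    ⟨J.n, h0⟩
  exact ⟨_, m, hm, fun a' m' h' => Nat.le_findGreatest (by have := h'.le; omega) ⟨m', h'⟩⟩

/-- Only the largest cut allows the vertex `ir J` to be deleted from the block. -/
theorem Cut.le_of_ins {A B C J : IPoset} {a' m' k : ℕ} (hm : Merge A B (ir A) J)
    (hi : Ins C B k) (h' : Cut J a' m') : a' ≤ ir A := by
  by_contra hlt
  push Not at hlt
  have h1 := hi.pos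
  have h2 := hi.le
  obtain ⟨hcut, hir⟩ := hm.cut (by omega)
  rw [hi.ir_eq] at hir
  have hle := hcut.le
  obtain ⟨g1, g2, g3, g4, g5, g6⟩ := h'
  have hk1 : J.rel (ir J) a' := by
    rcases g2.eq_or_lt with e | e
    · rw [e]
      exact g5 (by omega)
    · exact J.dec g1 e (g5 (by omega))
  have hrel : ∀ x y, ir A < y → y ≤ ir A + B.n → ir A ≤ x →
      (J.rel x y ↔ B.rel (x - ir A) (y - ir A)) := by
    intro x y hy hy' hx
    rw [← hm.rel_block (by omega) (by omega), Nat.sub_add_cancel hx, Nat.sub_add_cancel hy.le]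
  rw [hrel _ _ hlt (by omega) (by omega), B.rel_iff_lt_next (by omega)] at hk1
  have hbound : B.next (a' - ir A) ≤ B.n + 1 := B.next_le (by omega)
  obtain ⟨e1, e2⟩ := hi.extendable (p := a' - ir A) (by omega) (by omega)
  have hd1 : a' + m' < ir A + B.next (a' - ir A) := by
    have := g5 (by omega)
    have hle : a' + m' - ir A < B.next (a' - ir A) := by
      rw [← B.rel_iff_lt_next (by omega), ← hrel _ _ hlt (by omega) (by omega)]
      exact this
    omega
  have g6' := g6.resolve_left (by have := hm.1; omega)
  rw [hrel _ _ (by omega) (by omega) hlt.le] at g6'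
  have := B.next_le_of_rel (by omega) g6'
  have heq : a' + m' + 1 - ir A = B.next (a' - ir A) := by omega
  rw [heq] at g6'
  exact e2 g6'

theorem exists_ins_of_maximal {A B J : IPoset} (hm : Merge A B (ir A) J) (hB : 1 ≤ B.n)
    (hmax : ∀ a' m', Cut J a' m' → a' ≤ ir A) : ∃ C, Ins C B (ir B) := by
  obtain ⟨hcut, hir⟩ := hm.cut hB
  have hJ := hm.1
  have hcle := hcut.le
  refine B.exists_ins_right (B.ir_pos hB) B.ir_le rfl fun p hp hpk hk => ?_
  by_contra hcon
  have hple := B.next_le (x := p) (by have := B.ir_le; omega)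
  have habove : ir A + B.n = J.n ∨ J.rel (p + ir A) (ir A + B.n + 1) := by
    rcases A.ir_eq_or_rel with e | e
    · exact Or.inl (by omega)
    · refine Or.inr ((hm.2 _ _).mpr (Or.inr (Or.inr ⟨_, by omega, ?_, e, ?_⟩)))
      · have := B.ir_le
        omega
      · rw [mapMerge_of_lt (by omega)]
        omega
  have hle := hmax (p + ir A) (B.next p - 1 - p) ?_
  · omega
  refine ⟨by omega, by omega, by omega, by omega, fun _ => ?_, ?_⟩
  · have e : p + ir A + (B.next p - 1 - p) = (B.next p - 1) + ir A := by omega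
    rw [e, hm.rel_block hp (by omega), B.rel_iff_lt_next (by omega)]
    omega
  · by_cases hn : B.next p ≤ B.n
    · have hr : B.rel p (B.next p) := by
        by_contra hr
        exact hcon ⟨hn, hr⟩
      have e : p + ir A + (B.next p - 1 - p) + 1 = B.next p + ir A := by omega
      rw [e, hm.rel_block (by omega) hn]
      exact Or.inr hr
    · have e : p + ir A + (B.next p - 1 - p) = ir A + B.n := by omega
      rw [e]
      exact habove

end IPoset

open IPoset

/-- The initial-rise composition is a bijection: every interval-poset `I` of
size `n ≥ 1` is uniquely determined by a triple `(I₁, I₂, r)` with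
`size I₁ + size I₂ + 1 = n` and `0 ≤ r ≤ ir I₂`, via `I = IR(I₁, I₂, r)`. -/
theorem initial_rise_bijection (n : ℕ) (hn : 1 ≤ n) :
    (∀ I1 I2 : IPoset, ∀ r : ℕ, I1.n + I2.n + 1 = n → r ≤ ir I2 →
      ∃! J : IPoset, J.n = n ∧ IsIRComp I1 I2 r J) ∧
    (∀ J : IPoset, J.n = n →
      ∃! t : IPoset × IPoset × ℕ,
        t.1.n + t.2.1.n + 1 = n ∧ t.2.2 ≤ ir t.2.1 ∧
        IsIRComp t.1 t.2.1 t.2.2 J) := by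
  constructor
  · intro A C r hn' hr
    obtain ⟨B, hB⟩ := C.exists_ins_of_le_ir hr
    obtain ⟨J, hJ⟩ := exists_merge A B A.ir_le
    have h1 := hB.card
    have h2 := hJ.1
    refine ⟨J, ⟨by omega, (isIRComp_iff hr).mpr ⟨B, hB, hJ⟩⟩, ?_⟩
    rintro K ⟨-, hK⟩
    obtain ⟨B', hB', hK⟩ := (isIRComp_iff hr).mp hK
    obtain rfl := hB.right_unique hB'
    exact hK.right_unique hJ
  · intro J hJ
    obtain ⟨a, m, hcut, hmax⟩ := J.exists_maximal_cut (by omega)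
    obtain ⟨A, B, rfl, rfl, hm⟩ := hcut.exists_merge
    have hB : 1 ≤ B.n := by
      have := hcut.lt
      have := hcut.ir_le
      omega
    obtain ⟨C, hC⟩ := exists_ins_of_maximal hm hB hmax
    have h1 := hC.card
    have h2 := hm.1
    have h3 := hC.le_ir_add_one
    have h4 := hC.pos
    refine ⟨(A, C, ir C + 1 - ir B), ⟨show A.n + C.n + 1 = n by omega,
      show ir C + 1 - ir B ≤ ir C by omega, ?_⟩, ?_⟩
    · refine (isIRComp_iff (show ir C + 1 - ir B ≤ ir C by omega)).mpr ⟨B, ?_, hm⟩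
      rwa [Nat.sub_sub_self h3]
    · rintro ⟨A', C', r⟩ ⟨hn', hr, hcomp⟩
      simp only at hn' hr hcomp
      obtain ⟨B', hB', hm'⟩ := (isIRComp_iff hr).mp hcomp
      obtain ⟨hcut', -⟩ := hm'.cut (by have := hB'.card; omega)
      have hle := hmax _ _ hcut'
      have hge := Cut.le_of_ins hm' hB' hcut
      have hir : ir A' = ir A := le_antisymm hle hge
      rw [hir] at hm' hcut'
      obtain ⟨rfl, rfl⟩ := hm'.left_unique hm (hcut'.size_unique hcut)
      have hk := hB'.ir_eq
      rw [← hk] at hB'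
      obtain rfl := hB'.left_unique hC
      have : r = ir C' + 1 - ir B' := by omega
      rw [this]
end

section
/- There is a bijection β on interval-posets of size n, defined recursively by β(∅) = ∅ and β(LC(I1,I2,r)) = IR(β(I1), β(I2), r), which exchanges the statistics trees and ir: if trees(I) = a and ir(I) = b then trees(β(I)) = b and ir(β(I)) = a. -/
namespace IPoset

theorem ext_rel_s10 {I J : IPoset} (hn : I.n = J.n) (h : ∀ x y, I.rel x y ↔ J.rel x y) : I = J := by
  obtain ⟨n, rel, _⟩ := I
  obtain ⟨n', rel', _⟩ := J
  obtain rfl : n = n' := hn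
  obtain rfl : rel = rel' := by
    funext x y
    exact propext (h x y)
  rfl

/-- The least element of the interval `{x | x ≺ y}`. -/
noncomputable def lo (I : IPoset) (y : ℕ) : ℕ := sInf {x | I.rel x y}

/-- The greatest element of the interval `{x | x ≺ y}`. -/
noncomputable def hi (I : IPoset) (y : ℕ) : ℕ := sSup {x | I.rel x y}

theorem bddAbove_rel (I : IPoset) (y : ℕ) : BddAbove {x | I.rel x y} :=
  ⟨I.n, fun _ hx => (I.supp hx).2.1⟩

theorem rel_lo (I : IPoset) {y : ℕ} (h1 : 1 ≤ y) (h2 : y ≤ I.n) : I.rel (I.lo y) y :=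
  Nat.sInf_mem (s := {x | I.rel x y}) ⟨y, I.refl y h1 h2⟩

theorem rel_hi (I : IPoset) {y : ℕ} (h1 : 1 ≤ y) (h2 : y ≤ I.n) : I.rel (I.hi y) y :=
  Nat.sSup_mem (s := {x | I.rel x y}) ⟨y, I.refl y h1 h2⟩ (I.bddAbove_rel y)

theorem lo_le_of_rel (I : IPoset) {x y : ℕ} (h : I.rel x y) : I.lo y ≤ x :=
  Nat.sInf_le h

theorem le_hi_of_rel (I : IPoset) {x y : ℕ} (h : I.rel x y) : x ≤ I.hi y :=
  le_csSup (I.bddAbove_rel y) h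

/-- Every principal ideal of an interval-poset is an interval. -/
theorem rel_iff (I : IPoset) (x y : ℕ) :
    I.rel x y ↔ 1 ≤ x ∧ x ≤ I.n ∧ 1 ≤ y ∧ y ≤ I.n ∧ I.lo y ≤ x ∧ x ≤ I.hi y := by
  constructor
  · intro h
    obtain ⟨h1, h2, h3, h4⟩ := I.supp h
    exact ⟨h1, h2, h3, h4, I.lo_le_of_rel h, I.le_hi_of_rel h⟩
  · rintro ⟨h1, h2, h3, h4, h5, h6⟩
    have hl := I.rel_lo h3 h4
    have hh := I.rel_hi h3 h4
    rcases lt_trichotomy x y with h | rfl | h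
    · rcases h5.eq_or_lt with h' | h'
      · rwa [← h']
      · exact I.inc h' h hl
    · exact I.refl x h1 h2
    · rcases h6.eq_or_lt with h' | h'
      · rwa [h']
      · exact I.dec h h' hh

end IPoset

/-- The intervals `[l v, d v]`, for `v` in `{1,…,n}`, are the principal ideals of an
interval-poset. -/
structure Spans (n : ℕ) (l d : ℕ → ℕ) : Prop where
  l_pos : ∀ v, 1 ≤ v → v ≤ n → 1 ≤ l v
  l_le : ∀ v, 1 ≤ v → v ≤ n → l v ≤ v
  le_d : ∀ v, 1 ≤ v → v ≤ n → v ≤ d v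
  d_le : ∀ v, 1 ≤ v → v ≤ n → d v ≤ n
  l_mono : ∀ v w, 1 ≤ w → w ≤ v → v ≤ n → l v ≤ w → l v ≤ l w
  d_mono : ∀ v w, 1 ≤ v → v ≤ w → w ≤ n → w ≤ d v → d w ≤ d v
  anti : ∀ a b, 1 ≤ a → a < b → b ≤ n → l b ≤ a → d a < b

namespace IPoset

theorem spans (I : IPoset) : Spans I.n I.lo I.hi where
  l_pos v h1 h2 := (I.supp (I.rel_lo h1 h2)).1
  l_le v h1 h2 := I.lo_le_of_rel (I.refl v h1 h2)
  le_d v h1 h2 := I.le_hi_of_rel (I.refl v h1 h2)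
  d_le v h1 h2 := (I.supp (I.rel_hi h1 h2)).2.1
  l_mono v w h1 h2 h3 h4 := by
    have h : I.rel w v := (I.rel_iff w v).2
      ⟨h1, by omega, by omega, h3, h4, h2.trans (I.le_hi_of_rel (I.refl v (by omega) h3))⟩
    exact I.lo_le_of_rel (I.trans (I.rel_lo h1 (by omega)) h)
  d_mono v w h1 h2 h3 h4 := by
    have h : I.rel w v := (I.rel_iff w v).2
      ⟨by omega, h3, h1, by omega, (I.lo_le_of_rel (I.refl v h1 (by omega))).trans h2, h4⟩
    exact I.le_hi_of_rel (I.trans (I.rel_hi (by omega) h3) h)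
  anti a b h1 h2 h3 h4 := by
    by_contra! h5
    have h : I.rel a b := (I.rel_iff a b).2
      ⟨h1, by omega, by omega, h3, h4, h2.le.trans (I.le_hi_of_rel (I.refl b (by omega) h3))⟩
    have h' : I.rel b a := (I.rel_iff b a).2
      ⟨by omega, h3, h1, by omega, (I.lo_le_of_rel (I.refl a h1 (by omega))).trans h2.le, h5⟩
    exact h2.ne (I.antisymm h h')

end IPoset

/-- The interval-poset with given principal ideals. -/
def Spans.toIPoset {n : ℕ} {l d : ℕ → ℕ} (h : Spans n l d) : IPoset where
  n := n
  rel x y := 1 ≤ x ∧ x ≤ n ∧ 1 ≤ y ∧ y ≤ n ∧ l y ≤ x ∧ x ≤ d y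
  supp a b hab := by omega
  refl a h1 h2 := ⟨h1, h2, h1, h2, h.l_le a h1 h2, h.le_d a h1 h2⟩
  antisymm a b hab hba := by
    rcases lt_trichotomy a b with h' | h' | h'
    · have := h.anti a b (by omega) h' (by omega) (by omega)
      omega
    · exact h'
    · have := h.anti b a (by omega) h' (by omega) (by omega)
      omega
  trans a b c hab hbc := by
    refine ⟨hab.1, hab.2.1, hbc.2.2.1, hbc.2.2.2.1, ?_⟩
    have hb1 := h.l_le b (by omega) (by omega)
    have hb2 := h.le_d b (by omega) (by omega)
    have hc1 := h.l_le c (by omega) (by omega)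
    have hc2 := h.le_d c (by omega) (by omega)
    rcases lt_trichotomy b c with h' | rfl | h'
    · have := h.l_mono c b (by omega) h'.le (by omega) (by omega)
      have := h.anti b c (by omega) h' (by omega) (by omega)
      omega
    · omega
    · have := h.d_mono c b (by omega) h'.le (by omega) (by omega)
      have : c < l b := by
        by_contra! h''
        have := h.anti c b (by omega) h' (by omega) h''
        omega
      omega
  inc a b c h1 h2 h3 := by
    have := h.le_d c (by omega) (by omega)
    omega
  dec a b c h1 h2 h3 := by
    have := h.l_le a (by omega) (by omega)
    omega

theorem IPoset.lo_eq {I : IPoset} {l d : ℕ → ℕ} (h : Spans I.n l d)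
    (hr : ∀ x y, I.rel x y ↔ 1 ≤ x ∧ x ≤ I.n ∧ 1 ≤ y ∧ y ≤ I.n ∧ l y ≤ x ∧ x ≤ d y)
    {v : ℕ} (h1 : 1 ≤ v) (h2 : v ≤ I.n) : I.lo v = l v := by
  have a1 := h.l_pos v h1 h2
  have a2 := h.l_le v h1 h2
  have a3 := h.le_d v h1 h2
  have a4 := (hr _ _).1 (I.rel_lo h1 h2)
  have a5 := I.lo_le_of_rel ((hr (l v) v).2 (by omega))
  omega

theorem IPoset.hi_eq {I : IPoset} {l d : ℕ → ℕ} (h : Spans I.n l d)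
    (hr : ∀ x y, I.rel x y ↔ 1 ≤ x ∧ x ≤ I.n ∧ 1 ≤ y ∧ y ≤ I.n ∧ l y ≤ x ∧ x ≤ d y)
    {v : ℕ} (h1 : 1 ≤ v) (h2 : v ≤ I.n) : I.hi v = d v := by
  have a1 := h.d_le v h1 h2
  have a2 := h.l_le v h1 h2
  have a3 := h.le_d v h1 h2
  have a4 := (hr _ _).1 (I.rel_hi h1 h2)
  have a5 := I.le_hi_of_rel ((hr (d v) v).2 (by omega))
  omega

theorem Spans.lo_toIPoset {n : ℕ} {l d : ℕ → ℕ} (h : Spans n l d) {v : ℕ}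
    (h1 : 1 ≤ v) (h2 : v ≤ n) : h.toIPoset.lo v = l v :=
  IPoset.lo_eq (I := h.toIPoset) h (fun _ _ => Iff.rfl) h1 h2

theorem Spans.hi_toIPoset {n : ℕ} {l d : ℕ → ℕ} (h : Spans n l d) {v : ℕ}
    (h1 : 1 ≤ v) (h2 : v ≤ n) : h.toIPoset.hi v = d v :=
  IPoset.hi_eq (I := h.toIPoset) h (fun _ _ => Iff.rfl) h1 h2

theorem IPoset.ext_spans {I J : IPoset} (hn : I.n = J.n)
    (hl : ∀ v, 1 ≤ v → v ≤ I.n → I.lo v = J.lo v)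
    (hh : ∀ v, 1 ≤ v → v ≤ I.n → I.hi v = J.hi v) : I = J := by
  refine IPoset.ext_rel_s10 hn fun x y => ?_
  rw [I.rel_iff, J.rel_iff, ← hn]
  constructor
  · rintro ⟨a, b, c, e, f⟩
    rw [hl y c e, hh y c e] at f
    exact ⟨a, b, c, e, f⟩
  · rintro ⟨a, b, c, e, f⟩
    rw [← hl y c e, ← hh y c e] at f
    exact ⟨a, b, c, e, f⟩

theorem IPoset.finite_size (n : ℕ) : Finite {I : IPoset // I.n = n} := by
  refine Finite.of_injective
    (fun I (p : Fin (n + 1) × Fin (n + 1)) => I.1.rel p.1 p.2) ?_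
  rintro ⟨I, hI⟩ ⟨J, hJ⟩ h
  refine Subtype.ext (IPoset.ext_rel_s10 (hI.trans hJ.symm) fun x y => ?_)
  have key : ∀ a b : ℕ, a ≤ n → b ≤ n → (I.rel a b ↔ J.rel a b) := fun a b ha hb =>
    iff_of_eq (congrFun h (⟨a, by omega⟩, ⟨b, by omega⟩))
  constructor
  · intro hr
    have := I.supp hr
    exact (key x y (by omega) (by omega)).1 hr
  · intro hr
    have := J.supp hr
    exact (key x y (by omega) (by omega)).2 hr

/-! ### The initial rise and the roots in terms of principal ideals -/

open scoped Classical in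
theorem ir_eq_iff (I : IPoset) (k : ℕ) :
    ir I = k ↔ k ≤ I.n ∧ (k ≠ 0 → ∀ i, 2 ≤ i → i ≤ k → ¬ I.rel (i - 1) i) ∧
      ∀ ⦃m⦄, k < m → m ≤ I.n → ¬ ∀ i, 2 ≤ i → i ≤ m → ¬ I.rel (i - 1) i := by
  unfold ir
  exact Nat.findGreatest_eq_iff

theorem ir_le (I : IPoset) : ir I ≤ I.n := ((ir_eq_iff I _).1 rfl).1

theorem lo_of_le_ir (I : IPoset) {i : ℕ} (h1 : 1 ≤ i) (h2 : i ≤ ir I) : I.lo i = i := by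
  obtain ⟨hn, hs, -⟩ := (ir_eq_iff I _).1 rfl
  have a1 := I.spans.l_le i h1 (by omega)
  have a2 := I.spans.l_pos i h1 (by omega)
  have a3 := I.spans.le_d i h1 (by omega)
  by_contra hne
  exact hs (by omega) i (by omega) h2 ((I.rel_iff _ _).2 (by omega))

theorem lo_ir_succ (I : IPoset) (h : ir I < I.n) : I.lo (ir I + 1) ≤ ir I := by
  by_contra! hlt
  refine ((ir_eq_iff I _).1 rfl).2.2 (Nat.lt_succ_self _) h fun i h1 h2 hr => ?_
  have := I.lo_le_of_rel hr
  rcases h2.eq_or_lt with rfl | h2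
  · simp only [Nat.succ_eq_add_one] at this
    omega
  · have := lo_of_le_ir I (i := i) (by omega) (by omega)
    omega

theorem ir_pos (I : IPoset) (h : 1 ≤ I.n) : 1 ≤ ir I := by
  by_contra! h0
  exact ((ir_eq_iff I _).1 rfl).2.2 h0 h fun i h1 h2 => by omega

theorem ir_eq {I : IPoset} {k : ℕ} (hk : k ≤ I.n)
    (hlo : ∀ i, 1 ≤ i → i ≤ k → I.lo i = i) (hlt : k < I.n → I.lo (k + 1) ≤ k) : ir I = k := by
  rcases lt_trichotomy (ir I) k with h | h | h
  · have := lo_ir_succ I (by omega)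
    have := hlo (ir I + 1) (by omega) (by omega)
    omega
  · exact h
  · have := ir_le I
    have := hlt (by omega)
    have := lo_of_le_ir I (i := k + 1) (by omega) (by omega)
    omega

theorem isDecRoot_iff (I : IPoset) (x : ℕ) :
    IsDecRoot I x ↔ 1 ≤ x ∧ x ≤ I.n ∧ ∀ y, 1 ≤ y → y < x → I.hi y < x := by
  unfold IsDecRoot
  refine and_congr_right fun h1 => and_congr_right fun h2 => ?_
  refine forall_congr' fun y => ?_
  constructor
  · intro h h3 h4
    by_contra! h5
    have := I.spans.l_le y h3 (by omega)
    exact h h4 ((I.rel_iff _ _).2 (by omega))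
  · intro h h3 hr
    have := h (I.supp hr).2.2.1 h3
    have := I.le_hi_of_rel hr
    omega

/-! ### Insertion of a vertex -/

/-- Lower ends of the principal ideals after insertion of the vertex `k`. -/
def insLo (l : ℕ → ℕ) (k v : ℕ) : ℕ :=
  if v ≤ k then v else if l (v - 1) ≤ k then l (v - 1) else l (v - 1) + 1

/-- Upper ends of the principal ideals after insertion of the vertex `k`. -/
noncomputable def insHi (d : ℕ → ℕ) (k v : ℕ) : ℕ :=
  if k < v then d (v - 1) + 1 else if v = k then k else if d v < k then d v
  else sInf {w | k ≤ w ∧ d w = d v}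

theorem insLo_of_le {l : ℕ → ℕ} {k v : ℕ} (h : v ≤ k) : insLo l k v = v := if_pos h

theorem insLo_succ {l : ℕ → ℕ} {k u : ℕ} (h : k ≤ u) :
    insLo l k (u + 1) = if l u ≤ k then l u else l u + 1 := by
  unfold insLo
  rw [if_neg (by omega), Nat.add_sub_cancel]

theorem insHi_succ {d : ℕ → ℕ} {k u : ℕ} (h : k ≤ u) : insHi d k (u + 1) = d u + 1 := by
  unfold insHi
  rw [if_pos (by omega), Nat.add_sub_cancel]

theorem insHi_self {d : ℕ → ℕ} {k : ℕ} : insHi d k k = k := by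
  unfold insHi
  rw [if_neg (by omega), if_pos rfl]

theorem insHi_of_lt {d : ℕ → ℕ} {k v : ℕ} (h1 : v < k) (h2 : d v < k) : insHi d k v = d v := by
  unfold insHi
  rw [if_neg (by omega), if_neg (by omega), if_pos h2]

namespace Spans

theorem insHi_spec {n : ℕ} {l d : ℕ → ℕ} (h : Spans n l d) {k v : ℕ}
    (h1 : 1 ≤ v) (h2 : v < k) (h3 : k ≤ d v) (hv : v ≤ n) :
    k ≤ insHi d k v ∧ insHi d k v ≤ d v ∧ d (insHi d k v) = d v ∧
      ∀ u, k ≤ u → u < insHi d k v → d u < insHi d k v := by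
  have e : insHi d k v = sInf {w | k ≤ w ∧ d w = d v} := by
    unfold insHi
    rw [if_neg (by omega), if_neg (by omega), if_neg (by omega)]
  have hd := h.d_le v h1 hv
  have hdd : d (d v) = d v := by
    have := h.d_mono v (d v) h1 (by omega) hd le_rfl
    have := h.le_d (d v) (by omega) hd
    omega
  have hmem : d v ∈ {w | k ≤ w ∧ d w = d v} := ⟨h3, hdd⟩
  have hs := Nat.sInf_mem ⟨_, hmem⟩
  have hle := Nat.sInf_le hmem
  rw [← e] at hs hle
  refine ⟨hs.1, hle, hs.2, fun u hu1 hu2 => ?_⟩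
  have hne : d u ≠ d v := fun hne => by
    have := Nat.sInf_le (show u ∈ {w | k ≤ w ∧ d w = d v} from ⟨hu1, hne⟩)
    omega
  have := h.d_mono v u h1 (by omega) (by omega) (by omega)
  by_contra! h5
  have := h.d_mono u (insHi d k v) (by omega) (by omega) (by omega) h5
  have := hs.2
  omega

theorem insert {n : ℕ} {l d : ℕ → ℕ} (h : Spans n l d) {k : ℕ}
    (hk1 : 1 ≤ k) (hk2 : k ≤ n + 1) (hl : ∀ i, 1 ≤ i → i < k → l i = i) :
    Spans (n + 1) (insLo l k) (insHi d k) where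
  l_pos v h1 h2 := by
    rcases le_or_gt v k with h3 | h3
    · rwa [insLo_of_le h3]
    · obtain ⟨u, rfl⟩ : ∃ u, v = u + 1 := ⟨v - 1, by omega⟩
      rw [insLo_succ (by omega)]
      have := h.l_pos u (by omega) (by omega)
      split_ifs <;> omega
  l_le v h1 h2 := by
    rcases le_or_gt v k with h3 | h3
    · rw [insLo_of_le h3]
    · obtain ⟨u, rfl⟩ : ∃ u, v = u + 1 := ⟨v - 1, by omega⟩
      rw [insLo_succ (by omega)]
      have := h.l_le u (by omega) (by omega)
      split_ifs <;> omega
  le_d v h1 h2 := by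
    rcases lt_trichotomy v k with h3 | rfl | h3
    · have := h.le_d v h1 (by omega)
      rcases lt_or_ge (d v) k with h4 | h4
      · rwa [insHi_of_lt h3 h4]
      · have := h.insHi_spec h1 h3 h4 (by omega)
        omega
    · rw [insHi_self]
    · obtain ⟨u, rfl⟩ : ∃ u, v = u + 1 := ⟨v - 1, by omega⟩
      rw [insHi_succ (by omega)]
      have := h.le_d u (by omega) (by omega)
      omega
  d_le v h1 h2 := by
    rcases lt_trichotomy v k with h3 | rfl | h3
    · have := h.d_le v h1 (by omega)
      rcases lt_or_ge (d v) k with h4 | h4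
      · rw [insHi_of_lt h3 h4]
        omega
      · have := h.insHi_spec h1 h3 h4 (by omega)
        omega
    · rwa [insHi_self]
    · obtain ⟨u, rfl⟩ : ∃ u, v = u + 1 := ⟨v - 1, by omega⟩
      rw [insHi_succ (by omega)]
      have := h.d_le u (by omega) (by omega)
      omega
  l_mono v w h1 h2 h3 h4 := by
    rcases le_or_gt w k with h5 | h5
    · rwa [insLo_of_le h5]
    · obtain ⟨u, rfl⟩ : ∃ u, v = u + 1 := ⟨v - 1, by omega⟩
      obtain ⟨x, rfl⟩ : ∃ x, w = x + 1 := ⟨w - 1, by omega⟩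
      rw [insLo_succ (by omega)] at h4
      rw [insLo_succ (by omega), insLo_succ (by omega)]
      have := h.l_le u (by omega) (by omega)
      have := h.l_mono u x (by omega) (by omega) (by omega) (by split_ifs at h4 <;> omega)
      split_ifs <;> omega
  d_mono v w h1 h2 h3 h4 := by
    rcases lt_trichotomy v k with h5 | rfl | h5
    · rcases lt_or_ge (d v) k with h6 | h6
      · rw [insHi_of_lt h5 h6] at h4 ⊢
        have := h.d_mono v w h1 h2 (by omega) h4
        rw [insHi_of_lt (by omega) (by omega)]
        exact this
      · obtain ⟨a1, a2, a3, a4⟩ := h.insHi_spec h1 h5 h6 (by omega)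
        have hdv := h.d_le v h1 (by omega)
        rcases lt_trichotomy w k with h7 | rfl | h7
        · have hm := h.d_mono v w h1 h2 (by omega) (by omega)
          rcases lt_or_ge (d w) k with h8 | h8
          · rw [insHi_of_lt h7 h8]
            omega
          · obtain ⟨b1, b2, b3, b4⟩ := h.insHi_spec (by omega) h7 h8 (by omega)
            by_contra! h9
            have := b4 _ a1 h9
            omega
        · rwa [insHi_self]
        · obtain ⟨x, rfl⟩ : ∃ x, w = x + 1 := ⟨w - 1, by omega⟩
          rw [insHi_succ (by omega)]
          have := a4 x (by omega) (by omega)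
          omega
    · rw [insHi_self] at h4 ⊢
      obtain rfl : w = v := by omega
      rw [insHi_self]
    · obtain ⟨u, rfl⟩ : ∃ u, v = u + 1 := ⟨v - 1, by omega⟩
      obtain ⟨x, rfl⟩ : ∃ x, w = x + 1 := ⟨w - 1, by omega⟩
      rw [insHi_succ (by omega)] at h4
      rw [insHi_succ (by omega), insHi_succ (by omega)]
      have := h.d_mono u x (by omega) (by omega) (by omega) (by omega)
      omega
  anti a b h1 h2 h3 h4 := by
    rcases le_or_gt b k with h5 | h5
    · rw [insLo_of_le h5] at h4
      omega
    · obtain ⟨u, rfl⟩ : ∃ u, b = u + 1 := ⟨b - 1, by omega⟩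
      rw [insLo_succ (by omega)] at h4
      rcases lt_trichotomy a k with h6 | rfl | h6
      · have hlu : l u ≤ a := by split_ifs at h4 <;> omega
        have := h.anti a u h1 (by omega) (by omega) hlu
        rcases lt_or_ge (d a) k with h7 | h7
        · rw [insHi_of_lt h6 h7]
          omega
        · have := h.insHi_spec h1 h6 h7 (by omega)
          omega
      · rwa [insHi_self]
      · obtain ⟨x, rfl⟩ : ∃ x, a = x + 1 := ⟨a - 1, by omega⟩
        rw [insHi_succ (by omega)]
        have := h.anti x u (by omega) (by omega) (by omega) (by split_ifs at h4 <;> omega)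
        omega

end Spans

/-- Roots of the final forest with upper ends `d` restricted to the window `(v, D]`. -/
def windowRoots (d : ℕ → ℕ) (v D : ℕ) : Set ℕ :=
  {w | v < w ∧ w ≤ D ∧ ∀ u, v < u → u < w → d u < w}

theorem windowRoots_finite (d : ℕ → ℕ) (v D : ℕ) : (windowRoots d v D).Finite :=
  (Set.finite_Iic D).subset fun _ hw => hw.2.1

theorem windowRoots_mono {d : ℕ → ℕ} {v D D' : ℕ} (h : D ≤ D') :
    windowRoots d v D ⊆ windowRoots d v D' :=
  fun _ hw => ⟨hw.1, hw.2.1.trans h, hw.2.2⟩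

theorem trees_eq (I : IPoset) : trees I = (windowRoots I.hi 0 I.n).ncard := by
  unfold trees
  congr 1
  ext x
  rw [Set.mem_ofPred_eq, isDecRoot_iff]
  exact Iff.rfl

theorem decChildCount_eq (I : IPoset) {v : ℕ} (h1 : 1 ≤ v) (h2 : v ≤ I.n) :
    decChildCount I v = (windowRoots I.hi v (I.hi v)).ncard := by
  unfold decChildCount
  congr 1
  ext w
  have hv := I.spans.d_le v h1 h2
  have hl := I.spans.l_le v h1 h2
  constructor
  · rintro ⟨a1, a2, a3⟩
    have := I.le_hi_of_rel a2
    refine ⟨a1, this, fun u hu1 hu2 => ?_⟩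
    by_contra! hlt
    have := I.spans.l_le u (by omega) (by omega)
    exact a3 u hu1 hu2 ⟨(I.rel_iff _ _).2 (by omega), (I.rel_iff _ _).2 (by omega)⟩
  · rintro ⟨a1, a2, a3⟩
    refine ⟨a1, (I.rel_iff _ _).2 (by omega), fun u hu1 hu2 hr => ?_⟩
    have := a3 u hu1 hu2
    have := I.le_hi_of_rel hr.1
    omega

theorem shiftIns_injective (k : ℕ) : Function.Injective (shiftIns k) := by
  intro a b hab
  unfold shiftIns at hab
  split_ifs at hab <;> omega

theorem windowRoots_congr {d d' : ℕ → ℕ} {v D : ℕ} (h : ∀ u, v < u → u < D → d u = d' u) :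
    windowRoots d v D = windowRoots d' v D := by
  ext w
  refine and_congr_right fun _ => and_congr_right fun h2 => ?_
  refine forall_congr' fun u => forall_congr' fun h3 => forall_congr' fun h4 => ?_
  rw [h u h3 (by omega)]

theorem windowRoots_shift {d d' : ℕ → ℕ} {v D k : ℕ}
    (h : ∀ u, v < u → u < D → d' (u + k) = d u + k) :
    windowRoots d' (v + k) (D + k) = (fun x => x + k) '' windowRoots d v D := by
  ext w
  constructor
  · rintro ⟨a1, a2, a3⟩
    refine ⟨w - k, ⟨by omega, by omega, fun u hu1 hu2 => ?_⟩, by dsimp only; omega⟩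
    have := a3 (u + k) (by omega) (by omega)
    rw [h u hu1 (by omega)] at this
    omega
  · rintro ⟨x, ⟨a1, a2, a3⟩, rfl⟩
    refine ⟨by dsimp only; omega, by dsimp only; omega, fun u hu1 hu2 => ?_⟩
    dsimp only at hu2 ⊢
    obtain ⟨y, rfl⟩ : ∃ y, u = y + k := ⟨u - k, by omega⟩
    rw [h y (by omega) (by omega)]
    have := a3 y (by omega) (by omega)
    omega

namespace Spans

theorem ncard_windowRoots_insHi {n : ℕ} {l d : ℕ → ℕ} (h : Spans n l d) {k v D : ℕ}
    (hv : v < k) (hk : k ≤ D + 1) (hD : D ≤ n)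
    (hcl : ∀ u, v < u → u ≤ D → d u ≤ D) :
    (windowRoots (insHi d k) v (D + 1)).ncard = (windowRoots d v D).ncard + 1 := by
  suffices hs : ∃ e, e ∉ shiftIns k '' windowRoots d v D ∧
      windowRoots (insHi d k) v (D + 1) = Insert.insert e (shiftIns k '' windowRoots d v D) by
    obtain ⟨e, he1, he2⟩ := hs
    rw [he2, Set.ncard_insert_of_notMem he1 ((windowRoots_finite _ _ _).image _),
      Set.ncard_image_of_injective _ (shiftIns_injective k)]
  have hlow : ∀ w, v < w → w ≤ k → (∀ u, v < u → u < w → d u < w) →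
      ∀ u, v < u → u < w → insHi d k u < w := by
    intro w h1 h2 h3 u h4 h5
    have := h3 u h4 h5
    rwa [insHi_of_lt (by omega) (by omega)]
  have hlow' : ∀ w, w ≤ k → w ≤ D + 1 → (∀ u, v < u → u < w → insHi d k u < w) →
      ∀ u, v < u → u < w → d u < w := by
    intro w h2 h1 h3 u h4 h5
    have := h3 u h4 h5
    by_contra! h6
    rcases lt_or_ge (d u) k with h7 | h7
    · rw [insHi_of_lt (by omega) h7] at this
      omega
    · have := h.insHi_spec (k := k) (v := u) (by omega) (by omega) (by omega) (by omega)
      omega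
  by_cases hy : ∃ y, v < y ∧ y < k ∧ k ≤ d y
  · obtain ⟨⟨y1, y2, y3⟩, ymin⟩ := Nat.find_spec hy, fun m => Nat.find_min (m := m) hy
    set y := Nat.find hy
    clear_value y
    have yroot : ∀ u, v < u → u < y → d u < y := by
      intro u hu1 hu2
      by_contra! h5
      have := h.d_mono u y (by omega) (by omega) (by omega) h5
      exact ymin u hu2 ⟨hu1, by omega, by omega⟩
    have yD := hcl y y1 (by omega)
    obtain ⟨w1, w2, w3, w4⟩ := h.insHi_spec (k := k) (v := y) (by omega) y2 y3 (by omega)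
    set w := insHi d k y
    have hdbd : ∀ u, v < u → u < k → insHi d k u ≤ w := by
      intro u hu1 hu2
      rcases lt_or_ge (d u) k with h7 | h7
      · rw [insHi_of_lt hu2 h7]
        omega
      · have hyu : y ≤ u := by
          by_contra! h8
          exact ymin u h8 ⟨hu1, hu2, h7⟩
        obtain ⟨b1, b2, b3, b4⟩ := h.insHi_spec (by omega) hu2 h7 (by omega)
        have := h.d_mono y u (by omega) hyu (by omega) (by omega)
        by_contra! h9
        have := b4 _ w1 h9
        omega
    refine ⟨w + 1, ?_, ?_⟩
    · rintro ⟨x, ⟨x1, x2, x3⟩, hx⟩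
      unfold shiftIns at hx
      split_ifs at hx
      · omega
      · obtain rfl : x = w := by omega
        have := x3 y y1 (by omega)
        omega
    · ext x
      constructor
      · rintro ⟨x1, x2, x3⟩
        rcases lt_or_ge x k with h4 | h4
        · exact Or.inr ⟨x, ⟨x1, by omega, hlow' x h4.le (by omega) x3⟩, if_pos h4⟩
        · have hx := x3 y y1 (by omega)
          rcases eq_or_lt_of_le (show w + 1 ≤ x from hx) with h5 | h5
          · exact Or.inl h5.symm
          · refine Or.inr ⟨x - 1, ⟨by omega, by omega, fun u hu1 hu2 => ?_⟩, ?_⟩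
            · rcases lt_or_ge u k with h6 | h6
              · have hw := x3 (w + 1) (by omega) h5
                rw [insHi_succ w1, w3] at hw
                rcases lt_or_ge u y with h7 | h7
                · have := yroot u hu1 h7
                  omega
                · have := h.d_mono y u (by omega) h7 (by omega) (by omega)
                  omega
              · have := x3 (u + 1) (by omega) (by omega)
                rw [insHi_succ h6] at this
                omega
            · unfold shiftIns
              rw [if_neg (by omega)]
              omega
      · rintro (rfl | ⟨x, ⟨x1, x2, x3⟩, rfl⟩)
        · refine ⟨by omega, by omega, fun u hu1 hu2 => ?_⟩
          rcases lt_trichotomy u k with h5 | rfl | h5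
          · have := hdbd u hu1 h5
            omega
          · rw [insHi_self]
            omega
          · obtain ⟨z, rfl⟩ : ∃ z, u = z + 1 := ⟨u - 1, by omega⟩
            rw [insHi_succ (by omega)]
            have := w4 z (by omega) (by omega)
            omega
        · unfold shiftIns
          split_ifs with h4
          · exact ⟨x1, by omega, hlow x x1 h4.le x3⟩
          · refine ⟨by omega, by omega, fun u hu1 hu2 => ?_⟩
            have := x3 y y1 (by omega)
            rcases lt_trichotomy u k with h5 | rfl | h5
            · have := hdbd u hu1 h5
              omega
            · rw [insHi_self]
              omega
            · obtain ⟨z, rfl⟩ : ∃ z, u = z + 1 := ⟨u - 1, by omega⟩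
              rw [insHi_succ (by omega)]
              have := x3 z (by omega) (by omega)
              omega
  · push Not at hy
    refine ⟨k, ?_, ?_⟩
    · rintro ⟨x, -, hx⟩
      unfold shiftIns at hx
      split_ifs at hx <;> omega
    · ext x
      constructor
      · rintro ⟨x1, x2, x3⟩
        rcases lt_trichotomy x k with h4 | h4 | h4
        · exact Or.inr ⟨x, ⟨x1, by omega, hlow' x h4.le (by omega) x3⟩, if_pos h4⟩
        · exact Or.inl h4
        · refine Or.inr ⟨x - 1, ⟨by omega, by omega, fun u hu1 hu2 => ?_⟩, ?_⟩
          · rcases lt_or_ge u k with h6 | h6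
            · have := hy u hu1 h6
              omega
            · have := x3 (u + 1) (by omega) (by omega)
              rw [insHi_succ h6] at this
              omega
          · unfold shiftIns
            rw [if_neg (by omega)]
            omega
      · rintro (rfl | ⟨x, ⟨x1, x2, x3⟩, rfl⟩)
        · exact ⟨hv, hk, hlow _ hv le_rfl fun u hu1 hu2 => hy u hu1 hu2⟩
        · unfold shiftIns
          split_ifs with h4
          · exact ⟨x1, by omega, hlow x x1 h4.le x3⟩
          · refine ⟨by omega, by omega, fun u hu1 hu2 => ?_⟩
            rcases lt_trichotomy u k with h5 | rfl | h5
            · have := hy u hu1 h5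
              rw [insHi_of_lt h5 this]
              omega
            · rw [insHi_self]
              omega
            · obtain ⟨z, rfl⟩ : ∃ z, u = z + 1 := ⟨u - 1, by omega⟩
              rw [insHi_succ (by omega)]
              have := x3 z (by omega) (by omega)
              omega

/-- Insertion keeps the number of children of every former vertex. -/
theorem ncard_children_insHi {n : ℕ} {l d : ℕ → ℕ} (h : Spans n l d) {k v : ℕ}
    (hv1 : 1 ≤ v) (hv2 : v ≤ n) :
    (windowRoots (insHi d k) (shiftIns k v) (insHi d k (shiftIns k v))).ncard =
      (windowRoots d v (d v)).ncard := by
  have hdv := h.d_le v hv1 hv2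
  have hvd := h.le_d v hv1 hv2
  unfold shiftIns
  split_ifs with h1
  · rcases lt_or_ge (d v) k with h2 | h2
    · rw [insHi_of_lt h1 h2]
      congr 1
      refine windowRoots_congr fun u hu1 hu2 => ?_
      have := h.d_mono v u hv1 hu1.le (by omega) hu2.le
      exact insHi_of_lt (by omega) (by omega)
    · obtain ⟨w1, w2, w3, w4⟩ := h.insHi_spec hv1 h1 h2 hv2
      have key := h.ncard_windowRoots_insHi (k := k) (v := v) (D := d v) h1 (by omega) hdv
        fun u hu1 hu2 => h.d_mono v u hv1 hu1.le (by omega) hu2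
      have e : windowRoots (insHi d k) v (d v + 1) =
          Insert.insert (insHi d k v + 1) (windowRoots (insHi d k) v (insHi d k v)) := by
        ext x
        constructor
        · rintro ⟨x1, x2, x3⟩
          rcases lt_trichotomy x (insHi d k v + 1) with h4 | h4 | h4
          · exact Or.inr ⟨x1, by omega, x3⟩
          · exact Or.inl h4
          · have := x3 _ (by omega) h4
            rw [insHi_succ w1] at this
            omega
        · rintro (rfl | ⟨x1, x2, x3⟩)
          · refine ⟨by omega, by omega, fun u hu1 hu2 => ?_⟩
            rcases lt_trichotomy u k with h5 | rfl | h5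
            · have hm := h.d_mono v u (by omega) (by omega) (by omega) (by omega)
              rcases lt_or_ge (d u) k with h8 | h8
              · rw [insHi_of_lt h5 h8]
                omega
              · obtain ⟨b1, b2, b3, b4⟩ := h.insHi_spec (by omega) h5 h8 (by omega)
                by_contra! h9
                have := b4 _ w1 (by omega)
                omega
            · rw [insHi_self]
              omega
            · obtain ⟨z, rfl⟩ : ∃ z, u = z + 1 := ⟨u - 1, by omega⟩
              rw [insHi_succ (by omega)]
              have := w4 z (by omega) (by omega)
              omega
          · exact ⟨x1, by omega, x3⟩
      rw [e, Set.ncard_insert_of_notMem _ (windowRoots_finite _ _ _)] at key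
      · omega
      · intro hmem
        have := hmem.2.1
        omega
  · rw [insHi_succ (by omega), windowRoots_shift (d := d) (k := 1),
      Set.ncard_image_of_injective _ (add_left_injective 1)]
    exact fun u hu1 _ => insHi_succ (by omega)

end Spans

/-- The position at which the initial-rise composition inserts a new vertex. -/
noncomputable def insertPos (I : IPoset) (r : ℕ) : ℕ := ir I + 1 - min r (ir I)

theorem insertPos_pos (I : IPoset) (r : ℕ) : 1 ≤ insertPos I r := by
  unfold insertPos
  omega

theorem insertPos_le (I : IPoset) (r : ℕ) : insertPos I r ≤ ir I + 1 := by
  unfold insertPos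
  omega

theorem insertVertex_spans (I : IPoset) (r : ℕ) :
    Spans (I.n + 1) (insLo I.lo (insertPos I r)) (insHi I.hi (insertPos I r)) := by
  have := insertPos_le I r
  have := ir_le I
  exact I.spans.insert (insertPos_pos I r) (by omega) fun i h1 h2 => lo_of_le_ir I h1 (by omega)

/-- The insertion step of the initial-rise composition. -/
noncomputable def insertVertex (I : IPoset) (r : ℕ) : IPoset := (insertVertex_spans I r).toIPoset

theorem insertVertex_n (I : IPoset) (r : ℕ) : (insertVertex I r).n = I.n + 1 := rfl

theorem insertVertex_lo (I : IPoset) (r : ℕ) {v : ℕ} (h1 : 1 ≤ v) (h2 : v ≤ I.n + 1) :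
    (insertVertex I r).lo v = insLo I.lo (insertPos I r) v :=
  Spans.lo_toIPoset _ h1 h2

theorem insertVertex_hi (I : IPoset) (r : ℕ) {v : ℕ} (h1 : 1 ≤ v) (h2 : v ≤ I.n + 1) :
    (insertVertex I r).hi v = insHi I.hi (insertPos I r) v :=
  Spans.hi_toIPoset _ h1 h2

theorem ir_insertVertex (I : IPoset) (r : ℕ) : ir (insertVertex I r) = insertPos I r := by
  have h1 := insertPos_pos I r
  have h2 := insertPos_le I r
  have h3 := ir_le I
  refine ir_eq (by rw [insertVertex_n]; omega) (fun i hi1 hi2 => ?_) (fun hlt => ?_)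
  · rw [insertVertex_lo I r hi1 (by omega), insLo_of_le hi2]
  · rw [insertVertex_n] at hlt
    rw [insertVertex_lo I r (by omega) (by omega), insLo_succ le_rfl]
    have := I.spans.l_le (insertPos I r) h1 (by omega)
    split_ifs
    omega

theorem trees_insertVertex (I : IPoset) (r : ℕ) : trees (insertVertex I r) = trees I + 1 := by
  have h1 := insertPos_pos I r
  have h2 := insertPos_le I r
  have h3 := ir_le I
  rw [trees_eq, trees_eq, insertVertex_n,
    windowRoots_congr fun u hu1 hu2 => insertVertex_hi I r hu1 (by omega)]
  exact I.spans.ncard_windowRoots_insHi (by omega) (by omega) le_rfl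
    fun u hu1 hu2 => I.spans.d_le u hu1 hu2

theorem isInsert_insertVertex {I : IPoset} {r : ℕ} (hr : r ≤ ir I) :
    IsInsert I r (insertVertex I r) := by
  have h1 := insertPos_pos I r
  have h2 := insertPos_le I r
  have h3 := ir_le I
  have hk : ir I + 1 - r = insertPos I r := by
    unfold insertPos
    omega
  refine ⟨rfl, ?_⟩
  dsimp only
  rw [hk]
  refine ⟨fun a b hab => ⟨fun hrel => ?_, fun htr => ?_⟩, fun v hv1 hv2 => ?_⟩
  · obtain ⟨a1, a2, a3, a4, a5, -⟩ := ((insertVertex I r).rel_iff a b).1 hrel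
    rw [insertVertex_n] at a2 a4
    rw [insertVertex_lo I r a3 a4] at a5
    have hb : insertPos I r < b := by
      by_contra! h
      rw [insLo_of_le h] at a5
      omega
    obtain ⟨c, rfl⟩ : ∃ c, b = c + 1 := ⟨b - 1, by omega⟩
    rw [insLo_succ (by omega)] at a5
    have hc : ∀ x, 1 ≤ x → x < c → I.lo c ≤ x → I.rel x c := fun x x1 x2 x3 => by
      have := I.spans.le_d c (by omega) (by omega)
      exact (I.rel_iff _ _).2 (by omega)
    have hsc : c + 1 = shiftIns (insertPos I r) c := by
      unfold shiftIns
      rw [if_neg (by omega)]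
    rcases lt_trichotomy a (insertPos I r) with h | h | h
    · refine .single (Or.inr ⟨a, c, by omega, hc a a1 (by omega) (by split_ifs at a5 <;> omega),
        ?_, hsc⟩)
      unfold shiftIns
      rw [if_pos h]
    · rcases eq_or_lt_of_le (show insertPos I r ≤ c by omega) with h' | h'
      · exact .single (Or.inl ⟨h, by omega, by omega⟩)
      · refine .head (Or.inl ⟨h, rfl, by omega⟩) (.single (Or.inr ⟨insertPos I r, c, h',
          hc _ h1 h' (by split_ifs at a5 <;> omega), ?_, hsc⟩))
        unfold shiftIns
        rw [if_neg (by omega)]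
    · refine .single (Or.inr ⟨a - 1, c, by omega,
        hc _ (by omega) (by omega) (by split_ifs at a5 <;> omega), ?_, hsc⟩)
      unfold shiftIns
      rw [if_neg (by omega)]
      omega
  · have hstep : ∀ u v, ((u = insertPos I r ∧ v = insertPos I r + 1 ∧
        insertPos I r + 1 ≤ I.n + 1) ∨ ∃ a' b', a' < b' ∧ I.rel a' b' ∧
        u = shiftIns (insertPos I r) a' ∧ v = shiftIns (insertPos I r) b') →
        (insertVertex I r).rel u v := by
      rintro u v (⟨rfl, rfl, h⟩ | ⟨a', b', hab', hrel, rfl, rfl⟩)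
      · have := (insertVertex I r).spans.le_d (insertPos I r + 1) (by omega) h
        have := I.spans.l_le (insertPos I r) h1 (by omega)
        refine ((insertVertex I r).rel_iff _ _).2 ⟨h1, ?_, by omega, h, ?_, by omega⟩
        · rw [insertVertex_n]
          omega
        · rw [insertVertex_lo I r (by omega) h, insLo_succ le_rfl]
          split_ifs
          omega
      · obtain ⟨c1, c2, c3, c4, c5, c6⟩ := (I.rel_iff _ _).1 hrel
        have hb : insertPos I r ≤ b' := by
          by_contra! h
          have := lo_of_le_ir I c3 (by omega)
          omega
        have hb' : shiftIns (insertPos I r) b' = b' + 1 := by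
          unfold shiftIns
          rw [if_neg (by omega)]
        have := (insertVertex I r).spans.le_d (b' + 1) (by omega) (by rw [insertVertex_n]; omega)
        rw [hb']
        refine ((insertVertex I r).rel_iff _ _).2 ?_
        rw [insertVertex_n, insertVertex_lo I r (by omega) (by omega), insLo_succ hb]
        unfold shiftIns
        split_ifs <;> omega
    exact Relation.TransGen.trans_induction_on (motive := fun {u v} _ => (insertVertex I r).rel u v)
      htr (fun huv => hstep _ _ huv) fun _ _ h h' => (insertVertex I r).trans h h'
  · have hs1 : 1 ≤ shiftIns (insertPos I r) v := by
      unfold shiftIns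
      split_ifs <;> omega
    have hs2 : shiftIns (insertPos I r) v ≤ I.n + 1 := by
      unfold shiftIns
      split_ifs <;> omega
    rw [decChildCount_eq _ hs1 hs2, decChildCount_eq _ hv1 hv2, insertVertex_hi I r hs1 hs2,
      ← I.spans.ncard_children_insHi hv1 hv2 (k := insertPos I r)]
    congr 1
    have := (insertVertex I r).spans.d_le _ hs1 hs2
    rw [insertVertex_n, insertVertex_hi I r hs1 hs2] at this
    exact windowRoots_congr fun u hu1 hu2 => insertVertex_hi I r (by omega) (by omega)

/-! ### Merging -/

/-- Lower ends of the principal ideals after insertion of a block of `m` vertices after `a`. -/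
def mergeLo (a m : ℕ) (l l' : ℕ → ℕ) (v : ℕ) : ℕ :=
  if v ≤ a then v else if v ≤ a + m then l' (v - a) + a
  else if l (v - m) ≤ a then l (v - m) else l (v - m) + m

/-- Upper ends of the principal ideals after insertion of a block of `m` vertices after `a`. -/
def mergeHi (a m : ℕ) (d d' : ℕ → ℕ) (v : ℕ) : ℕ :=
  if v ≤ a then (if d v < a then d v else d v + m) else if v ≤ a + m then d' (v - a) + a
  else d (v - m) + m

section merge

variable {a m : ℕ} {l l' d d' : ℕ → ℕ}

theorem mergeLo_of_le {v : ℕ} (h : v ≤ a) : mergeLo a m l l' v = v := if_pos h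

theorem mergeLo_block {v : ℕ} (h1 : 1 ≤ v) (h2 : v ≤ m) :
    mergeLo a m l l' (v + a) = l' v + a := by
  unfold mergeLo
  rw [if_neg (by omega), if_pos (by omega), Nat.add_sub_cancel]

theorem mergeLo_of_gt {v : ℕ} (h : a < v) :
    mergeLo a m l l' (v + m) = if l v ≤ a then l v else l v + m := by
  unfold mergeLo
  rw [if_neg (by omega), if_neg (by omega), Nat.add_sub_cancel]

theorem mergeHi_of_le {v : ℕ} (h : v ≤ a) :
    mergeHi a m d d' v = if d v < a then d v else d v + m := if_pos h

theorem mergeHi_block {v : ℕ} (h1 : 1 ≤ v) (h2 : v ≤ m) :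
    mergeHi a m d d' (v + a) = d' v + a := by
  unfold mergeHi
  rw [if_neg (by omega), if_pos (by omega), Nat.add_sub_cancel]

theorem mergeHi_of_gt {v : ℕ} (h : a < v) : mergeHi a m d d' (v + m) = d v + m := by
  unfold mergeHi
  rw [if_neg (by omega), if_neg (by omega), Nat.add_sub_cancel]

theorem merge_cases (a m v : ℕ) :
    v ≤ a ∨ (∃ u, 1 ≤ u ∧ u ≤ m ∧ v = u + a) ∨ ∃ u, a < u ∧ v = u + m := by
  rcases le_or_gt v a with h | h
  · exact Or.inl h
  · rcases le_or_gt v (a + m) with h' | h'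
    · exact Or.inr (Or.inl ⟨v - a, by omega, by omega, by omega⟩)
    · exact Or.inr (Or.inr ⟨v - m, by omega, by omega⟩)

theorem Spans.d_of_l_succ {n : ℕ} (h : Spans n l d) (ha : a ≤ n) (ha1 : 1 ≤ a)
    (hs : a < n → l (a + 1) ≤ a) : d a = a := by
  have h1 := h.le_d a ha1 ha
  have h2 := h.d_le a ha1 ha
  rcases lt_or_ge a n with h3 | h3
  · have := h.anti a (a + 1) ha1 (by omega) h3 (hs h3)
    omega
  · omega

theorem Spans.merge {n : ℕ} (h : Spans n l d) (h' : Spans m l' d') (ha : a ≤ n) :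
    Spans (n + m) (mergeLo a m l l') (mergeHi a m d d') where
  l_pos v h1 h2 := by
    rcases merge_cases a m v with h3 | ⟨u, h3, h4, rfl⟩ | ⟨u, h3, rfl⟩
    · rwa [mergeLo_of_le h3]
    · rw [mergeLo_block h3 h4]
      have := h'.l_pos u h3 h4
      omega
    · rw [mergeLo_of_gt h3]
      have := h.l_pos u (by omega) (by omega)
      split_ifs <;> omega
  l_le v h1 h2 := by
    rcases merge_cases a m v with h3 | ⟨u, h3, h4, rfl⟩ | ⟨u, h3, rfl⟩
    · rw [mergeLo_of_le h3]
    · rw [mergeLo_block h3 h4]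
      have := h'.l_le u h3 h4
      omega
    · rw [mergeLo_of_gt h3]
      have := h.l_le u (by omega) (by omega)
      split_ifs <;> omega
  le_d v h1 h2 := by
    rcases merge_cases a m v with h3 | ⟨u, h3, h4, rfl⟩ | ⟨u, h3, rfl⟩
    · rw [mergeHi_of_le h3]
      have := h.le_d v h1 (by omega)
      split_ifs <;> omega
    · rw [mergeHi_block h3 h4]
      have := h'.le_d u h3 h4
      omega
    · rw [mergeHi_of_gt h3]
      have := h.le_d u (by omega) (by omega)
      omega
  d_le v h1 h2 := by
    rcases merge_cases a m v with h3 | ⟨u, h3, h4, rfl⟩ | ⟨u, h3, rfl⟩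
    · rw [mergeHi_of_le h3]
      have := h.d_le v h1 (by omega)
      split_ifs <;> omega
    · rw [mergeHi_block h3 h4]
      have := h'.d_le u h3 h4
      omega
    · rw [mergeHi_of_gt h3]
      have := h.d_le u (by omega) (by omega)
      omega
  l_mono v w h1 h2 h3 h4 := by
    rcases merge_cases a m v with a3 | ⟨u, a3, a4, rfl⟩ | ⟨u, a3, rfl⟩ <;>
    rcases merge_cases a m w with b3 | ⟨x, b3, b4, rfl⟩ | ⟨x, b3, rfl⟩
    · rwa [mergeLo_of_le b3]
    · omega
    · omega
    · rwa [mergeLo_of_le b3]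
    · rw [mergeLo_block a3 a4] at h4
      rw [mergeLo_block a3 a4, mergeLo_block b3 b4]
      have := h'.l_mono u x b3 (by omega) (by omega) (by omega)
      omega
    · omega
    · rwa [mergeLo_of_le b3]
    · rw [mergeLo_of_gt a3] at h4
      rw [mergeLo_of_gt a3, mergeLo_block b3 b4]
      have := h'.l_pos x b3 b4
      split_ifs at h4 ⊢ <;> omega
    · rw [mergeLo_of_gt a3] at h4
      rw [mergeLo_of_gt a3, mergeLo_of_gt b3]
      have := h.l_mono u x (by omega) (by omega) (by omega) (by split_ifs at h4 <;> omega)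
      split_ifs <;> omega
  d_mono v w h1 h2 h3 h4 := by
    rcases merge_cases a m v with a3 | ⟨u, a3, a4, rfl⟩ | ⟨u, a3, rfl⟩ <;>
    rcases merge_cases a m w with b3 | ⟨x, b3, b4, rfl⟩ | ⟨x, b3, rfl⟩
    · rw [mergeHi_of_le a3] at h4
      rw [mergeHi_of_le a3, mergeHi_of_le b3]
      have := h.d_mono v w h1 h2 (by omega) (by split_ifs at h4 <;> omega)
      split_ifs <;> omega
    · rw [mergeHi_of_le a3] at h4
      rw [mergeHi_of_le a3, mergeHi_block b3 b4]
      have := h'.d_le x b3 b4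
      split_ifs at h4 ⊢ <;> omega
    · rw [mergeHi_of_le a3] at h4
      rw [mergeHi_of_le a3, mergeHi_of_gt b3]
      have := h.d_mono v x h1 (by omega) (by omega) (by split_ifs at h4 <;> omega)
      split_ifs at h4 ⊢ <;> omega
    · omega
    · rw [mergeHi_block a3 a4] at h4
      rw [mergeHi_block a3 a4, mergeHi_block b3 b4]
      have := h'.d_mono u x a3 (by omega) (by omega) (by omega)
      omega
    · rw [mergeHi_block a3 a4] at h4
      have := h'.d_le u a3 a4
      omega
    · omega
    · omega
    · rw [mergeHi_of_gt a3] at h4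
      rw [mergeHi_of_gt a3, mergeHi_of_gt b3]
      have := h.d_mono u x (by omega) (by omega) (by omega) (by omega)
      omega
  anti v w h1 h2 h3 h4 := by
    rcases merge_cases a m w with b3 | ⟨x, b3, b4, rfl⟩ | ⟨x, b3, rfl⟩
    · rw [mergeLo_of_le b3] at h4
      omega
    · rw [mergeLo_block b3 b4] at h4
      have := h'.l_pos x b3 b4
      obtain ⟨u, rfl⟩ : ∃ u, v = u + a := ⟨v - a, by omega⟩
      rw [mergeHi_block (by omega) (by omega)]
      have := h'.anti u x (by omega) (by omega) (by omega) (by omega)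
      omega
    · rw [mergeLo_of_gt b3] at h4
      rcases merge_cases a m v with a3 | ⟨u, a3, a4, rfl⟩ | ⟨u, a3, rfl⟩
      · rw [mergeHi_of_le a3]
        have := h.anti v x h1 (by omega) (by omega) (by split_ifs at h4 <;> omega)
        split_ifs <;> omega
      · rw [mergeHi_block a3 a4]
        have := h'.d_le u a3 a4
        omega
      · rw [mergeHi_of_gt a3]
        have := h.anti u x (by omega) (by omega) (by omega) (by split_ifs at h4 <;> omega)
        omega

end merge

theorem merge_spans (I K : IPoset) :
    Spans (I.n + K.n) (mergeLo (ir I) K.n I.lo K.lo) (mergeHi (ir I) K.n I.hi K.hi) :=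
  I.spans.merge K.spans (ir_le I)

/-- The merge step of the initial-rise composition. -/
noncomputable def merge (I K : IPoset) : IPoset := (merge_spans I K).toIPoset

theorem merge_n (I K : IPoset) : (merge I K).n = I.n + K.n := rfl

theorem merge_lo (I K : IPoset) {v : ℕ} (h1 : 1 ≤ v) (h2 : v ≤ I.n + K.n) :
    (merge I K).lo v = mergeLo (ir I) K.n I.lo K.lo v :=
  Spans.lo_toIPoset _ h1 h2

theorem merge_hi (I K : IPoset) {v : ℕ} (h1 : 1 ≤ v) (h2 : v ≤ I.n + K.n) :
    (merge I K).hi v = mergeHi (ir I) K.n I.hi K.hi v :=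
  Spans.hi_toIPoset _ h1 h2

theorem hi_ir (I : IPoset) (h : 1 ≤ ir I) : I.hi (ir I) = ir I :=
  I.spans.d_of_l_succ (ir_le I) h (lo_ir_succ I)

theorem ir_merge (I K : IPoset) (hK : 1 ≤ K.n) : ir (merge I K) = ir I + ir K := by
  have h1 := ir_le I
  have h2 := ir_le K
  have h3 := ir_pos K hK
  refine ir_eq (by rw [merge_n]; omega) (fun i hi1 hi2 => ?_) (fun hlt => ?_)
  · rw [merge_lo _ _ hi1 (by omega)]
    rcases le_or_gt i (ir I) with h | h
    · rw [mergeLo_of_le h]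
    · obtain ⟨u, rfl⟩ : ∃ u, i = u + ir I := ⟨i - ir I, by omega⟩
      rw [mergeLo_block (by omega) (by omega), lo_of_le_ir K (by omega) (by omega)]
  · rw [merge_n] at hlt
    rw [merge_lo _ _ (by omega) (by omega)]
    rcases h2.eq_or_lt with h | h
    · have e : ir I + ir K + 1 = ir I + 1 + K.n := by omega
      rw [e, mergeLo_of_gt (by omega)]
      have := lo_ir_succ I (by omega)
      split_ifs
      omega
    · have e : ir I + ir K + 1 = ir K + 1 + ir I := by omega
      rw [e, mergeLo_block (by omega) (by omega)]
      have := lo_ir_succ K h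
      omega

theorem trees_merge_of_pos (I K : IPoset) (hI : 1 ≤ I.n) : trees (merge I K) = trees I := by
  have h1 := ir_le I
  have h2 := ir_pos I hI
  have h3 := hi_ir I h2
  rw [trees_eq, trees_eq, merge_n,
    windowRoots_congr (d' := mergeHi (ir I) K.n I.hi K.hi)
      fun u hu1 hu2 => merge_hi I K hu1 (by omega)]
  have hinj : Function.Injective (mapMerge (ir I) K.n) := by
    intro a b hab
    unfold mapMerge at hab
    split_ifs at hab <;> omega
  rw [← Set.ncard_image_of_injective (windowRoots I.hi 0 I.n) hinj]
  congr 1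
  ext x
  constructor
  · rintro ⟨x1, x2, x3⟩
    rcases merge_cases (ir I) K.n x with h | ⟨u, u1, u2, rfl⟩ | ⟨u, u1, rfl⟩
    · refine ⟨x, ⟨x1, by omega, fun y hy1 hy2 => ?_⟩, if_pos h⟩
      have := x3 y hy1 hy2
      rw [mergeHi_of_le (by omega)] at this
      split_ifs at this <;> omega
    · have := x3 (ir I) h2 (by omega)
      rw [mergeHi_of_le le_rfl] at this
      split_ifs at this <;> omega
    · refine ⟨u, ⟨by omega, by omega, fun y hy1 hy2 => ?_⟩, if_neg (by omega)⟩
      rcases le_or_gt y (ir I) with h | h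
      · have := x3 y hy1 (by omega)
        rw [mergeHi_of_le h] at this
        split_ifs at this <;> omega
      · have := x3 (y + K.n) (by omega) (by omega)
        rw [mergeHi_of_gt h] at this
        omega
  · rintro ⟨u, ⟨u1, u2, u3⟩, rfl⟩
    unfold mapMerge
    split_ifs with h
    · refine ⟨u1, by omega, fun y hy1 hy2 => ?_⟩
      have := u3 y hy1 hy2
      rw [mergeHi_of_le (by omega)]
      split_ifs <;> omega
    · refine ⟨by omega, by omega, fun y hy1 hy2 => ?_⟩
      rcases merge_cases (ir I) K.n y with h | ⟨z, z1, z2, rfl⟩ | ⟨z, z1, rfl⟩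
      · rw [mergeHi_of_le h]
        have := u3 y hy1 (by omega)
        split_ifs <;> omega
      · rw [mergeHi_block z1 z2]
        have := K.spans.d_le z z1 z2
        omega
      · rw [mergeHi_of_gt z1]
        have := u3 z (by omega) (by omega)
        omega

theorem trees_merge_of_zero (I K : IPoset) (hI : I.n = 0) : trees (merge I K) = trees K := by
  have h1 := ir_le I
  have h0 : ir I = 0 := by omega
  rw [trees_eq, trees_eq, merge_n, hI, Nat.zero_add]
  congr 1
  refine windowRoots_congr fun u hu1 hu2 => ?_
  rw [merge_hi I K hu1 (by omega), h0]
  exact mergeHi_block (a := 0) hu1 hu2.le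

theorem merge_rel_iff (I K : IPoset) (x y : ℕ) : (merge I K).rel x y ↔ IRrel I K x y := by
  have hI := ir_le I
  have hrel := (merge I K).rel_iff x y
  rw [merge_n] at hrel
  constructor
  · intro h
    obtain ⟨h1, h2, h3, h4, h5, h6⟩ := hrel.1 h
    rw [merge_lo _ _ h3 h4] at h5
    rw [merge_hi _ _ h3 h4] at h6
    right
    have hm1 : ∀ v, v ≤ ir I → v = mapMerge (ir I) K.n v := fun v hv => (if_pos hv).symm
    have hm2 : ∀ v, ir I < v → v + K.n = mapMerge (ir I) K.n v := fun v hv =>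
      (if_neg (by omega)).symm
    rcases merge_cases (ir I) K.n y with b | ⟨v, b1, b2, rfl⟩ | ⟨v, b1, rfl⟩
    · rw [mergeLo_of_le b] at h5
      rw [mergeHi_of_le b] at h6
      have hle := I.spans.l_le y h3 (by omega)
      rcases merge_cases (ir I) K.n x with a | ⟨u, a1, a2, rfl⟩ | ⟨u, a1, rfl⟩
      · exact .single (Or.inl ⟨x, y, (I.rel_iff _ _).2 (by split_ifs at h6 <;> omega),
          hm1 x a, hm1 y b⟩)
      · refine .head (b := ir I) (Or.inr (Or.inr (by omega))) (.single (Or.inl ⟨ir I, y,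
          (I.rel_iff _ _).2 (by split_ifs at h6 <;> omega), hm1 _ le_rfl, hm1 y b⟩))
      · exact .single (Or.inl ⟨u, y, (I.rel_iff _ _).2 (by split_ifs at h6 <;> omega),
          hm2 u a1, hm1 y b⟩)
    · rw [mergeLo_block b1 b2] at h5
      rw [mergeHi_block b1 b2] at h6
      have := K.spans.l_pos v b1 b2
      have := K.spans.d_le v b1 b2
      exact .single (Or.inr (Or.inl ⟨x - ir I, v, (K.rel_iff _ _).2 (by omega), by omega, rfl⟩))
    · rw [mergeLo_of_gt b1] at h5
      rw [mergeHi_of_gt b1] at h6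
      have hle := I.spans.le_d v (by omega) (by omega)
      have hpos := I.spans.l_pos v (by omega) (by omega)
      rcases merge_cases (ir I) K.n x with a | ⟨u, a1, a2, rfl⟩ | ⟨u, a1, rfl⟩
      · exact .single (Or.inl ⟨x, v, (I.rel_iff _ _).2 (by split_ifs at h5 <;> omega),
          hm1 x a, hm2 v b1⟩)
      · refine .head (b := ir I) (Or.inr (Or.inr (by split_ifs at h5 <;> omega)))
          (.single (Or.inl ⟨ir I, v,
          (I.rel_iff _ _).2 (by split_ifs at h5 <;> omega), hm1 _ le_rfl, hm2 v b1⟩))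
      · exact .single (Or.inl ⟨u, v, (I.rel_iff _ _).2 (by split_ifs at h5 <;> omega),
          hm2 u a1, hm2 v b1⟩)
  · rintro (⟨rfl, h1, h2⟩ | h)
    · exact (merge I K).refl x h1 h2
    · refine Relation.TransGen.trans_induction_on (motive := fun {u v} _ => (merge I K).rel u v) h
        (fun {u v} huv => ?_) fun _ _ h h' => (merge I K).trans h h'
      have hrel' := (merge I K).rel_iff u v
      rw [merge_n] at hrel'
      refine hrel'.2 ?_
      rcases huv with ⟨p, q, hpq, rfl, rfl⟩ | ⟨p, q, hpq, rfl, rfl⟩ | ⟨h1, h2, h3, rfl⟩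
      · obtain ⟨c1, c2, c3, c4, c5, c6⟩ := (I.rel_iff _ _).1 hpq
        have b1 : 1 ≤ mapMerge (ir I) K.n q := by
          unfold mapMerge
          split_ifs <;> omega
        have b2 : mapMerge (ir I) K.n q ≤ I.n + K.n := by
          unfold mapMerge
          split_ifs <;> omega
        rw [merge_lo _ _ b1 b2, merge_hi _ _ b1 b2]
        rcases le_or_gt q (ir I) with h | h
        · have hlo := lo_of_le_ir I c3 h
          have hq : mapMerge (ir I) K.n q = q := if_pos h
          rw [hq, mergeLo_of_le h, mergeHi_of_le h]
          unfold mapMerge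
          split_ifs <;> omega
        · have hq : mapMerge (ir I) K.n q = q + K.n := if_neg (by omega)
          rw [hq, mergeLo_of_gt h, mergeHi_of_gt h]
          unfold mapMerge
          split_ifs <;> omega
      · obtain ⟨c1, c2, c3, c4, c5, c6⟩ := (K.rel_iff _ _).1 hpq
        rw [merge_lo _ _ (by omega) (by omega), merge_hi _ _ (by omega) (by omega),
          mergeLo_block c3 c4, mergeHi_block c3 c4]
        omega
      · rw [merge_lo _ _ (by omega) (by omega), merge_hi _ _ (by omega) (by omega),
          mergeLo_of_le le_rfl, mergeHi_of_le le_rfl, hi_ir I h1]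
        rw [if_neg (by omega)]
        omega

/-! ### The initial-rise composition -/

/-- The initial-rise composition. -/
noncomputable def irComp (I1 I2 : IPoset) (r : ℕ) : IPoset := merge I1 (insertVertex I2 r)

theorem irComp_n (I1 I2 : IPoset) (r : ℕ) : (irComp I1 I2 r).n = I1.n + I2.n + 1 := rfl

theorem isIRComp_irComp (I1 : IPoset) {I2 : IPoset} {r : ℕ} (hr : r ≤ ir I2) :
    IsIRComp I1 I2 r (irComp I1 I2 r) :=
  ⟨insertVertex I2 r, isInsert_insertVertex hr, rfl, merge_rel_iff _ _⟩

theorem ir_irComp (I1 I2 : IPoset) (r : ℕ) : ir (irComp I1 I2 r) = ir I1 + insertPos I2 r := by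
  unfold irComp
  rw [ir_merge _ _ (by rw [insertVertex_n]; omega), ir_insertVertex]

theorem trees_irComp_of_pos {I1 : IPoset} (h : 1 ≤ I1.n) (I2 : IPoset) (r : ℕ) :
    trees (irComp I1 I2 r) = trees I1 :=
  trees_merge_of_pos _ _ h

theorem trees_irComp_of_zero {I1 : IPoset} (h : I1.n = 0) (I2 : IPoset) (r : ℕ) :
    trees (irComp I1 I2 r) = trees I2 + 1 :=
  (trees_merge_of_zero _ _ h).trans (trees_insertVertex _ _)

theorem irComp_hi_of_le {I1 : IPoset} (I2 : IPoset) (r : ℕ) {v : ℕ} (h1 : 1 ≤ v)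
    (h2 : v ≤ ir I1) : (irComp I1 I2 r).hi v =
      if I1.hi v < ir I1 then I1.hi v else I1.hi v + (I2.n + 1) := by
  have := ir_le I1
  unfold irComp
  rw [merge_hi _ _ h1 (by omega), mergeHi_of_le h2, insertVertex_n]

theorem irComp_lo_block (I1 I2 : IPoset) (r : ℕ) {v : ℕ} (h1 : 1 ≤ v) (h2 : v ≤ I2.n + 1) :
    (irComp I1 I2 r).lo (v + ir I1) = insLo I2.lo (insertPos I2 r) v + ir I1 := by
  have := ir_le I1
  have hn := insertVertex_n I2 r
  unfold irComp
  rw [merge_lo _ _ (by omega) (by omega), mergeLo_block h1 (by omega), insertVertex_lo _ _ h1 h2]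

theorem irComp_hi_block (I1 I2 : IPoset) (r : ℕ) {v : ℕ} (h1 : 1 ≤ v) (h2 : v ≤ I2.n + 1) :
    (irComp I1 I2 r).hi (v + ir I1) = insHi I2.hi (insertPos I2 r) v + ir I1 := by
  have := ir_le I1
  have hn := insertVertex_n I2 r
  unfold irComp
  rw [merge_hi _ _ (by omega) (by omega), mergeHi_block h1 (by omega), insertVertex_hi _ _ h1 h2]

theorem irComp_lo_of_gt {I1 : IPoset} (I2 : IPoset) (r : ℕ) {v : ℕ} (h1 : ir I1 < v)
    (h2 : v ≤ I1.n) : (irComp I1 I2 r).lo (v + (I2.n + 1)) =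
      if I1.lo v ≤ ir I1 then I1.lo v else I1.lo v + (I2.n + 1) := by
  unfold irComp
  rw [← insertVertex_n I2 r, merge_lo _ _ (by omega) (by omega), mergeLo_of_gt h1]

theorem irComp_hi_of_gt {I1 : IPoset} (I2 : IPoset) (r : ℕ) {v : ℕ} (h1 : ir I1 < v)
    (h2 : v ≤ I1.n) : (irComp I1 I2 r).hi (v + (I2.n + 1)) = I1.hi v + (I2.n + 1) := by
  unfold irComp
  rw [← insertVertex_n I2 r, merge_hi _ _ (by omega) (by omega), mergeHi_of_gt h1]

theorem irComp_hi_ir {I1 : IPoset} (I2 : IPoset) (r : ℕ) (h : 1 ≤ ir I1) :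
    (irComp I1 I2 r).hi (ir I1) = ir I1 + (I2.n + 1) := by
  rw [irComp_hi_of_le I2 r h le_rfl, hi_ir I1 h, if_neg (by omega)]

theorem ir_le_of_irComp_eq {I1 I2 J1 J2 : IPoset} {r s : ℕ}
    (h : irComp I1 I2 r = irComp J1 J2 s) : ir J1 ≤ ir I1 := by
  by_contra! hlt
  have hI1 := ir_le I1
  have hJ1 := ir_le J1
  have hI2 := ir_le I2
  have hJ2 := ir_le J2
  have hn := congrArg IPoset.n h
  rw [irComp_n, irComp_n] at hn
  have hir := congrArg ir h
  rw [ir_irComp, ir_irComp] at hir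
  have hk := insertPos_pos I2 r
  have hk' := insertPos_le I2 r
  have hm := insertPos_pos J2 s
  have hm' := insertPos_le J2 s
  obtain ⟨v, hv⟩ : ∃ v, ir J1 = v + ir I1 := ⟨ir J1 - ir I1, by omega⟩
  have hd := irComp_hi_block I1 I2 r (v := v) (by omega) (by omega)
  rw [h, ← hv, irComp_hi_ir J2 s (by omega)] at hd
  have hvd : insertPos I2 r ≤ I2.hi v := by
    by_contra! hc
    rw [insHi_of_lt (by omega) hc] at hd
    omega
  obtain ⟨w1, w2, w3, w4⟩ := I2.spans.insHi_spec (v := v) (by omega) (by omega) hvd (by omega)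
  have hvn := I2.spans.d_le v (by omega) (by omega)
  have hl := irComp_lo_block I1 I2 r (v := insHi I2.hi (insertPos I2 r) v + 1)
    (by omega) (by omega)
  rw [insLo_succ w1] at hl
  have e : insHi I2.hi (insertPos I2 r) v + 1 + ir I1 = ir J1 + 1 + (J2.n + 1) := by omega
  have hs := lo_ir_succ J1 (by omega)
  rw [h, e, irComp_lo_of_gt J2 s (by omega) (by omega), if_pos hs] at hl
  have := I2.spans.anti v (insHi I2.hi (insertPos I2 r) v) (by omega) (by omega) (by omega)
    (by split_ifs at hl <;> omega)
  omega

theorem hi_eq_of_insHi {I : IPoset} {k v : ℕ} (h1 : 1 ≤ v) (h2 : v ≤ I.n) (hv : v < k)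
    (h : k ≤ I.hi v) :
    k ≤ insHi I.hi k v ∧ insHi I.hi k v + 1 ≤ I.n + 1 ∧
      insHi I.hi k (insHi I.hi k v + 1) = I.hi v + 1 := by
  obtain ⟨w1, w2, w3, -⟩ := I.spans.insHi_spec h1 hv h h2
  have := I.spans.d_le v h1 h2
  rw [insHi_succ w1, w3]
  omega

/-- The initial-rise composition determines its three components. -/
theorem irComp_injective {I1 I2 J1 J2 : IPoset} {r s : ℕ} (hr : r ≤ ir I2) (hs : s ≤ ir J2)
    (h : irComp I1 I2 r = irComp J1 J2 s) : I1 = J1 ∧ I2 = J2 ∧ r = s := by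
  have ha : ir I1 = ir J1 := le_antisymm (ir_le_of_irComp_eq h.symm) (ir_le_of_irComp_eq h)
  have hI1 := ir_le I1
  have hJ1 := ir_le J1
  have hI2 := ir_le I2
  have hn := congrArg IPoset.n h
  rw [irComp_n, irComp_n] at hn
  have hir := congrArg ir h
  rw [ir_irComp, ir_irComp] at hir
  have hk : insertPos I2 r = insertPos J2 s := by omega
  have hk1 := insertPos_pos I2 r
  have hk2 := insertPos_le I2 r
  have hn2 : I2.n = J2.n := by
    rcases Nat.eq_zero_or_pos (ir I1) with h0 | h0
    · have : ¬ 1 ≤ I1.n := fun hc => by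
        have := ir_pos I1 hc
        omega
      have : ¬ 1 ≤ J1.n := fun hc => by
        have := ir_pos J1 hc
        omega
      omega
    · have e := irComp_hi_ir I2 r h0
      rw [h, ha, irComp_hi_ir J2 s (by omega)] at e
      omega
  have hn1 : I1.n = J1.n := by omega
  have hlo : ∀ v, 1 ≤ v → v ≤ I2.n + 1 →
      insLo I2.lo (insertPos I2 r) v = insLo J2.lo (insertPos I2 r) v := by
    intro v h1 h2
    have e := irComp_lo_block I1 I2 r h1 h2
    rw [h, ha, irComp_lo_block J1 J2 s h1 (by omega), ← hk] at e
    omega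
  have hhi : ∀ v, 1 ≤ v → v ≤ I2.n + 1 →
      insHi I2.hi (insertPos I2 r) v = insHi J2.hi (insertPos I2 r) v := by
    intro v h1 h2
    have e := irComp_hi_block I1 I2 r h1 h2
    rw [h, ha, irComp_hi_block J1 J2 s h1 (by omega), ← hk] at e
    omega
  have h2 : I2 = J2 := by
    refine IPoset.ext_spans hn2 (fun v h1 h2 => ?_) fun v h1 h2 => ?_
    · rcases lt_or_ge v (insertPos I2 r) with hv | hv
      · have := insertPos_le J2 s
        rw [lo_of_le_ir I2 h1 (by omega), lo_of_le_ir J2 h1 (by omega)]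
      · have e := hlo (v + 1) (by omega) (by omega)
        rw [insLo_succ hv, insLo_succ hv] at e
        split_ifs at e <;> omega
    · rcases lt_or_ge v (insertPos I2 r) with hv | hv
      · have e := hhi v h1 (by omega)
        rcases lt_or_ge (I2.hi v) (insertPos I2 r) with c | c <;>
          rcases lt_or_ge (J2.hi v) (insertPos I2 r) with c' | c'
        · rwa [insHi_of_lt hv c, insHi_of_lt hv c'] at e
        · have := hi_eq_of_insHi h1 (by omega) hv c'
          rw [insHi_of_lt hv c] at e
          omega
        · have := hi_eq_of_insHi h1 h2 hv c
          rw [insHi_of_lt hv c'] at e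
          omega
        · have a1 := hi_eq_of_insHi h1 h2 hv c
          have a2 := hi_eq_of_insHi h1 (by omega) hv c'
          have := hhi _ (by omega) a1.2.1
          rw [← e] at a2
          omega
      · have e := hhi (v + 1) (by omega) (by omega)
        rw [insHi_succ hv, insHi_succ hv] at e
        omega
  subst h2
  refine ⟨?_, rfl, ?_⟩
  · refine IPoset.ext_spans hn1 (fun v h1 h2 => ?_) fun v h1 h2 => ?_
    · rcases le_or_gt v (ir I1) with hv | hv
      · rw [lo_of_le_ir I1 h1 hv, lo_of_le_ir J1 h1 (by omega)]
      · have e := irComp_lo_of_gt I2 r hv h2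
        rw [h, irComp_lo_of_gt I2 s (by omega) (by omega), ← ha] at e
        split_ifs at e <;> omega
    · rcases le_or_gt v (ir I1) with hv | hv
      · have e := irComp_hi_of_le I2 r h1 hv
        rw [h, irComp_hi_of_le I2 s h1 (by omega), ← ha] at e
        split_ifs at e <;> omega
      · have e := irComp_hi_of_gt I2 r hv h2
        rw [h, irComp_hi_of_gt I2 s (by omega) (by omega)] at e
        omega
  · unfold insertPos at hk
    omega

/-- `[1, q]` is a lower set of the final forest of `I` containing exactly the trees of its `r`
smallest roots. -/
structure IsCut (I : IPoset) (r q : ℕ) : Prop where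
  le : q ≤ I.n
  closed : ∀ u, 1 ≤ u → u ≤ q → I.hi u ≤ q
  card : (windowRoots I.hi 0 q).ncard = r

theorem exists_windowRoot_le (I : IPoset) {u : ℕ} (h1 : 1 ≤ u) (h2 : u ≤ I.n) :
    ∃ s ∈ windowRoots I.hi 0 u, u ≤ I.hi s := by
  classical
  have hex : ∃ s, 1 ≤ s ∧ u ≤ I.hi s := ⟨u, h1, I.spans.le_d u h1 h2⟩
  obtain ⟨a1, a2⟩ := Nat.find_spec hex
  refine ⟨Nat.find hex, ⟨a1, Nat.find_min' hex ⟨h1, I.spans.le_d u h1 h2⟩,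
    fun v h3 h4 => ?_⟩, a2⟩
  have hs : Nat.find hex ≤ u := Nat.find_min' hex ⟨h1, I.spans.le_d u h1 h2⟩
  by_contra! h5
  have := I.spans.d_mono v (Nat.find hex) h3 h4.le (hs.trans h2) h5
  exact Nat.find_min hex h4 ⟨h3, a2.trans this⟩

theorem windowRoots_add_ncard {d : ℕ → ℕ} {q n : ℕ} (hq : q ≤ n)
    (hc : ∀ u, 1 ≤ u → u ≤ q → d u ≤ q) :
    (windowRoots d 0 n).ncard = (windowRoots d 0 q).ncard + (windowRoots d q n).ncard := by
  rw [← Set.ncard_union_eq ?_ (windowRoots_finite _ _ _) (windowRoots_finite _ _ _)]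
  · congr 1
    ext w
    constructor
    · rintro ⟨h1, h2, h3⟩
      rcases le_or_gt w q with h | h
      · exact Or.inl ⟨h1, h, h3⟩
      · exact Or.inr ⟨h, h2, fun u h4 h5 => h3 u (by omega) h5⟩
    · rintro (⟨h1, h2, h3⟩ | ⟨h1, h2, h3⟩)
      · exact ⟨h1, h2.trans hq, h3⟩
      · refine ⟨by omega, h2, fun u h4 h5 => ?_⟩
        rcases le_or_gt u q with h | h
        · exact (hc u h4 h).trans_lt h1
        · exact h3 u h h5
  · rw [Set.disjoint_left]
    rintro w ⟨-, h1, -⟩ ⟨h2, -, -⟩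
    omega

theorem windowRoots_eq_singleton {d : ℕ → ℕ} {q n : ℕ} (h1 : q + 1 ≤ n) (h2 : n ≤ d (q + 1)) :
    windowRoots d q n = {q + 1} := by
  ext w
  rw [Set.mem_singleton_iff]
  constructor
  · rintro ⟨h3, h4, h5⟩
    by_contra hne
    have := h5 (q + 1) (by omega) (by omega)
    omega
  · rintro rfl
    exact ⟨by omega, h1, fun u _ _ => by omega⟩

theorem IsCut.trees_eq_add {I : IPoset} {r q : ℕ} (h : IsCut I r q) :
    trees I = r + (windowRoots I.hi q I.n).ncard := by
  rw [trees_eq, windowRoots_add_ncard h.le h.closed, h.card]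

theorem exists_isCut (I : IPoset) {r : ℕ} (h : r ≤ trees I) : ∃ q, IsCut I r q := by
  induction r with
  | zero =>
    refine ⟨0, Nat.zero_le _, fun u h1 h2 => by omega, ?_⟩
    rw [Set.ncard_eq_zero (windowRoots_finite _ _ _), Set.eq_empty_iff_forall_notMem]
    rintro w ⟨h1, h2, -⟩
    omega
  | succ r ih =>
    obtain ⟨q, hq⟩ := ih (by omega)
    have hlt : q < I.n := by
      by_contra! hge
      have := hq.trees_eq_add
      have he : windowRoots I.hi q I.n = ∅ := by
        rw [Set.eq_empty_iff_forall_notMem]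
        rintro w ⟨h1, h2, -⟩
        omega
      rw [he, Set.ncard_empty] at this
      omega
    have a1 := I.spans.le_d (q + 1) (by omega) hlt
    have a2 := I.spans.d_le (q + 1) (by omega) hlt
    have a3 : ∀ u, 1 ≤ u → u ≤ I.hi (q + 1) → I.hi u ≤ I.hi (q + 1) := by
      intro u h1 h2
      rcases le_or_gt u q with h3 | h3
      · have := hq.closed u h1 h3
        omega
      · exact I.spans.d_mono _ _ (by omega) h3 (by omega) h2
    refine ⟨I.hi (q + 1), a2, a3, ?_⟩
    rw [windowRoots_add_ncard (q := q) (by omega) hq.closed, hq.card]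
    rw [windowRoots_eq_singleton a1 le_rfl, Set.ncard_singleton]

theorem isDecRoot_and_le_eq (I : IPoset) {s : ℕ} (hs : s ≤ I.n) :
    {z | IsDecRoot I z ∧ z ≤ s} = windowRoots I.hi 0 s := by
  ext z
  constructor
  · rintro ⟨h, hz⟩
    obtain ⟨h1, -, h3⟩ := (isDecRoot_iff I z).1 h
    exact ⟨h1, hz, h3⟩
  · rintro ⟨h1, h2, h3⟩
    exact ⟨(isDecRoot_iff I z).2 ⟨h1, h2.trans hs, h3⟩, h2⟩

/-- The vertices below one of the `r` smallest roots form an initial segment. -/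
theorem IsCut.exists_root_iff {I : IPoset} {r q : ℕ} (h : IsCut I r q) {u : ℕ} (h1 : 1 ≤ u)
    (h2 : u ≤ I.n) :
    (∃ s, IsDecRoot I s ∧ Set.ncard {z | IsDecRoot I z ∧ z ≤ s} ≤ r ∧
      (u = s ∨ (s < u ∧ I.rel u s))) ↔ u ≤ q := by
  constructor
  · rintro ⟨s, hs, hc, hu⟩
    obtain ⟨b1, b2, b3⟩ := (isDecRoot_iff I s).1 hs
    have hsq : s ≤ q := by
      by_contra! hlt
      rw [isDecRoot_and_le_eq I b2, ← h.card] at hc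
      refine hc.not_gt (Set.ncard_lt_ncard ?_ (windowRoots_finite _ _ _))
      refine ⟨windowRoots_mono hlt.le, fun hsub => ?_⟩
      have : s ≤ q := (hsub ⟨b1, le_rfl, b3⟩).2.1
      omega
    rcases hu with rfl | ⟨-, hu⟩
    · exact hsq
    · exact (I.le_hi_of_rel hu).trans (h.closed s b1 hsq)
  · intro hu
    obtain ⟨s, ⟨c1, c2, c3⟩, c4⟩ := exists_windowRoot_le I h1 h2
    refine ⟨s, (isDecRoot_iff I s).2 ⟨c1, c2.trans h2, c3⟩, ?_, ?_⟩
    · rw [isDecRoot_and_le_eq I (c2.trans h2), ← h.card]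
      exact Set.ncard_le_ncard (windowRoots_mono (c2.trans hu)) (windowRoots_finite _ _ _)
    · rcases c2.eq_or_lt with rfl | hlt
      · exact Or.inl rfl
      · have := I.spans.l_le s c1 (c2.trans h2)
        exact Or.inr ⟨hlt, (I.rel_iff u s).2 ⟨h1, h2, c1, c2.trans h2, by omega, c4⟩⟩

/-- Lower ends of the principal ideals of the lower-contacts composition. -/
def lcLo (n : ℕ) (l l' : ℕ → ℕ) (v : ℕ) : ℕ :=
  if v ≤ n then l v else if v = n + 1 then 1 else l' (v - (n + 1)) + (n + 1)

/-- Upper ends of the principal ideals of the lower-contacts composition. -/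
def lcHi (n q : ℕ) (d d' : ℕ → ℕ) (v : ℕ) : ℕ :=
  if v ≤ n then d v else if v = n + 1 then q + (n + 1) else d' (v - (n + 1)) + (n + 1)

theorem lcLo_of_le {n : ℕ} {l l' : ℕ → ℕ} {v : ℕ} (h : v ≤ n) : lcLo n l l' v = l v := if_pos h

theorem lcLo_self {n : ℕ} {l l' : ℕ → ℕ} : lcLo n l l' (n + 1) = 1 := by simp [lcLo]

theorem lcLo_add {n : ℕ} {l l' : ℕ → ℕ} {v : ℕ} (h : 1 ≤ v) :
    lcLo n l l' (v + (n + 1)) = l' v + (n + 1) := by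
  unfold lcLo
  rw [if_neg (by omega), if_neg (by omega), Nat.add_sub_cancel]

theorem lcHi_of_le {n q : ℕ} {d d' : ℕ → ℕ} {v : ℕ} (h : v ≤ n) : lcHi n q d d' v = d v :=
  if_pos h

theorem lcHi_self {n q : ℕ} {d d' : ℕ → ℕ} : lcHi n q d d' (n + 1) = q + (n + 1) := by
  simp [lcHi]

theorem lcHi_add {n q : ℕ} {d d' : ℕ → ℕ} {v : ℕ} (h : 1 ≤ v) :
    lcHi n q d d' (v + (n + 1)) = d' v + (n + 1) := by
  unfold lcHi
  rw [if_neg (by omega), if_neg (by omega), Nat.add_sub_cancel]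

/-- Case distinction on a vertex of the lower-contacts composition. -/
theorem lc_vertex_cases {n m v : ℕ} (h : v ≤ n + m + 1) :
    v ≤ n ∨ v = n + 1 ∨ ∃ u, 1 ≤ u ∧ u ≤ m ∧ v = u + (n + 1) := by
  rcases lt_trichotomy v (n + 1) with h1 | h1 | h1
  · exact Or.inl (by omega)
  · exact Or.inr (Or.inl h1)
  · exact Or.inr (Or.inr ⟨v - (n + 1), by omega, by omega, by omega⟩)

theorem IsCut.spans_lc (I1 : IPoset) {I2 : IPoset} {r q : ℕ} (h : IsCut I2 r q) :
    Spans (I1.n + I2.n + 1) (lcLo I1.n I1.lo I2.lo) (lcHi I1.n q I1.hi I2.hi) where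
  l_pos v h1 h2 := by
    rcases lc_vertex_cases h2 with h3 | rfl | ⟨u, h3, h4, rfl⟩
    · rw [lcLo_of_le h3]
      exact I1.spans.l_pos v h1 h3
    · rw [lcLo_self]
    · rw [lcLo_add h3]
      omega
  l_le v h1 h2 := by
    rcases lc_vertex_cases h2 with h3 | rfl | ⟨u, h3, h4, rfl⟩
    · rw [lcLo_of_le h3]
      exact I1.spans.l_le v h1 h3
    · rw [lcLo_self]
      omega
    · rw [lcLo_add h3]
      have := I2.spans.l_le u h3 h4
      omega
  le_d v h1 h2 := by
    rcases lc_vertex_cases h2 with h3 | rfl | ⟨u, h3, h4, rfl⟩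
    · rw [lcHi_of_le h3]
      exact I1.spans.le_d v h1 h3
    · rw [lcHi_self]
      omega
    · rw [lcHi_add h3]
      have := I2.spans.le_d u h3 h4
      omega
  d_le v h1 h2 := by
    rcases lc_vertex_cases h2 with h3 | rfl | ⟨u, h3, h4, rfl⟩
    · rw [lcHi_of_le h3]
      have := I1.spans.d_le v h1 h3
      omega
    · rw [lcHi_self]
      have := h.le
      omega
    · rw [lcHi_add h3]
      have := I2.spans.d_le u h3 h4
      omega
  l_mono v w h1 h2 h3 h4 := by
    rcases lc_vertex_cases h3 with h5 | rfl | ⟨u, h5, h6, rfl⟩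
    · rw [lcLo_of_le h5] at h4 ⊢
      rw [lcLo_of_le (h2.trans h5)]
      exact I1.spans.l_mono v w h1 h2 h5 h4
    · rw [lcLo_self]
      rcases h2.eq_or_lt with rfl | h2
      · rw [lcLo_self]
      · rw [lcLo_of_le (by omega)]
        exact I1.spans.l_pos w h1 (by omega)
    · rw [lcLo_add h5] at h4 ⊢
      have := I2.spans.l_pos u h5 h6
      obtain ⟨w, rfl⟩ : ∃ w', w = w' + (I1.n + 1) := ⟨w - (I1.n + 1), by omega⟩
      rw [lcLo_add (by omega)]
      have := I2.spans.l_mono u w (by omega) (by omega) h6 (by omega)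
      omega
  d_mono v w h1 h2 h3 h4 := by
    rcases lc_vertex_cases (h2.trans h3) with h5 | rfl | ⟨u, h5, h6, rfl⟩
    · rw [lcHi_of_le h5] at h4 ⊢
      have := I1.spans.d_le v h1 h5
      rw [lcHi_of_le (h4.trans this)]
      exact I1.spans.d_mono v w h1 h2 (by omega) h4
    · rw [lcHi_self] at h4 ⊢
      rcases h2.eq_or_lt with rfl | h2
      · rw [lcHi_self]
      · obtain ⟨w, rfl⟩ : ∃ w', w = w' + (I1.n + 1) := ⟨w - (I1.n + 1), by omega⟩
        rw [lcHi_add (by omega)]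
        have := h.closed w (by omega) (by omega)
        omega
    · rw [lcHi_add h5] at h4 ⊢
      obtain ⟨w, rfl⟩ : ∃ w', w = w' + (I1.n + 1) := ⟨w - (I1.n + 1), by omega⟩
      rw [lcHi_add (by omega)]
      have := I2.spans.d_mono u w h5 (by omega) (by omega) (by omega)
      omega
  anti a b h1 h2 h3 h4 := by
    rcases lc_vertex_cases h3 with h5 | rfl | ⟨u, h5, h6, rfl⟩
    · rw [lcLo_of_le h5] at h4
      rw [lcHi_of_le (by omega)]
      exact I1.spans.anti a b h1 h2 h5 h4
    · rw [lcHi_of_le (by omega)]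
      have := I1.spans.d_le a h1 (by omega)
      omega
    · rw [lcLo_add h5] at h4
      have := I2.spans.l_pos u h5 h6
      obtain ⟨a, rfl⟩ : ∃ a', a = a' + (I1.n + 1) := ⟨a - (I1.n + 1), by omega⟩
      rw [lcHi_add (by omega)]
      have := I2.spans.anti a u (by omega) (by omega) h6 (by omega)
      omega

theorem IsCut.LCrel_iff (I1 : IPoset) {I2 : IPoset} {r q : ℕ} (h : IsCut I2 r q) (x y : ℕ) :
    LCrel I1 I2 r x y ↔ 1 ≤ x ∧ x ≤ I1.n + I2.n + 1 ∧ 1 ≤ y ∧ y ≤ I1.n + I2.n + 1 ∧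
      lcLo I1.n I1.lo I2.lo y ≤ x ∧ x ≤ lcHi I1.n q I1.hi I2.hi y := by
  have hq := h.le
  dsimp only [LCrel]
  have hl : (y = I1.n + 1 ∧ I1.n + 1 < x ∧ x ≤ I1.n + 1 + I2.n ∧
      ∃ s, IsDecRoot I2 s ∧ Set.ncard {z | IsDecRoot I2 z ∧ z ≤ s} ≤ r ∧
        (x - (I1.n + 1) = s ∨ (s < x - (I1.n + 1) ∧ I2.rel (x - (I1.n + 1)) s))) ↔
      y = I1.n + 1 ∧ I1.n + 1 < x ∧ x ≤ I1.n + 1 + q := by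
    constructor
    · rintro ⟨h1, h2, h3, h4⟩
      have := (h.exists_root_iff (by omega) (by omega)).1 h4
      omega
    · rintro ⟨h1, h2, h3⟩
      exact ⟨h1, h2, by omega, (h.exists_root_iff (by omega) (by omega)).2 (by omega)⟩
  rw [hl, I1.rel_iff x y, I2.rel_iff (x - (I1.n + 1)) (y - (I1.n + 1))]
  by_cases hy : y ≤ I1.n + I2.n + 1
  swap
  · omega
  rcases lc_vertex_cases hy with h3 | rfl | ⟨u, h3, h4, rfl⟩
  · rw [lcLo_of_le h3, lcHi_of_le h3]
    rcases Nat.eq_zero_or_pos y with rfl | h1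
    · omega
    · have := I1.spans.d_le y h1 h3
      omega
  · rw [lcLo_self, lcHi_self]
    omega
  · rw [lcLo_add h3, lcHi_add h3, Nat.add_sub_cancel]
    have := I2.spans.l_pos u h3 h4
    have := I2.spans.d_le u h3 h4
    omega

/-- `J` is the lower-contacts composition `LC(I1, I2, r)`. -/
structure IsLC (I1 I2 : IPoset) (r : ℕ) (J : IPoset) : Prop where
  le_trees : r ≤ trees I2
  size : J.n = I1.n + I2.n + 1
  rel_iff : ∀ x y, J.rel x y ↔ LCrel I1 I2 r x y

namespace IsLC

variable {I1 I2 J : IPoset} {r : ℕ}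

theorem exists_isCut (h : IsLC I1 I2 r J) : ∃ q, IsCut I2 r q ∧
    (∀ v, 1 ≤ v → v ≤ J.n → J.lo v = lcLo I1.n I1.lo I2.lo v) ∧
    ∀ v, 1 ≤ v → v ≤ J.n → J.hi v = lcHi I1.n q I1.hi I2.hi v := by
  obtain ⟨q, hq⟩ := _root_.exists_isCut I2 h.le_trees
  have hs := hq.spans_lc I1
  have hr : ∀ x y, J.rel x y ↔ _ := fun x y => (h.rel_iff x y).trans (hq.LCrel_iff I1 x y)
  rw [← h.size] at hs
  simp only [← h.size] at hr
  exact ⟨q, hq, fun v h1 h2 => IPoset.lo_eq hs hr h1 h2, fun v h1 h2 => IPoset.hi_eq hs hr h1 h2⟩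

theorem trees_add (h : IsLC I1 I2 r J) : trees J + r = trees I1 + 1 + trees I2 := by
  obtain ⟨q, hq, -, hh⟩ := h.exists_isCut
  have hn := h.size
  have hqn := hq.le
  have hk : J.hi (I1.n + 1) = q + (I1.n + 1) := by rw [hh _ (by omega) (by omega), lcHi_self]
  have hl : ∀ u, 1 ≤ u → u ≤ I1.n → J.hi u = I1.hi u := fun u h1 h2 => by
    rw [hh u h1 (by omega), lcHi_of_le h2]
  have hu : ∀ u, 1 ≤ u → u ≤ I2.n → J.hi (u + (I1.n + 1)) = I2.hi u + (I1.n + 1) :=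
    fun u h1 h2 => by rw [hh _ (by omega) (by omega), lcHi_add h1]
  have hle : ∀ u, 1 ≤ u → u ≤ I1.n → J.hi u ≤ I1.n := fun u h1 h2 => by
    rw [hl u h1 h2]
    exact I1.spans.d_le u h1 h2
  have hN : J.n = I2.n + (I1.n + 1) := by omega
  rw [trees_eq J, hq.trees_eq_add, hN, windowRoots_add_ncard (q := q + (I1.n + 1)) (by omega),
    windowRoots_shift (d := I2.hi) fun u h1 h2 => hu u (by omega) (by omega),
    Set.ncard_image_of_injective _ (add_left_injective _),
    windowRoots_add_ncard (q := I1.n) (by omega) hle,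
    windowRoots_eq_singleton (by omega) hk.ge, Set.ncard_singleton,
    windowRoots_congr (d' := I1.hi) (fun u h1 h2 => hl u h1 h2.le), ← trees_eq I1]
  · omega
  · intro u h1 h2
    rcases lc_vertex_cases (n := I1.n) (m := I2.n) (v := u) (by omega) with
      h3 | rfl | ⟨w, h3, h4, rfl⟩
    · have := hle u h1 h3
      omega
    · exact hk.le
    · rw [hu w h3 h4]
      have := hq.closed w h3 (by omega)
      omega

theorem ir_of_pos (h : IsLC I1 I2 r J) (h1 : 1 ≤ I1.n) : ir J = ir I1 := by
  obtain ⟨q, hq, hl, -⟩ := h.exists_isCut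
  have hn := h.size
  have hir := ir_le I1
  refine ir_eq (by omega) (fun i h2 h3 => ?_) fun _ => ?_
  · rw [hl i h2 (by omega), lcLo_of_le (by omega), lo_of_le_ir I1 h2 h3]
  · rw [hl _ (by omega) (by omega)]
    rcases hir.eq_or_lt with he | hlt
    · rw [he, lcLo_self]
      exact h1
    · rw [lcLo_of_le hlt]
      exact lo_ir_succ I1 hlt

theorem ir_of_zero (h : IsLC I1 I2 r J) (h1 : I1.n = 0) : ir J = ir I2 + 1 := by
  obtain ⟨q, hq, hl, -⟩ := h.exists_isCut
  have hn := h.size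
  have hir := ir_le I2
  rw [h1] at hl
  refine ir_eq (by omega) (fun i h2 h3 => ?_) fun h2 => ?_
  · rw [hl i h2 (by omega)]
    rcases h2.eq_or_lt with rfl | h2
    · exact lcLo_self
    · obtain ⟨i, rfl⟩ : ∃ j, i = j + (0 + 1) := ⟨i - 1, by omega⟩
      rw [lcLo_add (by omega), lo_of_le_ir I2 (by omega) (by omega)]
  · have e := hl (ir I2 + 1 + (0 + 1)) (by omega) h2
    rw [lcLo_add (by omega)] at e
    have := lo_ir_succ I2 (by omega)
    rw [zero_add] at e
    omega

theorem size_le {I1' I2' : IPoset} {r' : ℕ} (h : IsLC I1 I2 r J) (h' : IsLC I1' I2' r' J) :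
    I1'.n ≤ I1.n := by
  by_contra! hlt
  obtain ⟨-, -, hl, -⟩ := h.exists_isCut
  obtain ⟨-, -, hl', -⟩ := h'.exists_isCut
  have hn := h.size
  have hn' := h'.size
  have e := hl' (I1'.n + 1) (by omega) (by omega)
  obtain ⟨u, hu⟩ : ∃ u, I1'.n + 1 = u + (I1.n + 1) := ⟨I1'.n - I1.n, by omega⟩
  rw [lcLo_self, hu, hl _ (by omega) (by omega), lcLo_add (by omega)] at e
  have := I2.spans.l_pos u (by omega) (by omega)
  omega

/-- The lower-contacts decomposition is unique. -/
theorem unique {I1' I2' : IPoset} {r' : ℕ} (h : IsLC I1 I2 r J) (h' : IsLC I1' I2' r' J) :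
    I1 = I1' ∧ I2 = I2' ∧ r = r' := by
  have hn1 : I1.n = I1'.n := le_antisymm (h'.size_le h) (h.size_le h')
  obtain ⟨q, -, hl, hh⟩ := h.exists_isCut
  obtain ⟨q', -, hl', hh'⟩ := h'.exists_isCut
  have hn := h.size
  have hn' := h'.size
  have e1 : I1 = I1' := by
    refine IPoset.ext_spans hn1 (fun v h1 h2 => ?_) fun v h1 h2 => ?_
    · have e := hl v h1 (by omega)
      rwa [hl' v h1 (by omega), lcLo_of_le h2, lcLo_of_le (by omega), eq_comm] at e
    · have e := hh v h1 (by omega)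
      rwa [hh' v h1 (by omega), lcHi_of_le h2, lcHi_of_le (by omega), eq_comm] at e
  subst e1
  have e2 : I2 = I2' := by
    refine IPoset.ext_spans (by omega) (fun v h1 h2 => ?_) fun v h1 h2 => ?_
    · have e := hl (v + (I1.n + 1)) (by omega) (by omega)
      rw [hl' _ (by omega) (by omega), lcLo_add h1, lcLo_add h1] at e
      omega
    · have e := hh (v + (I1.n + 1)) (by omega) (by omega)
      rw [hh' _ (by omega) (by omega), lcHi_add h1, lcHi_add h1] at e
      omega
  subst e2
  have := h.trees_add
  have := h'.trees_add
  exact ⟨rfl, rfl, by omega⟩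

theorem eq_of_eq {J' : IPoset} (h : IsLC I1 I2 r J) (h' : IsLC I1 I2 r J') : J = J' :=
  IPoset.ext_rel_s10 (h.size.trans h'.size.symm) fun x y => (h.rel_iff x y).trans (h'.rel_iff x y).symm

end IsLC

/-- Every nonempty interval-poset has a lower-contacts decomposition. -/
theorem exists_isLC (J : IPoset) (hJ : J.n ≠ 0) : ∃ I1 I2 r, IsLC I1 I2 r J := by
  classical
  obtain ⟨m, hmn, hm1, hm⟩ : ∃ m, m + 1 ≤ J.n ∧ J.lo (m + 1) ≤ 1 ∧
      ∀ v, m + 1 < v → v ≤ J.n → 1 < J.lo v := by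
    have h1 : 1 ≤ Nat.findGreatest (fun v => J.lo v ≤ 1) J.n :=
      Nat.le_findGreatest (by omega) (J.spans.l_le 1 le_rfl (by omega))
    obtain ⟨m, hm⟩ : ∃ m, Nat.findGreatest (fun v => J.lo v ≤ 1) J.n = m + 1 :=
      ⟨_, (Nat.sub_add_cancel h1).symm⟩
    obtain ⟨a1, a2, a3⟩ := Nat.findGreatest_eq_iff.1 hm
    exact ⟨m, a1, a2 (by omega), fun v h2 h3 => not_le.1 (a3 h2 h3)⟩
  have hlt : ∀ v, 1 ≤ v → v ≤ m → J.hi v ≤ m := fun v h1 h2 =>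
    Nat.le_of_lt_succ (J.spans.anti v (m + 1) h1 (by omega) hmn (by omega))
  have hgt : ∀ v, m + 1 < v → v ≤ J.n → m + 1 < J.lo v := fun v h1 h2 => by
    by_contra! h3
    have := J.spans.l_mono v (m + 1) (by omega) h1.le h2 h3
    have := hm v h1 h2
    omega
  have s1 : Spans m J.lo J.hi :=
    { l_pos := fun v h1 h2 => J.spans.l_pos v h1 (by omega)
      l_le := fun v h1 h2 => J.spans.l_le v h1 (by omega)
      le_d := fun v h1 h2 => J.spans.le_d v h1 (by omega)
      d_le := hlt
      l_mono := fun v w h1 h2 h3 => J.spans.l_mono v w h1 h2 (by omega)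
      d_mono := fun v w h1 h2 h3 => J.spans.d_mono v w h1 h2 (by omega)
      anti := fun a b h1 h2 h3 => J.spans.anti a b h1 h2 (by omega) }
  have s2 : Spans (J.n - (m + 1)) (fun v => J.lo (v + (m + 1)) - (m + 1))
      (fun v => J.hi (v + (m + 1)) - (m + 1)) :=
    { l_pos := fun v h1 h2 => by
        have := hgt (v + (m + 1)) (by omega) (by omega)
        omega
      l_le := fun v h1 h2 => by
        have := J.spans.l_le (v + (m + 1)) (by omega) (by omega)
        omega
      le_d := fun v h1 h2 => by
        have := J.spans.le_d (v + (m + 1)) (by omega) (by omega)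
        omega
      d_le := fun v h1 h2 => by
        have := J.spans.d_le (v + (m + 1)) (by omega) (by omega)
        omega
      l_mono := fun v w h1 h2 h3 h4 => by
        have := J.spans.l_mono (v + (m + 1)) (w + (m + 1)) (by omega) (by omega) (by omega)
          (by omega)
        omega
      d_mono := fun v w h1 h2 h3 h4 => by
        have := J.spans.d_mono (v + (m + 1)) (w + (m + 1)) (by omega) (by omega) (by omega)
          (by omega)
        omega
      anti := fun a b h1 h2 h3 h4 => by
        have := J.spans.anti (a + (m + 1)) (b + (m + 1)) (by omega) (by omega) (by omega)
          (by omega)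
        omega }
  have b1 := J.spans.le_d (m + 1) (by omega) hmn
  have b2 := J.spans.d_le (m + 1) (by omega) hmn
  have hn1 : s1.toIPoset.n = m := rfl
  have hn2 : s2.toIPoset.n = J.n - (m + 1) := rfl
  have hcut : IsCut s2.toIPoset _ (J.hi (m + 1) - (m + 1)) :=
    { le := by omega
      closed := fun u h1 h2 => by
        rw [s2.hi_toIPoset h1 (by omega)]
        have := J.spans.d_mono (m + 1) (u + (m + 1)) (by omega) (by omega) (by omega) (by omega)
        omega
      card := rfl }
  refine ⟨s1.toIPoset, s2.toIPoset,
    (windowRoots s2.toIPoset.hi 0 (J.hi (m + 1) - (m + 1))).ncard, ?_, by omega, fun x y => ?_⟩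
  · rw [hcut.trees_eq_add]
    exact Nat.le_add_right _ _
  · rw [hcut.LCrel_iff, J.rel_iff]
    have hN : s1.toIPoset.n + s2.toIPoset.n + 1 = J.n := by omega
    rw [hN]
    refine and_congr_right fun _ => and_congr_right fun _ => and_congr_right fun h1 =>
      and_congr_right fun h2 => ?_
    rcases lc_vertex_cases (n := m) (m := J.n - (m + 1)) (v := y) (by omega) with
      h3 | rfl | ⟨u, h3, h4, rfl⟩
    · rw [lcLo_of_le (by omega), lcHi_of_le (by omega), s1.lo_toIPoset h1 h3,
        s1.hi_toIPoset h1 h3]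
    · rw [hn1, lcLo_self, lcHi_self]
      have := J.spans.l_pos (m + 1) h1 h2
      omega
    · rw [hn1, lcLo_add h3, lcHi_add h3, s2.lo_toIPoset h3 h4, s2.hi_toIPoset h3 h4]
      have := hgt (u + (m + 1)) (by omega) h2
      have := J.spans.le_d (u + (m + 1)) h1 h2
      omega

open scoped Classical in
/-- The bijection defined recursively by `β(∅) = ∅` and
`β(LC(I₁, I₂, r)) = IR(β(I₁), β(I₂), r)`. -/
noncomputable def beta (J : IPoset) : IPoset :=
  if h : ∃ I1 I2 r, IsLC I1 I2 r J then
    irComp (beta h.choose) (beta h.choose_spec.choose) h.choose_spec.choose_spec.choose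
  else J
termination_by J.n
decreasing_by
  all_goals
    have := h.choose_spec.choose_spec.choose_spec.size
    omega

theorem IsLC.beta_eq {I1 I2 J : IPoset} {r : ℕ} (h : IsLC I1 I2 r J) :
    beta J = irComp (beta I1) (beta I2) r := by
  have hex : ∃ I1 I2 r, IsLC I1 I2 r J := ⟨I1, I2, r, h⟩
  rw [beta, dif_pos hex]
  obtain ⟨h1, h2, h3⟩ := hex.choose_spec.choose_spec.choose_spec.unique h
  have hcongr : ∀ K1 K2 s, K1 = I1 → K2 = I2 → s = r →
      irComp (beta K1) (beta K2) s = irComp (beta I1) (beta I2) r := by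
    rintro _ _ _ rfl rfl rfl
    rfl
  exact hcongr _ _ _ h1 h2 h3

theorem beta_of_n_eq_zero {J : IPoset} (h : J.n = 0) : beta J = J := by
  rw [beta, dif_neg]
  rintro ⟨I1, I2, r, hlc⟩
  have := hlc.size
  omega

/-- Induction along the lower-contacts decomposition. -/
theorem IsLC.induction {motive : IPoset → Prop} (zero : ∀ J : IPoset, J.n = 0 → motive J)
    (comp : ∀ I1 I2 r J, IsLC I1 I2 r J → motive I1 → motive I2 → motive J) (J : IPoset) :
    motive J := by
  induction hn : J.n using Nat.strong_induction_on generalizing J with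
  | _ n ih =>
    rcases Nat.eq_zero_or_pos J.n with h0 | h0
    · exact zero J h0
    · obtain ⟨I1, I2, r, h⟩ := exists_isLC J h0.ne'
      have := h.size
      exact comp I1 I2 r J h (ih I1.n (by omega) I1 rfl) (ih I2.n (by omega) I2 rfl)

theorem beta_n (J : IPoset) : (beta J).n = J.n := by
  induction J using IsLC.induction with
  | zero J h => rw [beta_of_n_eq_zero h]
  | comp I1 I2 r J h h1 h2 => rw [h.beta_eq, irComp_n, h1, h2, h.size]

theorem ir_of_n_eq_zero {J : IPoset} (h : J.n = 0) : ir J = 0 :=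
  Nat.eq_zero_of_le_zero (h ▸ ir_le J)

theorem trees_of_n_eq_zero {J : IPoset} (h : J.n = 0) : trees J = 0 := by
  rw [trees_eq, Set.ncard_eq_zero (windowRoots_finite _ _ _), Set.eq_empty_iff_forall_notMem]
  rintro w ⟨h1, h2, -⟩
  omega

theorem beta_stats (J : IPoset) : trees (beta J) = ir J ∧ ir (beta J) = trees J := by
  induction J using IsLC.induction with
  | zero J h =>
    rw [beta_of_n_eq_zero h, ir_of_n_eq_zero h, trees_of_n_eq_zero h]
    exact ⟨rfl, rfl⟩
  | comp I1 I2 r J h h1 h2 =>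
    have hr := h.le_trees
    rw [h.beta_eq]
    constructor
    · rcases Nat.eq_zero_or_pos I1.n with h0 | h0
      · rw [trees_irComp_of_zero ((beta_n I1).trans h0), h.ir_of_zero h0, h2.1]
      · rw [trees_irComp_of_pos ((beta_n I1).symm ▸ h0), h.ir_of_pos h0, h1.1]
    · have := h.trees_add
      rw [ir_irComp, insertPos, h1.2, h2.2]
      omega

theorem beta_injective : Function.Injective beta := by
  intro J
  induction J using IsLC.induction with
  | zero J h =>
    intro J' e
    have h' : J'.n = 0 := by rw [← beta_n, ← e, beta_n, h]
    rwa [beta_of_n_eq_zero h, beta_of_n_eq_zero h'] at e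
  | comp I1 I2 r J h h1 h2 =>
    intro J' e
    have hn : J'.n = J.n := by rw [← beta_n, ← e, beta_n]
    have := h.size
    obtain ⟨I1', I2', r', h'⟩ := exists_isLC J' (by omega)
    rw [h.beta_eq, h'.beta_eq] at e
    obtain ⟨e1, e2, rfl⟩ := irComp_injective (by rw [(beta_stats I2).2]; exact h.le_trees)
      (by rw [(beta_stats I2').2]; exact h'.le_trees) e
    obtain rfl := h1 e1
    obtain rfl := h2 e2
    exact h.eq_of_eq h'

theorem beta_surjective : Function.Surjective beta := by
  intro J
  have := IPoset.finite_size J.n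
  let f (I : {I : IPoset // I.n = J.n}) : {I : IPoset // I.n = J.n} :=
    ⟨beta I.1, (beta_n I.1).trans I.2⟩
  have hf : Function.Injective f := fun I I' e =>
    Subtype.ext (beta_injective (congrArg Subtype.val e))
  obtain ⟨I, hI⟩ := Finite.surjective_of_injective hf ⟨J, rfl⟩
  exact ⟨I.1, congrArg Subtype.val hI⟩

/-- There is a bijection `β` on interval-posets, preserving the size, defined
recursively by `β(∅) = ∅` and `β(LC(I₁,I₂,r)) = IR(β(I₁), β(I₂), r)`, which
exchanges the statistics `trees` and `ir`: if `trees I = a` and `ir I = b`,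
then `trees (β I) = b` and `ir (β I) = a`. -/
theorem beta_exchanges_statistics :
    ∃ β : IPoset → IPoset,
      Function.Bijective β ∧
      (∀ I, (β I).n = I.n) ∧
      (∀ I1 I2 : IPoset, ∀ r : ℕ, ∀ J : IPoset, r ≤ trees I2 →
        J.n = I1.n + I2.n + 1 → (∀ x y, J.rel x y ↔ LCrel I1 I2 r x y) →
        IsIRComp (β I1) (β I2) r (β J)) ∧
      (∀ I, trees (β I) = ir I ∧ ir (β I) = trees I) := by
  refine ⟨beta, ⟨beta_injective, beta_surjective⟩, beta_n, ?_, beta_stats⟩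
  intro I1 I2 r J hr hn hrel
  rw [IsLC.beta_eq ⟨hr, hn, hrel⟩]
  exact isIRComp_irComp (beta I1) (by rwa [(beta_stats I2).2])
end
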